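/- For any 0 < ξ < 1 and all integers k ≥ 4 and 1 ≤ ℓ < k/2 there exists γ > 0 such that the following holds for sufficiently large n: if H is a k-uniform hypergraph on n vertices with n divisible by k−ℓ, H is not (ℓ,ξ)-extremal, and δ_{k−2}(H) ≥ ((4(k−ℓ)−1)/(4(k−ℓ)²) − γ)·C(n,2), then H contains a Hamiltonian ℓ-cycle. -/

import Mathlib

open Finset

/-- `E` is the edge set of a `k`-uniform hypergraph on vertex set `Fin n`:
every edge is a `k`-element set of vertices. -/
def Uniform (n k : ℕ) (E : Finset (Finset (Fin n))) : Prop :=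
  ∀ e ∈ E, e.card = k

/-- The degree `d(S)` of a vertex set `S`: the number of edges containing `S`. -/
def deg {n : ℕ} (E : Finset (Finset (Fin n))) (S : Finset (Fin n)) : ℕ :=
  (E.filter fun e => S ⊆ e).card

/-- The minimum `s`-degree `δ_s(H)`: the minimum of `d(S)` over all `s`-element
vertex sets `S`. -/
noncomputable def minDeg (n : ℕ) (E : Finset (Finset (Fin n))) (s : ℕ) : ℕ :=
  sInf {d | ∃ S : Finset (Fin n), S.card = s ∧ deg E S = d}

/-- `d(L, X^(i) Y^(j))`: the number of edges of the form `L ∪ I ∪ J` with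
`I ∈ X^(i)`, `J ∈ Y^(j)` (take `Y = ∅`, `j = 0` when `Y^(j)` is omitted). -/
def degIn {n : ℕ} (E : Finset (Finset (Fin n))) (L X Y : Finset (Fin n)) (i j : ℕ) : ℕ :=
  (E.filter fun e =>
    L ⊆ e ∧ e \ L ⊆ X ∪ Y ∧ ((e \ L) ∩ X).card = i ∧ ((e \ L) ∩ Y).card = j).card

/-- The `i`-th edge of an ℓ-cycle given by the cyclic ordering `f` of the `n`
vertices: `k` cyclically consecutive vertices starting at position `i * (k - ℓ)`. -/
def cycEdge (n k ℓ : ℕ) (f : ℕ → Fin n) (i : ℕ) : Finset (Fin n) :=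
  (Finset.range k).image fun j => f ((i * (k - ℓ) + j) % n)

/-- `H = (Fin n, E)` contains a Hamiltonian ℓ-cycle: there is a cyclic ordering of
all `n` vertices such that each of the `n / (k - ℓ)` windows of `k` consecutive
vertices (consecutive windows overlapping in `ℓ` vertices) is an edge, and two
consecutive edges share exactly `ℓ` vertices. -/
def HasHamCycle (n k ℓ : ℕ) (E : Finset (Finset (Fin n))) : Prop :=
  ∃ f : ℕ → Fin n, Set.InjOn f (Set.Iio n) ∧
    (∀ i < n / (k - ℓ), cycEdge n k ℓ f i ∈ E) ∧
    (∀ i < n / (k - ℓ),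
      (cycEdge n k ℓ f i ∩ cycEdge n k ℓ f ((i + 1) % (n / (k - ℓ)))).card = ℓ)

/-- The `i`-th edge of an ℓ-path given by the linear ordering `f`. -/
def pathEdge (n k ℓ : ℕ) (f : ℕ → Fin n) (i : ℕ) : Finset (Fin n) :=
  (Finset.range k).image fun j => f (i * (k - ℓ) + j)

/-- `f` is (the linear ordering of the vertices of) an ℓ-path with `t` edges all of
which belong to `E`: the path has `t * (k - ℓ) + ℓ` vertices, every edge consists of
`k` consecutive vertices and two consecutive edges intersect in exactly `ℓ` vertices. -/
def IsPath (n k ℓ t : ℕ) (E : Finset (Finset (Fin n))) (f : ℕ → Fin n) : Prop :=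
  Set.InjOn f (Set.Iio (t * (k - ℓ) + ℓ)) ∧ ∀ i < t, pathEdge n k ℓ f i ∈ E

/-- The vertex set of the ℓ-path described by `f` with `t` edges. -/
def pathVerts (n k ℓ t : ℕ) (f : ℕ → Fin n) : Finset (Fin n) :=
  (Finset.range (t * (k - ℓ) + ℓ)).image f

/-- The first end (first `ℓ` vertices) of the ℓ-path described by `f`. -/
def pathEnd0 (n ℓ : ℕ) (f : ℕ → Fin n) : Finset (Fin n) :=
  (Finset.range ℓ).image f

/-- The last end (last `ℓ` vertices) of the ℓ-path described by `f` with `t` edges. -/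
def pathEnd1 (n k ℓ t : ℕ) (f : ℕ → Fin n) : Finset (Fin n) :=
  (Finset.Ico (t * (k - ℓ)) (t * (k - ℓ) + ℓ)).image f

/-- The extremal hypergraph `X_{k,ℓ}(n)` on `Fin n`.  If `n` is an odd multiple of
`k - ℓ`, take `A` to be the first `⌊n / (2(k-ℓ))⌋` vertices and all `k`-sets meeting
`A` as edges.  If `n` is an even multiple of `k - ℓ`, take `A` to be the first
`n / (2(k-ℓ)) - 1` vertices, fix the `ℓ + 1` following vertices (which lie in
`B = V ∖ A`), and take as edges all `k`-sets meeting `A` together with all `k`-subsets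
of `B` containing all `ℓ + 1` fixed vertices. -/
def Xedges (n k ℓ : ℕ) : Finset (Finset (Fin n)) :=
  if Odd (n / (k - ℓ)) then
    (Finset.powersetCard k (Finset.univ : Finset (Fin n))).filter fun e =>
      ∃ v ∈ e, (v : ℕ) < n / (2 * (k - ℓ))
  else
    (Finset.powersetCard k (Finset.univ : Finset (Fin n))).filter fun e =>
      (∃ v ∈ e, (v : ℕ) < n / (2 * (k - ℓ)) - 1) ∨
      ((∀ v ∈ e, n / (2 * (k - ℓ)) - 1 ≤ (v : ℕ)) ∧
        ∀ w : Fin n, n / (2 * (k - ℓ)) - 1 ≤ (w : ℕ) → (w : ℕ) < n / (2 * (k - ℓ)) + ℓ →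
          w ∈ e)

/-- `e(B)`: the number of edges lying entirely inside `B`. -/
def edgesIn {n : ℕ} (E : Finset (Finset (Fin n))) (B : Finset (Fin n)) : ℕ :=
  (E.filter fun e => e ⊆ B).card

/-- `(A, B)` is an `(ℓ,ξ)`-extremal partition of the vertex set:
`|A| = ⌈n/(2(k-ℓ))⌉ - 1`, `|B| = ⌊(2(k-ℓ)-1)n/(2(k-ℓ)) + 1⌋` and
`e(B) ≤ ξ · C(n,k)`. -/
def IsExtremalPartition (n k ℓ : ℕ) (E : Finset (Finset (Fin n))) (ξ : ℝ)
    (A B : Finset (Fin n)) : Prop :=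
  Disjoint A B ∧ A ∪ B = Finset.univ ∧
  A.card = ⌈(n : ℝ) / (2 * ((k - ℓ : ℕ) : ℝ))⌉₊ - 1 ∧
  B.card = ⌊(2 * ((k - ℓ : ℕ) : ℝ) - 1) * (n : ℝ) / (2 * ((k - ℓ : ℕ) : ℝ)) + 1⌋₊ ∧
  (edgesIn E B : ℝ) ≤ ξ * (n.choose k : ℝ)

/-- `H` is `(ℓ,ξ)`-extremal. -/
def IsExtremal (n k ℓ : ℕ) (E : Finset (Finset (Fin n))) (ξ : ℝ) : Prop :=
  ∃ A B, IsExtremalPartition n k ℓ E ξ A B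

/-- `(A, B)` is a minimal `(ℓ,ξ)`-extremal partition: among all `(ℓ,ξ)`-extremal
partitions it minimises `e(B)`. -/
def IsMinExtremalPartition (n k ℓ : ℕ) (E : Finset (Finset (Fin n))) (ξ : ℝ)
    (A B : Finset (Fin n)) : Prop :=
  IsExtremalPartition n k ℓ E ξ A B ∧
  ∀ A' B' : Finset (Fin n), IsExtremalPartition n k ℓ E ξ A' B' →
    edgesIn E B ≤ edgesIn E B'

open scoped Classical in
/-- `A_ε`: the set of vertices `v` with `d(v, B^(k-1)) ≥ (1-ε)·C(|B|, k-1)`. -/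
noncomputable def Aeps (n k : ℕ) (E : Finset (Finset (Fin n))) (B : Finset (Fin n)) (ε : ℝ) :
    Finset (Fin n) :=
  Finset.univ.filter fun v =>
    (1 - ε) * (B.card.choose (k - 1) : ℝ) ≤ (degIn E {v} B ∅ (k - 1) 0 : ℝ)

open scoped Classical in
/-- `B_ε`: the set of vertices `v` with `d(v, B^(k-1)) ≤ ε·C(|B|, k-1)`. -/
noncomputable def Beps (n k : ℕ) (E : Finset (Finset (Fin n))) (B : Finset (Fin n)) (ε : ℝ) :
    Finset (Fin n) :=
  Finset.univ.filter fun v =>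
    (degIn E {v} B ∅ (k - 1) 0 : ℝ) ≤ ε * (B.card.choose (k - 1) : ℝ)

/-- `V_ε = V ∖ (A_ε ∪ B_ε)`. -/
noncomputable def Veps (n k : ℕ) (E : Finset (Finset (Fin n))) (B : Finset (Fin n)) (ε : ℝ) :
    Finset (Fin n) :=
  Finset.univ \ (Aeps n k E B ε ∪ Beps n k E B ε)

/-- `L` is an ε-typical ℓ-set: `L ⊆ B_ε`, `|L| = ℓ` and
`d(L, B^(k-ℓ)) ≤ ε·C(|B|, k-ℓ)`. -/
def IsTypical (n k ℓ : ℕ) (E : Finset (Finset (Fin n))) (B : Finset (Fin n)) (ε : ℝ)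
    (L : Finset (Fin n)) : Prop :=
  L.card = ℓ ∧ L ⊆ Beps n k E B ε ∧
    (degIn E L B ∅ (k - ℓ) 0 : ℝ) ≤ ε * (B.card.choose (k - ℓ) : ℝ)

section Proportion

open scoped Classical in
/-- The proportion of elements of a finite type satisfying `P`. -/
noncomputable def pr {α : Type*} [Fintype α] (P : α → Prop) : ℝ :=
  (∑ x, if P x then (1 : ℝ) else 0) / Fintype.card α

variable {α β : Type*} [Fintype α] [Fintype β]

open scoped Classical in
theorem pr_eq_card (P : α → Prop) : pr P = (#{x | P x} : ℝ) / Fintype.card α := by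
  simp [pr]

theorem pr_nonneg (P : α → Prop) : 0 ≤ pr P := by
  classical
  unfold pr
  positivity

theorem pr_mono {P Q : α → Prop} (h : ∀ x, P x → Q x) : pr P ≤ pr Q := by
  classical
  unfold pr
  gcongr with x
  by_cases hp : P x
  · simp [hp, h x hp]
  · simp only [hp, if_false]; positivity

theorem pr_congr {P Q : α → Prop} (h : ∀ x, P x ↔ Q x) : pr P = pr Q :=
  le_antisymm (pr_mono fun x => (h x).1) (pr_mono fun x => (h x).2)

theorem pr_le_one (P : α → Prop) : pr P ≤ 1 := by
  classical
  rw [pr_eq_card]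
  apply div_le_one_of_le₀ _ (by positivity)
  exact_mod_cast Finset.card_le_univ _

theorem pr_true [Nonempty α] : pr (fun _ : α => True) = 1 := by
  simp [pr]

theorem pr_or_le (P Q : α → Prop) : pr (fun x => P x ∨ Q x) ≤ pr P + pr Q := by
  classical
  unfold pr
  rw [← add_div, ← Finset.sum_add_distrib]
  gcongr with x
  by_cases hp : P x <;> by_cases hq : Q x <;> simp [hp, hq]

theorem pr_and_not_ge (P Q : α → Prop) : pr P - pr Q ≤ pr (fun x => P x ∧ ¬ Q x) := by
  have h := pr_or_le (fun x => P x ∧ ¬ Q x) Q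
  have h2 : pr P ≤ pr (fun x => (P x ∧ ¬ Q x) ∨ Q x) := pr_mono fun x hx => by tauto
  linarith

theorem pr_exists_le {ι : Type*} (s : Finset ι) (P : ι → α → Prop) :
    pr (fun x => ∃ i ∈ s, P i x) ≤ ∑ i ∈ s, pr (P i) := by
  classical
  induction s using Finset.induction_on with
  | empty => simp [pr]
  | insert a s ha ih =>
    rw [Finset.sum_insert ha]
    calc pr (fun x => ∃ i ∈ insert a s, P i x) ≤ pr (fun x => P a x ∨ ∃ i ∈ s, P i x) :=
          pr_mono fun x => by simp
      _ ≤ _ := (pr_or_le _ _).trans (by gcongr)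

theorem exists_of_pr_pos {P : α → Prop} (h : 0 < pr P) : ∃ x, P x := by
  by_contra hn
  push Not at hn
  simp [pr, hn] at h

theorem pr_prod (R : α → β → Prop) :
    pr (fun x : α × β => R x.1 x.2) = (∑ a, pr (R a)) / Fintype.card α := by
  classical
  unfold pr
  rw [Fintype.sum_prod_type, ← Finset.sum_div, Fintype.card_prod, Nat.cast_mul, div_div, mul_comm]

theorem pr_prod_ge {P : α → Prop} {Q : α → β → Prop} {p c : ℝ} (hc : 0 ≤ c) (hp : p ≤ pr P)
    (h : ∀ a, P a → c ≤ pr (Q a)) : p * c ≤ pr (fun x : α × β => P x.1 ∧ Q x.1 x.2) := by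
  classical
  rw [pr_prod (fun a b => P a ∧ Q a b)]
  calc p * c ≤ pr P * c := by gcongr
    _ = (∑ a, if P a then c else 0) / Fintype.card α := by
        unfold pr
        rw [div_mul_eq_mul_div, Finset.sum_mul]
        simp
    _ ≤ _ := by
        gcongr with a
        by_cases ha : P a
        · simpa [ha] using h a ha
        · simp [ha, pr]

theorem pr_prod_le {Q : α → β → Prop} {c : ℝ} (hc : 0 ≤ c)
    (h : ∀ a, pr (Q a) ≤ c) : pr (fun x : α × β => Q x.1 x.2) ≤ c := by
  rw [pr_prod]
  apply div_le_of_le_mul₀ (by positivity) hc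
  calc ∑ a, pr (Q a) ≤ ∑ _a : α, c := Finset.sum_le_sum fun a _ => h a
    _ = _ := by simp [mul_comm]

theorem pr_equiv (e : α ≃ β) (P : β → Prop) : pr (fun x => P (e x)) = pr P := by
  classical
  unfold pr
  rw [Fintype.card_congr e, Equiv.sum_comp e (fun x => if P x then (1:ℝ) else 0)]

theorem pr_fst [Nonempty β] (P : α → Prop) : pr (fun x : α × β => P x.1) = pr P := by
  rw [pr_prod (fun a _ => P a)]
  classical
  unfold pr
  congr 1
  apply Finset.sum_congr rfl
  intro a _
  by_cases h : P a <;> simp [h]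

theorem pr_snd [Nonempty α] (P : β → Prop) : pr (fun x : α × β => P x.2) = pr P := by
  rw [← pr_fst (β := α) P, ← pr_equiv (Equiv.prodComm α β)]
  rfl

theorem pr_swap (R : α → β → Prop) :
    pr (fun x : β × α => R x.2 x.1) = pr (fun x : α × β => R x.1 x.2) :=
  pr_equiv (Equiv.prodComm β α) (fun x : α × β => R x.1 x.2)

/-- Cauchy–Schwarz: doubling one coordinate squares the proportion at worst. -/
theorem pr_doubling (R : α → β → Prop) :
    pr (fun x : α × β => R x.1 x.2) ^ 2 ≤
      pr (fun x : (α × α) × β => R x.1.1 x.2 ∧ R x.1.2 x.2) := by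
  classical
  have h1 : pr (fun x : α × β => R x.1 x.2) = (∑ b, pr (fun a => R a b)) / Fintype.card β := by
    rw [← pr_swap, pr_prod (fun b a => R a b)]
  have h2 : pr (fun x : (α × α) × β => R x.1.1 x.2 ∧ R x.1.2 x.2) =
      (∑ b, pr (fun a => R a b) ^ 2) / Fintype.card β := by
    rw [← pr_swap (fun (x : α × α) b => R x.1 b ∧ R x.2 b),
      pr_prod (fun b (x : α × α) => R x.1 b ∧ R x.2 b)]
    congr 1
    apply Finset.sum_congr rfl
    intro b _
    unfold pr
    rw [Fintype.sum_prod_type, div_pow, sq, Fintype.card_prod, Finset.sum_mul_sum, Nat.cast_mul, sq]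
    congr 1
    apply Finset.sum_congr rfl
    intro x _
    apply Finset.sum_congr rfl
    intro y _
    by_cases hx : R x b <;> by_cases hy : R y b <;> simp [hx, hy]
  rw [h1, h2, div_pow]
  rcases Nat.eq_zero_or_pos (Fintype.card β) with h0 | hpos
  · simp [h0]
  have hpos' : (0:ℝ) < Fintype.card β := by exact_mod_cast hpos
  rw [div_le_div_iff₀ (by positivity) hpos']
  have := sq_sum_le_card_mul_sum_sq (s := (univ : Finset β)) (f := fun b => pr (fun a => R a b))
  rw [Finset.card_univ] at this
  nlinarith

/-- Reverse Markov inequality for proportions. -/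
theorem pr_markov (R : α → β → Prop) {p : ℝ} (hp : 0 ≤ p)
    (h : p ≤ pr (fun x : α × β => R x.1 x.2)) : p / 2 ≤ pr (fun a => p / 2 ≤ pr (R a)) := by
  classical
  rw [pr_prod] at h
  rcases isEmpty_or_nonempty α with hα | hα
  · simp at h
    have : p = 0 := le_antisymm h hp
    simp [this, pr]
  have hpos' : (0:ℝ) < Fintype.card α := by exact_mod_cast Fintype.card_pos
  have h3 : (∑ a, pr (R a)) / Fintype.card α ≤ pr (fun a => p / 2 ≤ pr (R a)) + p / 2 := by
    rw [div_le_iff₀ hpos']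
    have : (pr (fun a => p / 2 ≤ pr (R a)) + p / 2) * Fintype.card α =
        ∑ a, ((if p / 2 ≤ pr (R a) then (1:ℝ) else 0) + p / 2) := by
      rw [Finset.sum_add_distrib, add_mul, pr, div_mul_cancel₀ _ hpos'.ne']
      simp [mul_comm]
    rw [this]
    apply Finset.sum_le_sum
    intro a _
    split_ifs with h'
    · linarith [pr_le_one (R a)]
    · push Not at h'; linarith
  linarith

theorem pr_pi {ι : Type*} [Fintype ι] [DecidableEq ι] (P : ι → α → Prop) :
    pr (fun g : ι → α => ∀ i, P i (g i)) = ∏ i, pr (P i) := by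
  classical
  unfold pr
  rw [Finset.prod_div_distrib, Finset.prod_univ_sum]
  simp only [Fintype.piFinset_univ, Fintype.card_fun, Finset.prod_const, Finset.card_univ,
    Nat.cast_pow]
  congr 1
  apply Finset.sum_congr rfl
  intro g _
  by_cases h : ∀ i, P i (g i)
  · simp [h]
  · rw [if_neg h]
    push Not at h
    obtain ⟨i, hi⟩ := h
    exact (Finset.prod_eq_zero (Finset.mem_univ i) (by simp [hi])).symm

theorem pr_proj {ι : Type*} [Fintype ι] [DecidableEq ι] (i : ι) (P : α → Prop) [Nonempty α] :
    pr (fun g : ι → α => P (g i)) = pr P := by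
  have := pr_pi (ι := ι) (fun j x => j = i → P x)
  rw [Finset.prod_eq_single i] at this
  · rw [pr_congr (Q := fun g : ι → α => P (g i))] at this
    · rw [this]; exact pr_congr (by simp)
    · intro g; simp
  · intro j _ hj
    simp [hj, pr_true]
  · simp

theorem pr_eq_const (a : α) : pr (fun x => x = a) = 1 / Fintype.card α := by
  classical
  rw [pr_eq_card, Finset.card_eq_one.2 ⟨a, by ext; simp⟩]; simp

theorem pr_mem (s : Finset α) : pr (fun x => x ∈ s) = (s.card : ℝ) / Fintype.card α := by
  classical
  rw [pr_eq_card]; simp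

/-- Resampling one coordinate does not change the distribution of a uniform tuple. -/
theorem pr_update {ι : Type*} [Fintype ι] [DecidableEq ι] (i : ι) [Nonempty α]
    (P : (ι → α) → Prop) :
    pr (fun p : (ι → α) × α => P (Function.update p.1 i p.2)) = pr P := by
  let e : (ι → α) × α ≃ (ι → α) × α :=
    { toFun := fun p => (Function.update p.1 i p.2, p.1 i)
      invFun := fun p => (Function.update p.1 i p.2, p.1 i)
      left_inv := fun p => by simp
      right_inv := fun p => by simp }
  rw [← pr_fst (β := α) P]
  exact pr_equiv e (fun x => P x.1)

end Proportion

section Tuples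

variable {V : Type*} [Fintype V] [DecidableEq V]

/-- The set of entries of a tuple. -/
def toF {ι : Type*} [Fintype ι] (x : ι → V) : Finset V := univ.image x

omit [Fintype V] in
@[simp] theorem mem_toF {ι : Type*} [Fintype ι] {x : ι → V} {v : V} : v ∈ toF x ↔ ∃ i, x i = v := by
  simp [toF]

omit [Fintype V] in
theorem card_toF_le {ι : Type*} [Fintype ι] (x : ι → V) : (toF x).card ≤ Fintype.card ι :=
  Finset.card_image_le

omit [Fintype V] in
theorem card_toF {ι : Type*} [Fintype ι] {x : ι → V} (hx : Function.Injective x) :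
    (toF x).card = Fintype.card ι := by
  rw [toF, Finset.card_image_of_injective _ hx, Finset.card_univ]

omit [Fintype V] in
theorem toF_sum {ι κ : Type*} [Fintype ι] [Fintype κ] (x : ι ⊕ κ → V) :
    toF x = toF (x ∘ Sum.inl) ∪ toF (x ∘ Sum.inr) := by
  ext v; simp

theorem pr_mem_toF_le {ι : Type*} [Fintype ι] [DecidableEq ι] (v : V) :
    pr (fun x : ι → V => v ∈ toF x) ≤ Fintype.card ι / Fintype.card V := by
  have : Nonempty V := ⟨v⟩
  calc pr (fun x : ι → V => v ∈ toF x) ≤ pr (fun x : ι → V => ∃ i ∈ univ, x i = v) :=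
        pr_mono fun x hx => by simpa using hx
    _ ≤ ∑ i : ι, pr (fun x : ι → V => x i = v) := pr_exists_le _ _
    _ = ∑ i : ι, 1 / (Fintype.card V : ℝ) :=
        Finset.sum_congr rfl fun i _ => by rw [pr_proj i (fun a => a = v), pr_eq_const]
    _ = _ := by simp [div_eq_mul_inv]

omit [Fintype V] [DecidableEq V] in
theorem pr_hit_le {T : Type*} [Fintype T] (vs : T → Finset V) {p : ℝ}
    (h : ∀ v, pr (fun g => v ∈ vs g) ≤ p) (F : Finset V) :
    pr (fun g => ¬ Disjoint (vs g) F) ≤ F.card * p := by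
  calc pr (fun g => ¬ Disjoint (vs g) F) ≤ pr (fun g => ∃ v ∈ F, v ∈ vs g) :=
        pr_mono fun g hg => by
          rw [Finset.not_disjoint_iff] at hg
          obtain ⟨v, h1, h2⟩ := hg; exact ⟨v, h2, h1⟩
    _ ≤ ∑ v ∈ F, pr (fun g => v ∈ vs g) := pr_exists_le _ _
    _ ≤ ∑ _v ∈ F, p := Finset.sum_le_sum fun v _ => h v
    _ = _ := by simp

theorem pr_toF_hit_le {ι : Type*} [Fintype ι] [DecidableEq ι] (F : Finset V) :
    pr (fun x : ι → V => ¬ Disjoint (toF x) F) ≤ F.card * (Fintype.card ι / Fintype.card V) :=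
  pr_hit_le _ pr_mem_toF_le F

omit [DecidableEq V] in
theorem pr_not_injective_le {ι : Type*} [Fintype ι] [DecidableEq ι] [Nonempty V] :
    pr (fun x : ι → V => ¬ Function.Injective x) ≤ (Fintype.card ι : ℝ) ^ 2 / Fintype.card V := by
  calc pr (fun x : ι → V => ¬ Function.Injective x)
      ≤ pr (fun x : ι → V => ∃ p ∈ (univ : Finset (ι × ι)), p.1 ≠ p.2 ∧ x p.1 = x p.2) :=
        pr_mono fun x hx => by
          unfold Function.Injective at hx
          push Not at hx
          obtain ⟨a, b, h1, h2⟩ := hx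
          exact ⟨(a, b), by simp, h2, h1⟩
    _ ≤ ∑ p : ι × ι, pr (fun x : ι → V => p.1 ≠ p.2 ∧ x p.1 = x p.2) := pr_exists_le _ _
    _ ≤ ∑ p : ι × ι, 1 / (Fintype.card V : ℝ) := by
        apply Finset.sum_le_sum
        rintro ⟨a, b⟩ -
        by_cases hab : a = b
        · simp [hab, pr]
        rw [← pr_update a]
        apply pr_prod_le (Q := fun (y : ι → V) v => (a, b).1 ≠ (a, b).2 ∧
          Function.update y a v (a, b).1 = Function.update y a v (a, b).2) (by positivity)
        intro x
        rw [← pr_eq_const (x b)]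
        exact pr_mono fun v hv => by
          have := hv.2
          simpa [Function.update_of_ne (Ne.symm hab)] using this
    _ = _ := by simp [sq, div_eq_mul_inv]

end Tuples

section Paths

variable {V : Type*} [DecidableEq V]

/-- `Lk ℓ E X Y W`: there is an `ℓ`-path with edges in `E` which starts in the `ℓ`-set `X`,
ends in the `ℓ`-set `Y`, and has the set `W` of interior vertices. -/
inductive Lk (ℓ : ℕ) (E : Finset (Finset V)) : Finset V → Finset V → Finset V → Prop
  | edge {X Y W : Finset V} (hX : X.card = ℓ) (hY : Y.card = ℓ) (hXY : Disjoint X Y)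
      (hXW : Disjoint X W) (hWY : Disjoint W Y) (he : X ∪ W ∪ Y ∈ E) : Lk ℓ E X Y W
  | trans {X Y Z W W' : Finset V} (h₁ : Lk ℓ E X Y W) (h₂ : Lk ℓ E Y Z W')
      (hd : Disjoint (X ∪ W) (W' ∪ Z)) : Lk ℓ E X Z (W ∪ Y ∪ W')

variable {ℓ k : ℕ} {E : Finset (Finset V)} {X Y Z W W' U U' : Finset V}

theorem Lk.card_left (h : Lk ℓ E X Y W) : X.card = ℓ := by
  induction h with
  | edge hX => exact hX
  | trans _ _ _ ih _ => exact ih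

theorem Lk.card_right (h : Lk ℓ E X Y W) : Y.card = ℓ := by
  induction h with
  | edge _ hY => exact hY
  | trans _ _ _ _ ih => exact ih

theorem Lk.disjoint (h : Lk ℓ E X Y W) : Disjoint X Y ∧ Disjoint X W ∧ Disjoint W Y := by
  induction h with
  | edge _ _ h1 h2 h3 => exact ⟨h1, h2, h3⟩
  | trans _ _ hd ih1 ih2 =>
    simp only [disjoint_union_left, disjoint_union_right] at *
    tauto

theorem Lk.interior_card (hE : ∀ e ∈ E, e.card = k) (hlk : 2 * ℓ < k) (h : Lk ℓ E X Y W) :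
    ∃ t, 1 ≤ t ∧ W.card + ℓ = t * (k - ℓ) := by
  induction h with
  | edge hX hY hXY hXW hWY he =>
    refine ⟨1, le_rfl, ?_⟩
    have := hE _ he
    rw [card_union_of_disjoint (by rw [disjoint_union_left]; exact ⟨hXY, hWY⟩),
      card_union_of_disjoint hXW] at this
    omega
  | trans h1 h2 hd ih1 ih2 =>
    obtain ⟨s, hs, h3⟩ := ih1
    obtain ⟨t, ht, h4⟩ := ih2
    refine ⟨s + t, by omega, ?_⟩
    have h5 := h1.disjoint
    have h6 := h2.disjoint
    have h7 := h1.card_right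
    simp only [disjoint_union_left, disjoint_union_right] at hd
    rw [card_union_of_disjoint (by rw [disjoint_union_left]; tauto),
      card_union_of_disjoint h5.2.2, add_mul]
    omega

/-- `Forest ℓ E es U`: the set `U` is partitioned into vertex disjoint paths whose pairs of ends
are listed by `es`. -/
def Forest (ℓ : ℕ) (E : Finset (Finset V)) : List (Finset V × Finset V) → Finset V → Prop
  | [], U => U = ∅
  | p :: es, U => ∃ W Z, Lk ℓ E p.1 p.2 W ∧ Disjoint (p.1 ∪ W ∪ p.2) Z ∧ Forest ℓ E es Z ∧
      U = p.1 ∪ W ∪ p.2 ∪ Z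

theorem Forest.single (h : Lk ℓ E X Y W) : Forest ℓ E [(X, Y)] (X ∪ W ∪ Y) :=
  ⟨W, ∅, h, disjoint_empty_right _, rfl, by simp⟩

theorem Forest.append {es es' : List (Finset V × Finset V)} (h : Forest ℓ E es U)
    (h' : Forest ℓ E es' U') (hd : Disjoint U U') : Forest ℓ E (es ++ es') (U ∪ U') := by
  induction es generalizing U with
  | nil =>
    obtain rfl : U = ∅ := h
    simpa using h'
  | cons p es ih =>
    obtain ⟨W, Z, h1, h2, h3, rfl⟩ := h
    rw [disjoint_union_left] at hd
    refine ⟨W, Z ∪ U', h1, ?_, ih h3 hd.2, by simp only [union_assoc]⟩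
    rw [disjoint_union_right]
    exact ⟨h2, hd.1⟩

theorem Forest.perm {es es' : List (Finset V × Finset V)} (hp : es.Perm es')
    (h : Forest ℓ E es U) : Forest ℓ E es' U := by
  induction hp generalizing U with
  | nil => exact h
  | cons p _ ih =>
    obtain ⟨W, Z, h1, h2, h3, h4⟩ := h
    exact ⟨W, Z, h1, h2, ih h3, h4⟩
  | swap q p es =>
    obtain ⟨W, _, h1, h2, ⟨W', Z, h1', h2', h3', rfl⟩, rfl⟩ := h
    rw [disjoint_union_right] at h2
    refine ⟨W', p.1 ∪ W ∪ p.2 ∪ Z, h1', ?_, ⟨W, Z, h1, ?_, h3', rfl⟩, ?_⟩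
    · rw [disjoint_union_right]; exact ⟨h2.1.symm, h2'⟩
    · exact h2.2
    · ext; simp only [mem_union]; tauto
  | trans _ _ ih1 ih2 => exact ih2 (ih1 h)

theorem Forest.ends_subset {es : List (Finset V × Finset V)} (h : Forest ℓ E es U) :
    ∀ p ∈ es, p.1 ⊆ U ∧ p.2 ⊆ U ∧ p.1.card = ℓ ∧ p.2.card = ℓ := by
  induction es generalizing U with
  | nil => simp
  | cons p es ih =>
    obtain ⟨W, Z, h1, h2, h3, rfl⟩ := h
    intro q hq
    rcases List.mem_cons.1 hq with rfl | hq
    · refine ⟨?_, ?_, h1.card_left, h1.card_right⟩ <;> intro x hx <;> simp [hx]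
    · obtain ⟨a, b, c⟩ := ih h3 q hq
      exact ⟨a.trans subset_union_right, b.trans subset_union_right, c⟩

/-- `Joins ℓ E Y es Z`: the set `Z` is partitioned into interiors of paths which connect `Y` and
the listed pairs of ends successively. -/
def Joins (ℓ : ℕ) (E : Finset (Finset V)) :
    Finset V → List (Finset V × Finset V) → Finset V → Prop
  | _, [], Z => Z = ∅
  | Y, p :: es, Z => ∃ I Z₀, Lk ℓ E Y p.1 I ∧ Disjoint I Z₀ ∧ Joins ℓ E p.2 es Z₀ ∧ Z = I ∪ Z₀

/-- The last end in a list of pairs of ends. -/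
def lastEnd : Finset V → List (Finset V × Finset V) → Finset V
  | Y, [] => Y
  | _, p :: es => lastEnd p.2 es

theorem Joins.concat {es : List (Finset V × Finset V)} (h0 : Lk ℓ E X Y W)
    (h : Forest ℓ E es U) (hJ : Joins ℓ E Y es Z) (hU : Disjoint (X ∪ W ∪ Y) U)
    (hZ : Disjoint (X ∪ W ∪ Y) Z) (hUZ : Disjoint U Z) :
    ∃ W', Lk ℓ E X (lastEnd Y es) W' ∧
      X ∪ W' ∪ lastEnd Y es = X ∪ W ∪ Y ∪ U ∪ Z := by
  induction es generalizing Y W U Z with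
  | nil =>
    obtain rfl : U = ∅ := h
    obtain rfl : Z = ∅ := hJ
    exact ⟨W, h0, by simp [lastEnd]⟩
  | cons p es ih =>
    obtain ⟨W1, U', h1, h2, h3, rfl⟩ := h
    obtain ⟨I, Z', h4, h5, h6, rfl⟩ := hJ
    have d0 := h0.disjoint
    have d1 := h1.disjoint
    have d4 := h4.disjoint
    obtain ⟨W', hW', hW''⟩ := ih (Y := p.2) (W := W ∪ Y ∪ I ∪ p.1 ∪ W1) (U := U') (Z := Z')
      (Lk.trans (Lk.trans h0 h4 (by grind [Finset.disjoint_left])) h1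
        (by grind [Finset.disjoint_left])) h3 h6
      (by grind [Finset.disjoint_left])
      (by grind [Finset.disjoint_left])
      (by grind [Finset.disjoint_left])
    refine ⟨W', hW', hW''.trans ?_⟩
    ext x
    simp only [mem_union]
    tauto

end Paths

section Cycle

variable {n k ℓ : ℕ} {E : Finset (Finset (Fin n))} {X Y W W' : Finset (Fin n)}

/-- All the windows of length `k` at multiples of `d` in `L` are edges, for the first `t`
windows. -/
def Windows {V : Type*} [DecidableEq V] (k d : ℕ) (E : Finset (Finset V)) (t : ℕ)
    (L : List V) : Prop :=
  ∀ i < t, ((L.drop (i * d)).take k).toFinset ∈ E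

theorem Windows.append {V : Type*} [DecidableEq V] {k d s t : ℕ} {E : Finset (Finset V)}
    {l₁ l₂ ly lz : List V} (h₁ : Windows k d E s (l₁ ++ ly)) (h₂ : Windows k d E t (l₂ ++ lz))
    (hp : ly <+: l₂ ++ lz) (hl : l₁.length = s * d) (hk : k ≤ d + ly.length) :
    Windows k d E (s + t) (l₁ ++ l₂ ++ lz) := by
  intro i hi
  rcases lt_or_ge i s with h | h
  · obtain ⟨r, hr⟩ := hp
    have h3 := h₁ i h
    rw [List.append_assoc, ← hr, ← List.append_assoc, List.drop_append_of_le_length,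
      List.take_append_of_le_length]
    · exact h3
    · have : (i + 1) * d ≤ s * d := Nat.mul_le_mul_right _ h
      simp only [List.length_drop, List.length_append]
      rw [add_mul] at this
      omega
    · have : (i + 1) * d ≤ s * d := Nat.mul_le_mul_right _ h
      simp only [List.length_append]
      rw [add_mul] at this
      omega
  · obtain ⟨j, rfl⟩ := Nat.exists_eq_add_of_le h
    have h3 := h₂ j (by omega)
    rw [List.append_assoc, add_mul, ← hl, ← List.drop_drop, List.drop_left]
    exact h3

theorem Lk.exists_list {V : Type*} [DecidableEq V] {k ℓ : ℕ} {E : Finset (Finset V)}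
    {X Y W : Finset V} (hE : ∀ e ∈ E, e.card = k) (hlk : 2 * ℓ < k) (h : Lk ℓ E X Y W)
    (lx : List V) (hn : lx.Nodup) (hX : lx.toFinset = X) :
    ∃ (l : List V) (t : ℕ), l.length = t * (k - ℓ) ∧ 1 ≤ t ∧ lx <+: l ∧ l.toFinset = X ∪ W ∧
      l.Nodup ∧ ∀ ly : List V, ly.Nodup → ly.toFinset = Y → Windows k (k - ℓ) E t (l ++ ly) := by
  induction h generalizing lx with
  | @edge X Y W hXc hYc hXY hXW hWY he =>
    subst hX
    have hk := hE _ he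
    rw [card_union_of_disjoint (by rw [disjoint_union_left]; exact ⟨hXY, hWY⟩),
      card_union_of_disjoint hXW] at hk
    have hlx : lx.length = ℓ := by rw [← hXc, List.toFinset_card_of_nodup hn]
    refine ⟨lx ++ W.toList, 1, ?_, le_rfl, List.prefix_append _ _, by simp, ?_, ?_⟩
    · simp only [List.length_append, length_toList, one_mul, hlx]
      omega
    · rw [List.nodup_append']
      refine ⟨hn, nodup_toList _, ?_⟩
      intro a ha hb
      exact disjoint_left.1 hXW (List.mem_toFinset.2 ha) (mem_toList.1 hb)
    · intro ly hly hY i hi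
      obtain rfl : i = 0 := by omega
      rw [zero_mul, List.drop_zero, List.take_of_length_le]
      · simpa [hY] using he
      · have : ly.length = ℓ := by rw [← hYc, ← hY, List.toFinset_card_of_nodup hly]
        simp only [List.length_append, length_toList]
        omega
  | @trans X Y Z W W' h1 h2 hd ih1 ih2 =>
    obtain ⟨l1, s, a1, a2, a3, a4, a5, a6⟩ := ih1 lx hn hX
    obtain ⟨l2, t, b1, b2, b3, b4, b5, b6⟩ := ih2 Y.toList (nodup_toList _) (by simp)
    refine ⟨l1 ++ l2, s + t, by simp [a1, b1, add_mul], by omega, a3.trans (List.prefix_append _ _),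
      by rw [List.toFinset_append, a4, b4]; simp only [union_assoc], ?_, ?_⟩
    · rw [List.nodup_append']
      refine ⟨a5, b5, ?_⟩
      intro a ha hb
      have h3 : a ∈ X ∪ W := by rw [← a4]; simpa using ha
      have h4 : a ∈ Y ∪ W' := by rw [← b4]; simpa using hb
      have d1 := h1.disjoint
      revert h3 h4
      have : Disjoint (X ∪ W) (Y ∪ W') := by grind [Finset.disjoint_left]
      exact fun h3 h4 => disjoint_left.1 this h3 h4
    · intro lz hlz hZ
      refine Windows.append (a6 _ (nodup_toList Y) (by simp)) (b6 lz hlz hZ)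
        (b3.trans (List.prefix_append _ _)) a1 ?_
      rw [length_toList, h1.card_right]
      omega

theorem hasHamCycle_of_lk (hE : Uniform n k E) (hlk : 2 * ℓ < k) (hn : 2 * k ≤ n)
    (h₁ : Lk ℓ E X Y W) (h₂ : Lk ℓ E Y X W') (hd : Disjoint (X ∪ W ∪ Y) W')
    (hu : X ∪ W ∪ Y ∪ W' = univ) : HasHamCycle n k ℓ E := by
  obtain ⟨l1, s, a1, a2, a3, a4, a5, a6⟩ := h₁.exists_list hE hlk X.toList (nodup_toList _) (by simp)
  obtain ⟨l2, t, b1, b2, b3, b4, b5, b6⟩ := h₂.exists_list hE hlk Y.toList (nodup_toList _) (by simp)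
  have hlx : X.toList.length = ℓ := by rw [length_toList, h₁.card_left]
  have hnd : (l1 ++ l2).Nodup := by
    rw [List.nodup_append']
    refine ⟨a5, b5, ?_⟩
    intro a ha hb
    have h3 : a ∈ X ∪ W := by rw [← a4]; simpa using ha
    have h4 : a ∈ Y ∪ W' := by rw [← b4]; simpa using hb
    have d1 := h₁.disjoint
    revert h3 h4
    have : Disjoint (X ∪ W) (Y ∪ W') := by grind [Finset.disjoint_left]
    exact fun h3 h4 => disjoint_left.1 this h3 h4
  have hall : (l1 ++ l2).toFinset = univ := by
    rw [List.toFinset_append, a4, b4, ← hu]; simp only [union_assoc]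
  have hlen : (l1 ++ l2).length = n := by
    rw [← List.toFinset_card_of_nodup hnd, hall, card_univ, Fintype.card_fin]
  have hw : Windows k (k - ℓ) E (s + t) (l1 ++ l2 ++ X.toList) := by
    refine Windows.append (a6 _ (nodup_toList Y) (by simp)) (b6 _ (nodup_toList X) (by simp))
      (b3.trans (List.prefix_append _ _)) a1 ?_
    rw [length_toList, h₁.card_right]
    omega
  have hst : (s + t) * (k - ℓ) = n := by
    rw [List.length_append] at hlen
    rw [add_mul]; omega
  have hpre : X.toList <+: l1 ++ l2 := a3.trans (List.prefix_append _ _)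
  generalize hL : l1 ++ l2 = l at *
  have hkl : 0 < k - ℓ := by omega
  have hdiv : n / (k - ℓ) = s + t := by rw [← hst, Nat.mul_div_cancel _ hkl]
  have hn0 : 0 < n := by omega
  have hlt : ∀ j, j % n < l.length := fun j => by rw [hlen]; exact Nat.mod_lt _ hn0
  let f : ℕ → Fin n := fun j => l[j % n]'(hlt j)
  have hf : ∀ a b, f a = f b → a % n = b % n := by
    intro a b hab
    exact (List.Nodup.getElem_inj_iff hnd).1 hab
  have hfm : ∀ a, f (a % n) = f a := by
    intro a
    simp only [f, Nat.mod_mod]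
  have hext : ∀ j, ∀ hj : j < (l ++ X.toList).length, (l ++ X.toList)[j] = f j := by
    intro j hj
    simp only [List.length_append, hlen, hlx] at hj
    rcases lt_or_ge j n with h | h
    · rw [List.getElem_append_left (by omega)]
      simp only [f, Nat.mod_eq_of_lt h]
    · rw [List.getElem_append_right (by omega)]
      have : j % n = j - n := by
        rw [Nat.mod_eq_sub_mod h, Nat.mod_eq_of_lt (by omega)]
      simp only [f, this, hlen]
      exact hpre.getElem _
  refine ⟨f, ?_, ?_, ?_⟩
  · intro a ha b hb hab
    have := hf a b hab
    rwa [Nat.mod_eq_of_lt ha, Nat.mod_eq_of_lt hb] at this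
  · intro i hi
    rw [hdiv] at hi
    have hw' := hw i hi
    convert hw' using 1
    have hle : i * (k - ℓ) + (k - ℓ) ≤ n := by
      rw [← hst, ← Nat.succ_mul]; exact Nat.mul_le_mul_right _ hi
    ext v
    simp only [cycEdge, mem_image, mem_range, hfm, List.mem_toFinset, List.mem_take_iff_getElem,
      List.getElem_drop, hext, List.length_drop, List.length_append, hlen, hlx]
    constructor
    · rintro ⟨j, hj, rfl⟩
      exact ⟨j, by omega, rfl⟩
    · rintro ⟨j, hj, rfl⟩
      exact ⟨j, by omega, rfl⟩
  · intro i hi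
    rw [hdiv] at hi ⊢
    have hA : ∀ j, cycEdge n k ℓ f j = (Ico (j * (k - ℓ)) (j * (k - ℓ) + k)).image f := by
      intro j
      ext v
      simp only [cycEdge, mem_image, mem_range, hfm, mem_Ico]
      constructor
      · rintro ⟨a, ha, rfl⟩; exact ⟨j * (k - ℓ) + a, by omega, rfl⟩
      · rintro ⟨a, ha, rfl⟩; exact ⟨a - j * (k - ℓ), by omega, by congr 1; omega⟩
    have hB : cycEdge n k ℓ f ((i + 1) % (s + t)) = cycEdge n k ℓ f (i + 1) := by
      rcases lt_or_ge (i + 1) (s + t) with h | h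
      · rw [Nat.mod_eq_of_lt h]
      · have : i + 1 = s + t := by omega
        rw [this, Nat.mod_self]
        simp only [cycEdge, hst, zero_mul, zero_add, Nat.add_mod_left]
    have hinj : ∀ a b, b ≤ a + n → Set.InjOn f (Ico a b) := by
      intro a b hb x hx y hy hxy
      simp only [coe_Ico, Set.mem_Ico] at hx hy
      have := hf x y hxy
      rcases le_total x y with h | h
      · have h2 := (Nat.modEq_iff_dvd' h).1 this
        rcases Nat.eq_zero_or_pos (y - x) with h3 | h3
        · omega
        · have := Nat.le_of_dvd h3 h2; omega
      · have h2 := (Nat.modEq_iff_dvd' h).1 this.symm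
        rcases Nat.eq_zero_or_pos (x - y) with h3 | h3
        · omega
        · have := Nat.le_of_dvd h3 h2; omega
    rw [hB]
    have h1 : (cycEdge n k ℓ f i).card = k := by
      rw [hA, card_image_of_injOn (hinj _ _ (by omega)), Nat.card_Ico]; omega
    have h2 : (cycEdge n k ℓ f (i + 1)).card = k := by
      rw [hA, card_image_of_injOn (hinj _ _ (by omega)), Nat.card_Ico]; omega
    have h3 : (cycEdge n k ℓ f i ∪ cycEdge n k ℓ f (i + 1)).card = 2 * k - ℓ := by
      rw [hA, hA, ← image_union]
      have : Ico (i * (k - ℓ)) (i * (k - ℓ) + k) ∪ Ico ((i + 1) * (k - ℓ)) ((i + 1) * (k - ℓ) + k) =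
          Ico (i * (k - ℓ)) (i * (k - ℓ) + (2 * k - ℓ)) := by
        ext x
        simp only [mem_union, mem_Ico, add_mul, one_mul]
        omega
      rw [this, card_image_of_injOn (hinj _ _ (by omega)), Nat.card_Ico]; omega
    have h4 := card_union_add_card_inter (cycEdge n k ℓ f i) (cycEdge n k ℓ f (i + 1))
    omega

end Cycle

section Extension

variable {V : Type*} [Fintype V] [DecidableEq V]

/-- Every `(k-2)`-set is completed to an edge by at least a proportion `d` of ordered pairs. -/
def DegCond (d : ℝ) (k : ℕ) (E : Finset (Finset V)) : Prop :=
  ∀ S : Finset V, S.card = k - 2 → d ≤ pr (fun p : V × V => insert p.1 (insert p.2 S) ∈ E)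

/-- The tuple `Z` extends `S` to an edge, is injective and avoids `S` and `F`. -/
def Extends {ι : Type*} [Fintype ι] (E : Finset (Finset V)) (S F : Finset V) (Z : ι → V) : Prop :=
  S ∪ toF Z ∈ E ∧ Function.Injective Z ∧ Disjoint S (toF Z) ∧ Disjoint (toF Z) F

variable {k : ℕ} {E : Finset (Finset V)} {d : ℝ}

omit [Fintype V] in
theorem injective_of_union_toF {ι : Type*} [Fintype ι] {S : Finset V} {Z : ι → V}
    (h : S.card + Fintype.card ι ≤ (S ∪ toF Z).card) :
    Function.Injective Z ∧ Disjoint S (toF Z) := by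
  have h1 := card_union_add_card_inter S (toF Z)
  have h2 := card_toF_le Z
  constructor
  · have h3 : (toF Z).card = Fintype.card ι := by omega
    rw [toF, ← card_univ, card_image_iff] at h3
    exact fun a b hab => h3 (by simp) (by simp) hab
  · rw [disjoint_iff_inter_eq_empty, ← card_eq_zero]; omega

theorem pr_pick {ι : Type*} [Fintype ι] [DecidableEq ι] [Nonempty V] (F : Finset V) :
    1 - ((Fintype.card ι : ℝ) ^ 2 + F.card * Fintype.card ι) / Fintype.card V ≤
      pr (fun Z : ι → V => Function.Injective Z ∧ Disjoint (toF Z) F) := by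
  have h1 := pr_and_not_ge (fun _ : ι → V => True)
    (fun Z => ¬ Function.Injective Z ∨ ¬ Disjoint (toF Z) F)
  rw [pr_true] at h1
  have h2 := pr_or_le (fun Z : ι → V => ¬ Function.Injective Z) (fun Z => ¬ Disjoint (toF Z) F)
  have h3 := pr_not_injective_le (V := V) (ι := ι)
  have h4 := pr_toF_hit_le (ι := ι) F
  have h5 : pr (fun Z : ι → V => True ∧ ¬ (¬ Function.Injective Z ∨ ¬ Disjoint (toF Z) F)) =
      pr (fun Z : ι → V => Function.Injective Z ∧ Disjoint (toF Z) F) :=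
    pr_congr fun Z => by tauto
  rw [h5] at h1
  rw [add_div, mul_div_assoc]
  linarith

theorem pr_pick_half {ι : Type*} [Fintype ι] [DecidableEq ι] [Nonempty V] (F : Finset V)
    (hn : 2 * ((Fintype.card ι : ℝ) ^ 2 + F.card * Fintype.card ι) ≤ Fintype.card V) :
    1 / 2 ≤ pr (fun Z : ι → V => Function.Injective Z ∧ Disjoint (toF Z) F) := by
  refine le_trans ?_ (pr_pick F)
  have : (0:ℝ) < Fintype.card V := by exact_mod_cast Fintype.card_pos
  have h : ((Fintype.card ι : ℝ) ^ 2 + F.card * Fintype.card ι) / Fintype.card V ≤ 1 / 2 := by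
    rw [div_le_iff₀ this]; linarith
  linarith

omit [Fintype V] [DecidableEq V] in
theorem pr_update₂ [Fintype V] {ι : Type*} [Fintype ι] [DecidableEq ι] [Nonempty V] (j i : ι)
    (P : (ι → V) → Prop) :
    pr (fun p : (ι → V) × (V × V) => P (Function.update (Function.update p.1 j p.2.1) i p.2.2)) =
      pr P := by
  rw [← pr_update i P, ← pr_equiv (Equiv.prodAssoc (ι → V) V V)]
  change pr (fun p : ((ι → V) × V) × V =>
    P (Function.update (Function.update p.1.1 j p.1.2) i p.2)) = _
  rw [← pr_swap
    (fun (p : (ι → V) × V) v => P (Function.update (Function.update p.1 j p.2) i v)),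
    ← pr_swap (fun (p : ι → V) v => P (Function.update p i v)),
    pr_prod (fun v (p : (ι → V) × V) => P (Function.update (Function.update p.1 j p.2) i v)),
    pr_prod (fun v (p : ι → V) => P (Function.update p i v))]
  congr 1
  apply Finset.sum_congr rfl
  intro v _
  exact pr_update j (fun p => P (Function.update p i v))

theorem pr_extends {ι : Type*} [Fintype ι] [DecidableEq ι] [Nonempty V] (hE : ∀ e ∈ E, e.card = k)
    (hd : DegCond d k E) (hd0 : 0 ≤ d) (hd1 : d ≤ 1) {S : Finset V} (F : Finset V)
    (hS : S.card + Fintype.card ι = k) (hι : 2 ≤ Fintype.card ι)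
    (hn : 2 * ((Fintype.card ι : ℝ) ^ 2 + (S.card + F.card) * Fintype.card ι) ≤
      d * Fintype.card V) :
    d / 2 ≤ pr (fun Z : ι → V => Extends E S F Z) := by
  have hV : (0:ℝ) < Fintype.card V := by exact_mod_cast Fintype.card_pos
  obtain ⟨i, j, hij⟩ := Fintype.exists_pair_of_one_lt_card (by omega : 1 < Fintype.card ι)
  have h1 : (1 - ((Fintype.card ι : ℝ) ^ 2 + S.card * Fintype.card ι) / Fintype.card V) * d ≤
      pr (fun Z : ι → V => S ∪ toF Z ∈ E) := by
    rw [← pr_update₂ j i]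
    have key := pr_prod_ge (P := fun Z : ι → V => Function.Injective Z ∧ Disjoint (toF Z) S)
      (Q := fun Z (p : V × V) => S ∪ toF (Function.update (Function.update Z j p.1) i p.2) ∈ E)
      hd0 (pr_pick S)
    refine (key ?_).trans (pr_mono (α := (ι → V) × V × V) fun _ h => h.2)
    clear key
    rintro Z ⟨hZ, hZS⟩
    let R : Finset V := S ∪ ((univ.erase i).erase j).image Z
    have hR : R.card = k - 2 := by
      rw [card_union_of_disjoint, card_image_of_injective _ hZ, card_erase_of_mem (by simp [hij.symm]),
        card_erase_of_mem (by simp), card_univ]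
      · omega
      · refine hZS.symm.mono_right ?_
        intro v hv
        rw [mem_image] at hv
        obtain ⟨a, -, rfl⟩ := hv
        simp
    refine (hd R hR).trans (pr_mono ?_)
    rintro ⟨a, b⟩ hab
    convert hab using 1
    ext v
    simp only [R, mem_union, mem_toF, mem_insert, mem_image, mem_erase, mem_univ, and_true]
    constructor
    · rintro (h | ⟨x, rfl⟩)
      · tauto
      · by_cases hxi : x = i
        · subst hxi; simp
        by_cases hxj : x = j
        · subst hxj; simp [hxi]
        right; right; right
        exact ⟨x, ⟨hxj, hxi⟩, by simp [hxi, hxj]⟩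
    · rintro (rfl | rfl | h | ⟨x, ⟨hxj, hxi⟩, rfl⟩)
      · right; exact ⟨j, by simp [hij.symm]⟩
      · right; exact ⟨i, by simp⟩
      · tauto
      · right; exact ⟨x, by simp [hxi, hxj]⟩
  have h2 := pr_and_not_ge (fun Z : ι → V => S ∪ toF Z ∈ E) (fun Z => ¬ Disjoint (toF Z) F)
  have h3 := pr_toF_hit_le (ι := ι) F
  have h4 : pr (fun Z : ι → V => S ∪ toF Z ∈ E ∧ ¬ ¬ Disjoint (toF Z) F) ≤
      pr (fun Z : ι → V => Extends E S F Z) := pr_mono fun Z hZ => by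
    have := injective_of_union_toF (S := S) (Z := Z) (by rw [hE _ hZ.1, hS])
    exact ⟨hZ.1, this.1, this.2, not_not.1 hZ.2⟩
  have h5 : ((Fintype.card ι : ℝ) ^ 2 + S.card * Fintype.card ι) / Fintype.card V * d +
      F.card * (Fintype.card ι / Fintype.card V) ≤ d / 2 := by
    rw [div_mul_eq_mul_div, ← mul_div_assoc, ← add_div, div_le_iff₀ hV]
    have : ((Fintype.card ι : ℝ) ^ 2 + S.card * Fintype.card ι) * d ≤
      ((Fintype.card ι : ℝ) ^ 2 + S.card * Fintype.card ι) * 1 := by gcongr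
    linarith
  linarith

end Extension

section Connect

/-- Standing assumptions: uniformity, a positive minimum pair-completion density, and a lower
bound for the number of vertices. -/
structure Good {V : Type*} [Fintype V] [DecidableEq V] (k : ℕ) (d : ℝ) (N : ℕ)
    (E : Finset (Finset V)) : Prop where
  unif : ∀ e ∈ E, e.card = k
  deg : DegCond d k E
  large : N ≤ Fintype.card V

theorem Good.mono {V : Type*} [Fintype V] [DecidableEq V] {k : ℕ} {d : ℝ} {N M : ℕ}
    {E : Finset (Finset V)} (h : Good k d M E) (hN : N ≤ M) : Good k d N E :=
  ⟨h.unif, h.deg, hN.trans h.large⟩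

theorem le_mul_of_ceil_le {C d : ℝ} (hd : 0 < d) {n : ℕ} (h : ⌈C / d⌉₊ ≤ n) : C ≤ d * n := by
  have h1 : C / d ≤ n := (Nat.le_ceil _).trans (by exact_mod_cast h)
  rwa [div_le_iff₀ hd, mul_comm] at h1

/-- A number of vertices which suffices for extending sets to edges while avoiding `f` vertices. -/
noncomputable def extN (k : ℕ) (d : ℝ) (f : ℕ) : ℕ := ⌈2 * ((2 * k ^ 2 + f * k : ℕ) : ℝ) / d⌉₊

variable {V : Type*} [Fintype V] [DecidableEq V] {k ℓ : ℕ} {E : Finset (Finset V)} {d : ℝ}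

/-- A version of `pr_extends` with a crude size condition. -/
theorem Good.extends {ι : Type*} [Fintype ι] [DecidableEq ι] {f N : ℕ} (hG : Good k d N E)
    (hd0 : 0 < d) (hd1 : d ≤ 1) (hN : extN k d f ≤ N) (hk : 1 ≤ k)
    {S : Finset V} (F : Finset V) (hF : F.card ≤ f)
    (hS : S.card + Fintype.card ι = k) (hι : 2 ≤ Fintype.card ι) :
    d / 2 ≤ pr (fun Z : ι → V => Extends E S F Z) := by
  have h1 := le_mul_of_ceil_le hd0 (hN.trans hG.large)
  have h2 : Fintype.card ι ^ 2 + (S.card + F.card) * Fintype.card ι ≤ 2 * k ^ 2 + f * k := by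
    have h3 : Fintype.card ι ≤ k := by omega
    have h4 : S.card ≤ k := by omega
    calc _ ≤ k ^ 2 + (k + f) * k := by gcongr
      _ = _ := by ring
  have hpos : 0 < 2 * ((2 * k ^ 2 + f * k : ℕ) : ℝ) := by positivity
  have hne : Nonempty V := by
    by_contra hne
    rw [not_nonempty_iff] at hne
    rw [Fintype.card_eq_zero] at h1
    simp at h1
    norm_cast at hpos
    have h1' : 2 * (2 * (k:ℝ) ^ 2 + f * k) = ((2 * (2 * k ^ 2 + f * k) : ℕ) : ℝ) := by push_cast; ring
    rw [h1'] at h1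
    norm_cast at h1
    omega
  refine pr_extends hG.unif hG.deg hd0.le hd1 F hS hι (le_trans ?_ h1)
  gcongr
  exact_mod_cast h2

omit [Fintype V] in
theorem toF_comp_equiv {ι κ : Type*} [Fintype ι] [Fintype κ] (e : ι ≃ κ) (x : κ → V) :
    toF (x ∘ e) = toF x := by
  ext v
  simp only [mem_toF, Function.comp]
  exact ⟨fun ⟨i, hi⟩ => ⟨e i, hi⟩, fun ⟨i, hi⟩ => ⟨e.symm i, by simpa using hi⟩⟩

omit [DecidableEq V] in
theorem pr_reindex {ι κ : Type*} [Fintype ι] [Fintype κ] [DecidableEq ι] [DecidableEq κ]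
    (e : ι ≃ κ) (P : (ι → V) → Prop) : pr (fun x : κ → V => P (x ∘ e)) = pr P :=
  pr_equiv (Equiv.arrowCongr e.symm (Equiv.refl V)) P

/-- A version of `Good.extends` for pairs. -/
theorem Good.extends_pair {f N : ℕ} (hG : Good k d N E)
    (hd0 : 0 < d) (hd1 : d ≤ 1) (hN : extN k d f ≤ N) (hk : 2 ≤ k)
    {S : Finset V} (F : Finset V) (hF : F.card ≤ f) (hS : S.card + 2 = k) :
    d / 2 ≤ pr (fun p : V × V => S ∪ {p.1, p.2} ∈ E ∧ p.1 ≠ p.2 ∧ p.1 ∉ S ∧ p.2 ∉ S ∧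
      p.1 ∉ F ∧ p.2 ∉ F) := by
  have h := hG.extends (ι := Fin 2) hd0 hd1 hN (by omega) F hF (by simpa using hS) (by simp)
  rw [← pr_equiv (finTwoArrowEquiv V)]
  refine h.trans (pr_mono fun Z hZ => ?_)
  obtain ⟨h1, h2, h3, h4⟩ := hZ
  have e : toF Z = {Z 0, Z 1} := by
    ext v; simp only [mem_toF, Fin.exists_fin_two, mem_insert, mem_singleton, eq_comm]
  rw [e] at h1 h3 h4
  simp only [disjoint_insert_left, disjoint_singleton_left, disjoint_insert_right,
    disjoint_singleton_right] at h3 h4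
  exact ⟨h1, fun h => by simpa using h2 h, h3.1, h3.2, h4.1, h4.2⟩

end Connect

section Connect

variable {V : Type} [Fintype V] [DecidableEq V] {k ℓ : ℕ} {E : Finset (Finset V)} {d : ℝ}

/-- Any two disjoint `ℓ`-sets are connected by a positive proportion of the `q`-tuples. -/
def Connecting (ℓ q : ℕ) (α : ℝ) (E : Finset (Finset V)) : Prop :=
  ∀ X Y : Finset V, X.card = ℓ → Y.card = ℓ → Disjoint X Y →
    α ≤ pr (fun z : Fin q → V => Function.Injective z ∧ Lk ℓ E X Y (toF z))

theorem Good.connecting_short {N : ℕ} (hG : Good k d N E) (hd0 : 0 < d) (hd1 : d ≤ 1)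
    (hN : extN k d 0 ≤ N) (hlk : 2 * ℓ + 2 ≤ k) : Connecting ℓ (k - 2 * ℓ) (d / 2) E := by
  intro X Y hX hY hXY
  refine (hG.extends (ι := Fin (k - 2 * ℓ)) hd0 hd1 hN (by omega) (S := X ∪ Y) ∅ (by simp)
    ?_ (by simp; omega)).trans (pr_mono fun Z hZ => ?_)
  · rw [card_union_of_disjoint hXY, Fintype.card_fin]; omega
  · obtain ⟨h1, h2, h3, -⟩ := hZ
    rw [disjoint_union_left] at h3
    exact ⟨h2, Lk.edge hX hY hXY h3.1 h3.2.symm (by rwa [union_right_comm])⟩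

/-- The auxiliary configuration whose doubling is a connecting path with four edges. -/
def HalfConn {m l : ℕ} (E : Finset (Finset V)) (X Y : Finset V) (a : Fin m ⊕ Fin 2 → V)
    (b : Fin 2 ⊕ Fin l → V) : Prop :=
  X ∪ toF (a ∘ Sum.inl) ∪ {a (Sum.inr 0), b (Sum.inl 0)} ∈ E ∧
  Y ∪ toF (a ∘ Sum.inl) ∪ {a (Sum.inr 1), b (Sum.inl 1)} ∈ E ∧
  toF (b ∘ Sum.inr) ∪ toF (a ∘ Sum.inl) ∪ {a (Sum.inr 0), a (Sum.inr 1)} ∈ E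

theorem Good.halfConn {N : ℕ} (hl : 2 ≤ ℓ) (hG : Good (2 * ℓ + 1) d N E) (hd0 : 0 < d)
    (hd1 : d ≤ 1) (hN : extN (2 * ℓ + 1) d (2 * ℓ) ≤ N) {X Y : Finset V} (hX : X.card = ℓ)
    (hY : Y.card = ℓ) :
    (((1 / 2) * (d / 2)) * (d / 2)) * (d / 2) ≤ pr (fun x :
      (Fin (ℓ - 1) ⊕ Fin 2 → V) × (Fin 2 ⊕ Fin ℓ → V) => HalfConn E X Y x.1 x.2) := by
  have hN0 : extN (2 * ℓ + 1) d 1 ≤ N := le_trans (by unfold extN; gcongr; omega) hN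
  have hne : Nonempty V := by
    obtain ⟨x, -⟩ := card_pos.1 (by omega : 0 < X.card)
    exact ⟨x⟩
  have hXY : (X ∪ Y).card ≤ 2 * ℓ := (card_union_le _ _).trans (by omega)
  have hbig := le_mul_of_ceil_le hd0 (hN.trans hG.large)
  have p1 := pr_pick_half (V := V) (ι := Fin (ℓ - 1)) (X ∪ Y) (by
    have h1 : 2 * ((ℓ - 1) ^ 2 + (X ∪ Y).card * (ℓ - 1)) ≤
        2 * (2 * (2 * ℓ + 1) ^ 2 + (2 * ℓ) * (2 * ℓ + 1)) := by
      have h3 : (ℓ - 1) ^ 2 ≤ (2 * ℓ + 1) ^ 2 := Nat.pow_le_pow_left (by omega) 2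
      gcongr <;> omega
    have h2 : d * (Fintype.card V : ℝ) ≤ 1 * Fintype.card V := by gcongr
    rw [one_mul] at h2
    refine le_trans ?_ (hbig.trans h2)
    rw [Fintype.card_fin]
    exact_mod_cast h1)
  have p2 := pr_prod_ge (c := d / 2) (Q := fun (P : Fin (ℓ - 1) → V) (p : V × V) =>
      X ∪ toF P ∪ {p.1, p.2} ∈ E ∧ p.1 ∉ toF P) (by positivity) p1 (by
    rintro P ⟨hP, hP'⟩
    rw [disjoint_union_right] at hP'
    refine (hG.extends_pair (f := 1) hd0 hd1 hN0 (by omega) (S := X ∪ toF P) ∅ (by simp)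
      ?_).trans (pr_mono fun p hp => ⟨hp.1, ?_⟩)
    · rw [card_union_of_disjoint hP'.1.symm, card_toF hP, Fintype.card_fin]; omega
    · have := hp.2.2.1
      simp only [mem_union, not_or] at this
      exact this.2)
  have p3 := pr_prod_ge (c := d / 2) (Q := fun (x : (Fin (ℓ - 1) → V) × (V × V)) (p : V × V) =>
      Y ∪ toF x.1 ∪ {p.1, p.2} ∈ E ∧ p.1 ∉ toF x.1 ∧ p.1 ≠ x.2.1) (by positivity) p2 (by
    rintro ⟨P, z, v⟩ ⟨⟨hP, hP'⟩, h1, h2⟩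
    rw [disjoint_union_right] at hP'
    refine (hG.extends_pair (f := 1) hd0 hd1 hN0 (by omega) (S := Y ∪ toF P) {z} (by simp)
      ?_).trans (pr_mono fun p hp => ⟨hp.1, ?_, ?_⟩)
    · rw [card_union_of_disjoint hP'.2.symm, card_toF hP, Fintype.card_fin]; omega
    · have := hp.2.2.1
      simp only [mem_union, not_or] at this
      exact this.2
    · have := hp.2.2.2.2.1
      simpa using this)
  have p4 := pr_prod_ge (c := d / 2)
    (Q := fun (x : ((Fin (ℓ - 1) → V) × (V × V)) × (V × V)) (C : Fin ℓ → V) =>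
      toF C ∪ toF x.1.1 ∪ {x.1.2.1, x.2.1} ∈ E) (by positivity) p3 (by
    rintro ⟨⟨P, z, v⟩, z', v'⟩ ⟨⟨⟨hP, hP'⟩, h1, h2⟩, h3, h4, h5⟩
    refine (hG.extends (f := 1) hd0 hd1 hN0 (by omega) (S := toF P ∪ {z, z'}) ∅ (by simp)
      ?_ (by simp; omega)).trans (pr_mono fun C hC => ?_)
    · rw [card_union_of_disjoint, card_toF hP, card_pair (Ne.symm h5)]
      · simp only [Fintype.card_fin]; omega
      · simp only [disjoint_insert_right, disjoint_singleton_right]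
        exact ⟨h2, h4⟩
    · have := hC.1
      convert this using 1
      simp only [union_comm, union_left_comm])
  refine p4.trans ?_
  let e : (((Fin (ℓ - 1) → V) × (V × V)) × (V × V)) × (Fin ℓ → V) ≃
      (Fin (ℓ - 1) ⊕ Fin 2 → V) × (Fin 2 ⊕ Fin ℓ → V) :=
    { toFun := fun t => (Sum.elim t.1.1.1 ![t.1.1.2.1, t.1.2.1], Sum.elim ![t.1.1.2.2, t.1.2.2] t.2)
      invFun := fun x => (((x.1 ∘ Sum.inl, (x.1 (Sum.inr 0), x.2 (Sum.inl 0))),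
        (x.1 (Sum.inr 1), x.2 (Sum.inl 1))), x.2 ∘ Sum.inr)
      left_inv := fun _ => rfl
      right_inv := by
        rintro ⟨a, b⟩
        refine Prod.ext ?_ ?_ <;> funext i <;> rcases i with i | i
        · rfl
        · fin_cases i <;> rfl
        · fin_cases i <;> rfl
        · rfl }
  rw [← pr_equiv e]
  refine pr_mono fun x hx => ?_
  exact ⟨hx.1.1.2.1, hx.1.2.1, hx.2⟩

omit [Fintype V] in
theorem Lk.trans₄ {X P C Q Y U Z W U' : Finset V} (k1 : Lk ℓ E X P U) (k2 : Lk ℓ E P C Z)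
    (k3 : Lk ℓ E C Q W) (k4 : Lk ℓ E Q Y U') (hXY : Disjoint X Y)
    (hX : Disjoint X (U ∪ P ∪ Z ∪ C ∪ W ∪ Q ∪ U')) (hY : Disjoint (U ∪ P ∪ Z ∪ C ∪ W ∪ Q ∪ U') Y)
    (h : Disjoint U P ∧ Disjoint (U ∪ P) Z ∧ Disjoint (U ∪ P ∪ Z) C ∧ Disjoint (U ∪ P ∪ Z ∪ C) W ∧
      Disjoint (U ∪ P ∪ Z ∪ C ∪ W) Q ∧ Disjoint (U ∪ P ∪ Z ∪ C ∪ W ∪ Q) U') :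
    Lk ℓ E X Y (U ∪ P ∪ Z ∪ C ∪ W ∪ Q ∪ U') :=
  Lk.trans (Lk.trans (Lk.trans k1 k2 (by grind [Finset.disjoint_left])) k3
    (by grind [Finset.disjoint_left])) k4 (by grind [Finset.disjoint_left])

omit [Fintype V] in
set_option maxHeartbeats 1000000 in
theorem HalfConn.lk {m l : ℕ} {X Y : Finset V} (hX : X.card = m + 1) (hY : Y.card = m + 1)
    (hl : l = m + 1)
    (hXY : Disjoint X Y) {x : (((Fin m ⊕ Fin 2) ⊕ (Fin m ⊕ Fin 2)) ⊕ (Fin 2 ⊕ Fin l)) → V}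
    (hx : Function.Injective x) (hXx : Disjoint (toF x) (X ∪ Y))
    (h1 : HalfConn E X Y (x ∘ Sum.inl ∘ Sum.inl) (x ∘ Sum.inr))
    (h2 : HalfConn E X Y (x ∘ Sum.inl ∘ Sum.inr) (x ∘ Sum.inr)) : Lk (m + 1) E X Y (toF x) := by
  obtain ⟨a1, a2, a3⟩ := h1
  obtain ⟨b1, b2, b3⟩ := h2
  subst hl
  let p₁ : Finset (((Fin m ⊕ Fin 2) ⊕ (Fin m ⊕ Fin 2)) ⊕ (Fin 2 ⊕ Fin (m + 1))) :=
    insert (Sum.inl (Sum.inl (Sum.inr 0))) (univ.image (Sum.inl ∘ Sum.inl ∘ Sum.inl))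
  let p₂ : Finset (((Fin m ⊕ Fin 2) ⊕ (Fin m ⊕ Fin 2)) ⊕ (Fin 2 ⊕ Fin (m + 1))) :=
    insert (Sum.inl (Sum.inr (Sum.inr 1))) (univ.image (Sum.inl ∘ Sum.inr ∘ Sum.inl))
  let c : Finset (((Fin m ⊕ Fin 2) ⊕ (Fin m ⊕ Fin 2)) ⊕ (Fin 2 ⊕ Fin (m + 1))) :=
    univ.image (Sum.inr ∘ Sum.inr)
  let z : Finset (((Fin m ⊕ Fin 2) ⊕ (Fin m ⊕ Fin 2)) ⊕ (Fin 2 ⊕ Fin (m + 1))) :=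
    {Sum.inl (Sum.inl (Sum.inr 1))}
  let w : Finset (((Fin m ⊕ Fin 2) ⊕ (Fin m ⊕ Fin 2)) ⊕ (Fin 2 ⊕ Fin (m + 1))) :=
    {Sum.inl (Sum.inr (Sum.inr 0))}
  let u : Finset (((Fin m ⊕ Fin 2) ⊕ (Fin m ⊕ Fin 2)) ⊕ (Fin 2 ⊕ Fin (m + 1))) :=
    {Sum.inr (Sum.inl 0)}
  let u' : Finset (((Fin m ⊕ Fin 2) ⊕ (Fin m ⊕ Fin 2)) ⊕ (Fin 2 ⊕ Fin (m + 1))) :=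
    {Sum.inr (Sum.inl 1)}
  have hdX : ∀ s : Finset (((Fin m ⊕ Fin 2) ⊕ (Fin m ⊕ Fin 2)) ⊕ (Fin 2 ⊕ Fin (m + 1))),
      Disjoint X (s.image x) ∧ Disjoint (s.image x) Y := by
    intro s
    rw [disjoint_union_right] at hXx
    have : s.image x ⊆ toF x := image_subset_image (subset_univ _)
    exact ⟨(hXx.1.mono_left this).symm, hXx.2.mono_left this⟩
  have hdd : ∀ s t : Finset (((Fin m ⊕ Fin 2) ⊕ (Fin m ⊕ Fin 2)) ⊕ (Fin 2 ⊕ Fin (m + 1))),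
      Disjoint s t → Disjoint (s.image x) (t.image x) :=
    fun s t h => (disjoint_image hx).2 h
  have d1 : Disjoint p₁ p₂ := by simp [p₁, p₂, disjoint_left]
  have d2 : Disjoint p₁ c := by simp [p₁, c, disjoint_left]
  have d3 : Disjoint p₁ z := by simp [p₁, z]
  have d4 : Disjoint p₁ w := by simp [p₁, w]
  have d5 : Disjoint u p₁ := by simp [p₁, u]
  have d6 : Disjoint p₁ u' := by simp [p₁, u']
  have d7 : Disjoint c p₂ := by simp [c, p₂, disjoint_left]
  have d8 : Disjoint z p₂ := by simp [z, p₂]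
  have d9 : Disjoint w p₂ := by simp [w, p₂]
  have d10 : Disjoint u p₂ := by simp [u, p₂]
  have d11 : Disjoint p₂ u' := by simp [p₂, u']
  have d12 : Disjoint z c := by simp [c, z]
  have d13 : Disjoint c w := by simp [c, w]
  have d14 : Disjoint u c := by simp [c, u]
  have d15 : Disjoint c u' := by simp [c, u']
  have d16 : Disjoint z w := by simp [z, w]
  have d17 : Disjoint u z := by simp [z, u]
  have d18 : Disjoint z u' := by simp [z, u']
  have d19 : Disjoint u w := by simp [w, u]
  have d20 : Disjoint w u' := by simp [w, u']
  have d21 : Disjoint u u' := by simp [u, u']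
  have c1 : (p₁.image x).card = m + 1 := by
    rw [card_image_of_injective _ hx, card_insert_of_notMem (by simp), card_image_of_injective]
    · simp
    · exact Sum.inl_injective.comp (Sum.inl_injective.comp Sum.inl_injective)
  have c2 : (p₂.image x).card = m + 1 := by
    rw [card_image_of_injective _ hx, card_insert_of_notMem (by simp), card_image_of_injective]
    · simp
    · exact Sum.inl_injective.comp (Sum.inr_injective.comp Sum.inl_injective)
  have c3 : (c.image x).card = m + 1 := by
    rw [card_image_of_injective _ hx, card_image_of_injective]
    · simp
    · exact Sum.inr_injective.comp Sum.inr_injective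
  have k1 : Lk (m + 1) E X (p₁.image x) (u.image x) := by
    refine Lk.edge hX c1 (hdX _).1 (hdX _).1 (hdd _ _ d5) ?_
    convert a1 using 1
    ext y; simp [u, p₁]
  have k2 : Lk (m + 1) E (p₁.image x) (c.image x) (z.image x) := by
    refine Lk.edge c1 c3 (hdd _ _ d2) (hdd _ _ d3) (hdd _ _ d12) ?_
    convert a3 using 1
    ext y; simp [z, p₁, c]; tauto
  have k3 : Lk (m + 1) E (c.image x) (p₂.image x) (w.image x) := by
    refine Lk.edge c3 c2 (hdd _ _ d7) (hdd _ _ d13) (hdd _ _ d9) ?_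
    convert b3 using 1
    ext y; simp [w, p₂, c]; tauto
  have k4 : Lk (m + 1) E (p₂.image x) Y (u'.image x) := by
    refine Lk.edge c2 hY (hdX _).2 (hdd _ _ d11) (hdX _).2 ?_
    convert b2 using 1
    ext y; simp [u', p₂]; tauto
  have hcov : u ∪ p₁ ∪ z ∪ c ∪ w ∪ p₂ ∪ u' = univ := by
    rw [eq_univ_iff_forall]
    rintro (((i | i) | (i | i)) | (i | i)) <;> (try fin_cases i) <;> simp [p₁, p₂, c, z, w, u, u']
  clear_value p₁ p₂ c z w u u'
  have key := Lk.trans₄ k1 k2 k3 k4 hXY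
    (by simp only [disjoint_union_right, (hdX _).1, true_and])
    (by simp only [disjoint_union_left, (hdX _).2, true_and])
    (by
      simp only [← image_union]
      refine ⟨hdd _ _ ?_, hdd _ _ ?_, hdd _ _ ?_, hdd _ _ ?_, hdd _ _ ?_, hdd _ _ ?_⟩ <;>
      · simp only [disjoint_union_left, *, and_true])
  simp only [← image_union] at key
  rw [hcov] at key
  exact key

theorem Good.connecting_long {N : ℕ} (hl : 2 ≤ ℓ) (hG : Good (2 * ℓ + 1) d N E) (hd0 : 0 < d)
    (hd1 : d ≤ 1) (hN : extN (2 * ℓ + 1) d (2 * ℓ) ≤ N)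
    (hN' : ⌈2 * (((3 * ℓ + 4) ^ 2 + 2 * ℓ * (3 * ℓ + 4) : ℕ) : ℝ) / (d ^ 3 / 16) ^ 2⌉₊ ≤ N) :
    Connecting ℓ (3 * ℓ + 4) ((d ^ 3 / 16) ^ 2 / 2) E := by
  intro X Y hX hY hXY
  have hne : Nonempty V := by
    obtain ⟨x, -⟩ := card_pos.1 (by omega : 0 < X.card)
    exact ⟨x⟩
  have hV : (0:ℝ) < Fintype.card V := by exact_mod_cast Fintype.card_pos
  have h1 := hG.halfConn hl hd0 hd1 hN hX hY
  have h2 := pr_doubling (HalfConn (m := ℓ - 1) (l := ℓ) E X Y)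
  let e : ((((Fin (ℓ - 1) ⊕ Fin 2) ⊕ (Fin (ℓ - 1) ⊕ Fin 2)) ⊕ (Fin 2 ⊕ Fin ℓ)) → V) ≃
      ((Fin (ℓ - 1) ⊕ Fin 2 → V) × (Fin (ℓ - 1) ⊕ Fin 2 → V)) × (Fin 2 ⊕ Fin ℓ → V) :=
    (Equiv.sumArrowEquivProdArrow _ _ _).trans
      (Equiv.prodCongr (Equiv.sumArrowEquivProdArrow _ _ _) (Equiv.refl _))
  rw [← pr_equiv e] at h2
  let r : Fin (3 * ℓ + 4) ≃ (((Fin (ℓ - 1) ⊕ Fin 2) ⊕ (Fin (ℓ - 1) ⊕ Fin 2)) ⊕ (Fin 2 ⊕ Fin ℓ)) :=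
    (Fintype.equivFinOfCardEq (by simp; omega)).symm
  have h3 := pr_and_not_ge (fun x => HalfConn E X Y (e x).1.1 (e x).2 ∧
    HalfConn E X Y (e x).1.2 (e x).2) (fun x => ¬ (Function.Injective x ∧ Disjoint (toF x) (X ∪ Y)))
  have h5 : pr (fun x : (((Fin (ℓ - 1) ⊕ Fin 2) ⊕ (Fin (ℓ - 1) ⊕ Fin 2)) ⊕ (Fin 2 ⊕ Fin ℓ)) → V =>
      ¬ (Function.Injective x ∧ Disjoint (toF x) (X ∪ Y))) ≤ (d ^ 3 / 16) ^ 2 / 2 := by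
    have h6 := pr_or_le
      (fun x : (((Fin (ℓ - 1) ⊕ Fin 2) ⊕ (Fin (ℓ - 1) ⊕ Fin 2)) ⊕ (Fin 2 ⊕ Fin ℓ)) → V =>
      ¬ Function.Injective x) (fun x => ¬ Disjoint (toF x) (X ∪ Y))
    have h7 := pr_not_injective_le (V := V)
      (ι := (((Fin (ℓ - 1) ⊕ Fin 2) ⊕ (Fin (ℓ - 1) ⊕ Fin 2)) ⊕ (Fin 2 ⊕ Fin ℓ)))
    have h8 := pr_toF_hit_le
      (ι := (((Fin (ℓ - 1) ⊕ Fin 2) ⊕ (Fin (ℓ - 1) ⊕ Fin 2)) ⊕ (Fin 2 ⊕ Fin ℓ))) (X ∪ Y)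
    have hc : Fintype.card (((Fin (ℓ - 1) ⊕ Fin 2) ⊕ (Fin (ℓ - 1) ⊕ Fin 2)) ⊕ (Fin 2 ⊕ Fin ℓ)) =
        3 * ℓ + 4 := by simp; omega
    rw [hc] at h7 h8
    rw [card_union_of_disjoint hXY, hX, hY] at h8
    have h9 := le_mul_of_ceil_le (by positivity) (hN'.trans hG.large)
    refine (pr_mono fun x hx => ?_).trans (h6.trans ((add_le_add h7 h8).trans ?_))
    · tauto
    · rw [← mul_div_assoc, ← add_div, div_le_iff₀ hV]
      push_cast at h9 ⊢
      linarith
  have h6 : (d ^ 3 / 16) ^ 2 ≤ (pr fun x : (Fin (ℓ - 1) ⊕ Fin 2 → V) × (Fin 2 ⊕ Fin ℓ → V) =>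
      HalfConn E X Y x.1 x.2) ^ 2 := by
    refine pow_le_pow_left₀ (by positivity) (le_trans (le_of_eq ?_) h1) 2
    ring
  rw [← pr_reindex r (fun z => Function.Injective z ∧ Lk ℓ E X Y (toF z))]
  refine le_trans ?_ (pr_mono (P := fun x => (HalfConn E X Y (e x).1.1 (e x).2 ∧
    HalfConn E X Y (e x).1.2 (e x).2) ∧
      ¬ ¬ (Function.Injective x ∧ Disjoint (toF x) (X ∪ Y))) ?_)
  · linarith
  · rintro x ⟨⟨g1, g2⟩, g3⟩
    obtain ⟨g3, g4⟩ := not_not.1 g3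
    refine ⟨g3.comp r.injective, ?_⟩
    rw [toF_comp_equiv]
    obtain ⟨m, rfl⟩ : ∃ m, ℓ = m + 1 := ⟨ℓ - 1, by omega⟩
    exact HalfConn.lk hX hY rfl hXY g3 g4 g1 g2

theorem exists_connecting (k ℓ : ℕ) (hk : 4 ≤ k) (hl : 1 ≤ ℓ) (hlk : 2 * ℓ < k) (d : ℝ)
    (hd0 : 0 < d) (hd1 : d ≤ 1) : ∃ tc : ℕ, 1 ≤ tc ∧ ∃ α : ℝ, 0 < α ∧ ∃ N : ℕ,
      ∀ (V : Type) [Fintype V] [DecidableEq V] (E : Finset (Finset V)), Good k d N E →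
        Connecting ℓ (tc * (k - ℓ) - ℓ) α E := by
  by_cases h : 2 * ℓ + 2 ≤ k
  · refine ⟨1, le_rfl, d / 2, by positivity, extN k d 0, fun V _ _ E hG => ?_⟩
    have : 1 * (k - ℓ) - ℓ = k - 2 * ℓ := by omega
    rw [this]
    exact hG.connecting_short hd0 hd1 le_rfl h
  · obtain rfl : k = 2 * ℓ + 1 := by omega
    refine ⟨4, by omega, (d ^ 3 / 16) ^ 2 / 2, by positivity, max (extN (2 * ℓ + 1) d (2 * ℓ))
      ⌈2 * (((3 * ℓ + 4) ^ 2 + 2 * ℓ * (3 * ℓ + 4) : ℕ) : ℝ) / (d ^ 3 / 16) ^ 2⌉₊,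
      fun V _ _ E hG => ?_⟩
    have : 4 * (2 * ℓ + 1 - ℓ) - ℓ = 3 * ℓ + 4 := by omega
    rw [this]
    exact hG.connecting_long (by omega) hd0 hd1 (le_max_left _ _) (le_max_right _ _)

end Connect

section Gadgets

variable {V : Type} [Fintype V] [DecidableEq V] {k ℓ : ℕ} {E : Finset (Finset V)} {d : ℝ}

omit [Fintype V] in
/-- The disjoint paths with ends `es` can cover `U ∪ A` as well as `U ∪ B`. -/
def Tr (ℓ : ℕ) (E : Finset (Finset V)) (U : Finset V) (es : List (Finset V × Finset V))
    (A B : Finset V) : Prop :=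
  Disjoint U (A ∪ B) ∧ Forest ℓ E es (U ∪ A) ∧ Forest ℓ E es (U ∪ B)

omit [Fintype V] in
theorem Tr.append {U U' A B A' B' : Finset V} {es es' : List (Finset V × Finset V)}
    (h : Tr ℓ E U es A B) (h' : Tr ℓ E U' es' A' B')
    (hd : Disjoint (U ∪ A ∪ B) (U' ∪ A' ∪ B')) :
    Tr ℓ E (U ∪ U') (es ++ es') (A ∪ A') (B ∪ B') := by
  obtain ⟨h1, h2, h3⟩ := h
  obtain ⟨h1', h2', h3'⟩ := h'
  have hd' := hd.symm
  simp only [disjoint_union_left, disjoint_union_right] at h1 h1' hd hd'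
  refine ⟨by simp only [disjoint_union_left, disjoint_union_right]; tauto, ?_, ?_⟩
  · rw [union_union_union_comm]
    exact h2.append h2' (by simp only [disjoint_union_left, disjoint_union_right]; tauto)
  · rw [union_union_union_comm]
    exact h3.append h3' (by simp only [disjoint_union_left, disjoint_union_right]; tauto)

/-- A random family of vertex sets together with lists of ends, for which every vertex is hit with
probability `O(1/n)`. -/
structure Gad (V : Type) [Fintype V] [DecidableEq V] (q : ℕ) (T : Type) [Fintype T] where
  vs : T → Finset V
  ends : T → List (Finset V × Finset V)
  wf : T → Prop
  card_le : ∀ g, (vs g).card ≤ q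
  hit : ∀ v, pr (fun g => v ∈ vs g) ≤ (q : ℝ) / Fintype.card V
  bad : pr (fun g => ¬ wf g) ≤ (q : ℝ) / Fintype.card V

variable {q q' : ℕ} {T T' : Type} [Fintype T'] [Fintype T]

/-- The same family with other ends. -/
def Gad.withEnds (G : Gad V q T) (f : T → List (Finset V × Finset V)) : Gad V q T :=
  { G with ends := f }

theorem pr_fst_le {α β : Type*} [Fintype α] [Fintype β] (P : α → Prop) :
    pr (fun x : α × β => P x.1) ≤ pr P := by
  rcases isEmpty_or_nonempty β with h | h
  · have : pr (fun x : α × β => P x.1) = 0 := by simp [pr_eq_card]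
    rw [this]
    exact pr_nonneg _
  · rw [pr_fst]

theorem pr_snd_le {α β : Type*} [Fintype α] [Fintype β] (P : β → Prop) :
    pr (fun x : α × β => P x.2) ≤ pr P :=
  pr_prod_le (Q := fun _ b => P b) (pr_nonneg _) fun _ => le_rfl

/-- Pairs of independent members of two families, required to be disjoint. -/
def Gad.prod (G : Gad V q T) (G' : Gad V q' T') : Gad V (q + q' + q * q') (T × T') where
  vs g := G.vs g.1 ∪ G'.vs g.2
  ends g := G.ends g.1 ++ G'.ends g.2
  wf g := G.wf g.1 ∧ G'.wf g.2 ∧ Disjoint (G.vs g.1) (G'.vs g.2)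
  card_le g := (card_union_le _ _).trans
    (le_trans (add_le_add (G.card_le _) (G'.card_le _)) (Nat.le_add_right _ _))
  hit v := by
    have h1 : pr (fun g : T × T' => v ∈ G.vs g.1 ∪ G'.vs g.2) ≤
        pr (fun g : T × T' => v ∈ G.vs g.1) + pr (fun g : T × T' => v ∈ G'.vs g.2) :=
      (pr_mono fun g hg => by simpa using hg).trans (pr_or_le _ _)
    have h2 := pr_fst_le (β := T') fun g => v ∈ G.vs g
    have h3 := pr_snd_le (α := T) fun g => v ∈ G'.vs g
    have h4 := G.hit v
    have h5 := G'.hit v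
    have h6 : (0:ℝ) ≤ ((q * q' : ℕ) : ℝ) / Fintype.card V := by positivity
    push_cast at h6 ⊢
    rw [add_div, add_div]
    linarith
  bad := by
    have h1 : pr (fun g : T × T' => ¬ (G.wf g.1 ∧ G'.wf g.2 ∧ Disjoint (G.vs g.1) (G'.vs g.2))) ≤
        pr (fun g : T × T' => ¬ G.wf g.1) + (pr (fun g : T × T' => ¬ G'.wf g.2) +
          pr (fun g : T × T' => ¬ Disjoint (G.vs g.1) (G'.vs g.2))) :=
      (pr_mono fun g hg => by tauto).trans ((pr_or_le _ _).trans
        (add_le_add le_rfl (pr_or_le _ _)))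
    have h2 := pr_fst_le (β := T') fun g => ¬ G.wf g
    have h3 := pr_snd_le (α := T) fun g => ¬ G'.wf g
    have h4 := G.bad
    have h5 := G'.bad
    have h6 : pr (fun g : T × T' => ¬ Disjoint (G.vs g.1) (G'.vs g.2)) ≤
        (q : ℝ) * ((q' : ℝ) / Fintype.card V) := by
      refine pr_prod_le (Q := fun a b => ¬ Disjoint (G.vs a) (G'.vs b)) (by positivity)
        fun a => ?_
      have := pr_hit_le G'.vs G'.hit (G.vs a)
      simp only [disjoint_comm] at this ⊢
      refine this.trans ?_
      gcongr
      exact_mod_cast G.card_le a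
    rw [← mul_div_assoc] at h6
    push_cast
    rw [add_div, add_div]
    linarith

/-- The family of tuples of vertices. -/
def Gad.tuple (V : Type) [Fintype V] [DecidableEq V] (ι : Type) [Fintype ι] [DecidableEq ι] :
    Gad V (Fintype.card ι + Fintype.card ι ^ 2) (ι → V) where
  vs x := toF x
  ends _ := []
  wf x := Function.Injective x
  card_le x := (card_toF_le x).trans (Nat.le_add_right _ _)
  hit v := (pr_mem_toF_le v).trans (by gcongr; exact Nat.le_add_right _ _)
  bad := by
    rcases isEmpty_or_nonempty V with h | h
    · refine le_trans (pr_mono (Q := fun _ => False) fun x hx => hx fun i => ?_) ?_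
      · exact isEmptyElim (x i)
      · simp [pr_eq_card]
    · refine pr_not_injective_le.trans ?_
      gcongr
      exact_mod_cast Nat.le_add_left _ _

/-- The family of single vertices. -/
def Gad.vertex (V : Type) [Fintype V] [DecidableEq V] : Gad V 1 V where
  vs x := {x}
  ends _ := []
  wf _ := True
  card_le x := by simp
  hit v := by
    refine le_trans (pr_mono (Q := fun x => x = v) fun x hx => ?_) (le_of_eq ?_)
    · simpa [eq_comm] using hx
    · rw [pr_eq_const]; simp
  bad := by
    have : pr (fun _ : V => ¬ True) = 0 := by simp [pr_eq_card]
    rw [this]; positivity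

/-- A family with a single member, which is empty. -/
def Gad.unit (V : Type) [Fintype V] [DecidableEq V] : Gad V 0 Unit where
  vs _ := ∅
  ends _ := []
  wf _ := True
  card_le x := by simp
  hit v := by simp [pr_eq_card]
  bad := by simp [pr_eq_card]

theorem Gad.pr_bad_le (G : Gad V q T) (F : Finset V) {f : ℕ} (hF : F.card ≤ f) :
    pr (fun g => ¬ (G.wf g ∧ Disjoint (G.vs g) F)) ≤ ((q + f * q : ℕ) : ℝ) / Fintype.card V := by
  have h1 : pr (fun g => ¬ (G.wf g ∧ Disjoint (G.vs g) F)) ≤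
      pr (fun g => ¬ G.wf g) + pr (fun g => ¬ Disjoint (G.vs g) F) :=
    (pr_mono fun g hg => by tauto).trans (pr_or_le _ _)
  have h2 := pr_hit_le G.vs G.hit F
  have h3 := G.bad
  have h4 : (F.card : ℝ) * ((q : ℝ) / Fintype.card V) ≤ f * ((q : ℝ) / Fintype.card V) := by
    gcongr
  rw [← mul_div_assoc, ← mul_div_assoc] at h4
  rw [← mul_div_assoc] at h2
  push_cast
  rw [add_div]
  linarith

/-- A number of vertices for which well-formedness and avoiding `f` vertices fail with probability
at most `α / 2`. -/
noncomputable def avoidN (q f : ℕ) (α : ℝ) : ℕ := ⌈2 * ((q + f * q : ℕ) : ℝ) / α⌉₊ + 1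

/-- Lower bounds for proportions survive restricting to well-formed members which avoid `F`. -/
theorem Gad.pr_and_ge (G : Gad V q T) (F : Finset V) {f N : ℕ} (hF : F.card ≤ f) {P : T → Prop}
    {α : ℝ} (hα : 0 < α) (hN : avoidN q f α ≤ N)
    (hV : N ≤ Fintype.card V) (h : α ≤ pr P) :
    α / 2 ≤ pr (fun g => P g ∧ G.wf g ∧ Disjoint (G.vs g) F) := by
  unfold avoidN at hN
  have h1 := pr_and_not_ge P (fun g => ¬ (G.wf g ∧ Disjoint (G.vs g) F))
  have h2 := G.pr_bad_le F hF
  have h3 := le_mul_of_ceil_le hα ((Nat.le_succ _).trans (hN.trans hV))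
  have hpos : (0:ℝ) < Fintype.card V := by
    have : 0 < Fintype.card V := by omega
    exact_mod_cast this
  have h4 : ((q + f * q : ℕ) : ℝ) / Fintype.card V ≤ α / 2 := by
    rw [div_le_iff₀ hpos]
    linarith
  refine le_trans (by linarith) (h1.trans (pr_mono fun g hg => ?_))
  tauto

omit [Fintype V] in
theorem Lk.elem {A₁ M₁ L M₂ A₂ : Finset V} {a b z : V} (h1 : A₁.card = ℓ) (h2 : A₂.card = ℓ)
    (hL : L.card + 1 = ℓ) (e1 : A₁ ∪ M₁ ∪ (L ∪ {a, b}) ∈ E) (e2 : A₂ ∪ M₂ ∪ L ∪ {a, z} ∈ E)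
    (d1 : Disjoint A₁ M₁) (d2 : Disjoint A₂ M₂) (d3 : Disjoint (A₂ ∪ M₂) L)
    (d4 : Disjoint (A₁ ∪ M₁) (L ∪ {a, b})) (d5 : Disjoint (A₁ ∪ M₁) (A₂ ∪ M₂ ∪ {z}))
    (hab : a ≠ b) (haz : a ≠ z) (hbz : b ≠ z) (ha : a ∉ A₂ ∪ M₂ ∪ L) (hb : b ∉ A₂ ∪ M₂ ∪ L)
    (hz : z ∉ A₂ ∪ M₂ ∪ L) :
    Lk ℓ E A₁ A₂ ((M₁ ∪ {b}) ∪ ({a} ∪ L) ∪ (M₂ ∪ {z})) := by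
  have hc : ({a} ∪ L).card = ℓ := by
    rw [← insert_eq, card_insert_of_notMem (by grind)]
    exact hL
  refine Lk.trans (Lk.edge h1 hc ?_ ?_ ?_ ?_) (Lk.edge hc h2 ?_ ?_ ?_ ?_) ?_
  · grind [Finset.disjoint_left]
  · grind [Finset.disjoint_left]
  · grind [Finset.disjoint_left]
  · convert e1 using 1; ext; simp only [mem_union, mem_insert, mem_singleton]; tauto
  · grind [Finset.disjoint_left]
  · grind [Finset.disjoint_left]
  · grind [Finset.disjoint_left]
  · convert e2 using 1; ext; simp only [mem_union, mem_insert, mem_singleton]; tauto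
  · grind [Finset.disjoint_left]

omit [Fintype V] in
theorem Tr.elem {A₁ M₁ L M₂ A₂ : Finset V} {a b x y : V} (h1 : A₁.card = ℓ) (h2 : A₂.card = ℓ)
    (hL : L.card + 1 = ℓ) (e1 : A₁ ∪ M₁ ∪ (L ∪ {a, b}) ∈ E) (e2 : A₂ ∪ M₂ ∪ L ∪ {a, y} ∈ E)
    (e3 : A₂ ∪ M₂ ∪ L ∪ {x, b} ∈ E)
    (d1 : Disjoint A₁ M₁) (d2 : Disjoint A₂ M₂) (d3 : Disjoint (A₂ ∪ M₂) L)
    (d4 : Disjoint (L ∪ {a, b}) (A₁ ∪ M₁)) (d5 : Disjoint (A₁ ∪ M₁) (A₂ ∪ M₂ ∪ L ∪ {x, y}))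
    (hab : a ≠ b) (hax : a ≠ x) (hbx : b ≠ x) (hay : a ≠ y) (hby : b ≠ y)
    (ha : a ∉ A₂ ∪ M₂ ∪ L) (hb : b ∉ A₂ ∪ M₂ ∪ L) (hx : x ∉ A₂ ∪ M₂ ∪ L) (hy : y ∉ A₂ ∪ M₂ ∪ L) :
    Tr ℓ E (A₂ ∪ M₂ ∪ L ∪ ({a} ∪ {b} ∪ (A₁ ∪ M₁))) [(A₁, A₂)] {x} {y} := by
  have k1 := Lk.elem (a := b) (b := a) (z := x) h1 h2 hL (by rwa [pair_comm])
      (by rwa [pair_comm]) d1 d2 d3 (by rw [pair_comm]; exact d4.symm)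
      (d5.mono_right (union_subset_union subset_union_left (by simp))) hab.symm hbx hax hb ha hx
  have k2 := Lk.elem (a := a) (b := b) (z := y) h1 h2 hL e1 e2 d1 d2 d3 d4.symm
      (d5.mono_right (union_subset_union subset_union_left (by simp))) hab hay hby ha hb hy
  refine ⟨?_, ?_, ?_⟩
  · clear k1 k2 e1 e2 e3
    simp only [disjoint_union_left, disjoint_union_right, disjoint_insert_left,
      disjoint_insert_right, disjoint_singleton_right, disjoint_singleton_left, mem_union,
      mem_singleton, not_or] at *
    tauto
  · convert Forest.single k1 using 1
    ext; simp only [mem_union, mem_singleton]; clear * -; tauto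
  · convert Forest.single k2 using 1
    ext; simp only [mem_union, mem_singleton]; clear * -; tauto

end Gadgets

section Exchange

variable {V : Type} [Fintype V] [DecidableEq V] {k ℓ : ℕ} {E : Finset (Finset V)} {d : ℝ}

/-- The bound for the size of exchange gadgets. -/
def exQ (k ℓ : ℕ) : ℕ :=
  let r := Fintype.card ((Fin ℓ ⊕ Fin (k - 2 * ℓ - 1)) ⊕ Fin (ℓ - 1))
  let z := Fintype.card (Fin ℓ ⊕ Fin (k - 2 * ℓ - 1))
  (r + r ^ 2) + (3 + (z + z ^ 2) + 3 * (z + z ^ 2)) +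
    (r + r ^ 2) * (3 + (z + z ^ 2) + 3 * (z + z ^ 2))

/-- Pairs of vertices. -/
def Gad.pair (V : Type) [Fintype V] [DecidableEq V] : Gad V 3 (V × V) :=
  (Gad.vertex V).prod (Gad.vertex V)

/-- The gadgets which can exchange two vertices. -/
def exGad (V : Type) [Fintype V] [DecidableEq V] (k ℓ : ℕ) : Gad V (exQ k ℓ)
    (((Fin ℓ ⊕ Fin (k - 2 * ℓ - 1)) ⊕ Fin (ℓ - 1) → V) ×
      (V × V) × (Fin ℓ ⊕ Fin (k - 2 * ℓ - 1) → V)) :=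
  ((Gad.tuple V ((Fin ℓ ⊕ Fin (k - 2 * ℓ - 1)) ⊕ Fin (ℓ - 1))).prod
    ((Gad.pair V).prod (Gad.tuple V (Fin ℓ ⊕ Fin (k - 2 * ℓ - 1))))).withEnds
    fun g => [(toF (g.2.2 ∘ Sum.inl), toF (g.1 ∘ Sum.inl ∘ Sum.inl))]

omit [Fintype V] in
/-- The vertices `x` and `y` satisfy the conditions for an exchange which only depend on the
central part of a gadget. -/
def CanEx {ι : Type} [Fintype ι] (E : Finset (Finset V)) (R : ι → V) (a b x y : V) : Prop :=
  toF R ∪ {x, b} ∈ E ∧ toF R ∪ {a, y} ∈ E ∧ Function.Injective R ∧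
    (a ≠ b ∧ a ≠ x ∧ a ≠ y ∧ b ≠ x ∧ b ≠ y) ∧ (a ∉ toF R ∧ b ∉ toF R ∧ x ∉ toF R ∧ y ∉ toF R)

theorem Good.pr_exGad {N : ℕ} (hG : Good k d N E) (hl : 1 ≤ ℓ) (hlk : 2 * ℓ < k) (hk : 4 ≤ k)
    (hd0 : 0 < d) (hd1 : d ≤ 1) (hN : extN k d k ≤ N)
    {R : (Fin ℓ ⊕ Fin (k - 2 * ℓ - 1)) ⊕ Fin (ℓ - 1) → V} {a b x y : V}
    (h : CanEx E R a b x y) :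
    d / 2 ≤ pr (fun Z => Tr ℓ E ((exGad V k ℓ).vs (R, (a, b), Z))
      ((exGad V k ℓ).ends (R, (a, b), Z)) {x} {y}) := by
  obtain ⟨h1, h2, h3, ⟨h4, h5, h6, h7, h8⟩, h9, h10, h11, h12⟩ := h
  have hL : (toF (R ∘ Sum.inr)).card + 1 = ℓ := by
    rw [card_toF (h3.comp Sum.inr_injective)]; simp; omega
  have hR := toF_sum R
  have hR' := toF_sum (R ∘ Sum.inl)
  simp only [Function.comp_assoc] at hR'
  have hA : (toF (R ∘ Sum.inl ∘ Sum.inl)).card = ℓ := by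
    rw [card_toF (h3.comp (Sum.inl_injective.comp Sum.inl_injective))]; simp
  have hab : (toF (R ∘ Sum.inr) ∪ {a, b}).card = ℓ + 1 := by
    rw [card_union_of_disjoint, card_pair h4]
    · omega
    · rw [hR] at h9 h10
      simp only [mem_union, not_or] at h9 h10
      simp only [disjoint_insert_right, disjoint_singleton_right]
      exact ⟨h9.2, h10.2⟩
  refine (hG.extends (f := k) hd0 hd1 hN (by omega) (S := toF (R ∘ Sum.inr) ∪ {a, b})
    (toF R ∪ {x, y}) ?_ ?_ ?_).trans (pr_mono fun Z hZ => ?_)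
  · refine (card_union_le _ _).trans ((add_le_add (card_toF_le R) card_le_two).trans ?_)
    simp; omega
  · rw [hab]; simp; omega
  · simp; omega
  · obtain ⟨k1, k2, k3, k4⟩ := hZ
    have hZ' := toF_sum Z
    have hA' : (toF (Z ∘ Sum.inl)).card = ℓ := by
      rw [card_toF (k2.comp Sum.inl_injective)]; simp
    have d1 : Disjoint (toF (Z ∘ Sum.inl)) (toF (Z ∘ Sum.inr)) := by
      rw [Finset.disjoint_left]
      simp only [mem_toF, Function.comp_apply, not_exists, forall_exists_index]
      rintro _ i rfl j hj
      exact absurd (k2 hj) (by simp)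
    have d2 : Disjoint (toF (R ∘ Sum.inl ∘ Sum.inl)) (toF (R ∘ Sum.inl ∘ Sum.inr)) := by
      rw [Finset.disjoint_left]
      simp only [mem_toF, Function.comp_apply, not_exists, forall_exists_index]
      rintro _ i rfl j hj
      exact absurd (h3 hj) (by simp)
    have d3 : Disjoint (toF (R ∘ Sum.inl)) (toF (R ∘ Sum.inr)) := by
      rw [Finset.disjoint_left]
      simp only [mem_toF, Function.comp_apply, not_exists, forall_exists_index]
      rintro _ i rfl j hj
      exact absurd (h3 hj) (by simp)
    show Tr ℓ E (toF R ∪ ({a} ∪ {b} ∪ toF Z))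
      [(toF (Z ∘ Sum.inl), toF (R ∘ Sum.inl ∘ Sum.inl))] {x} {y}
    rw [hR'] at d3
    rw [hR, hR'] at h1 h2 h9 h10 h11 h12 k4 ⊢
    rw [hZ'] at k1 k3 k4 ⊢
    exact Tr.elem hA' hA hL (by rwa [union_comm]) h2 h1 d1 d2 d3 k3 k4 h4 h5 h7 h6 h8 h9 h10 h11 h12

/-- A constant fraction of the gadgets exchanges `s` and `y`. -/
def Nb (k ℓ : ℕ) (E : Finset (Finset V)) (α : ℝ) (s y : V) : Prop :=
  α ≤ pr (fun g => Tr ℓ E ((exGad V k ℓ).vs g) ((exGad V k ℓ).ends g) {s} {y})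

theorem Good.pr_nb {N : ℕ} (hG : Good k d N E) (hl : 1 ≤ ℓ) (hlk : 2 * ℓ < k) (hk : 4 ≤ k)
    (hd0 : 0 < d) (hd1 : d ≤ 1) (hN : extN k d k ≤ N) (hN2 : 2 ≤ N) (s : V) :
    1 / 2 * (d / 2 * (d / 2 * (d / 2))) / 2 ≤
      pr (fun y => Nb k ℓ E (1 / 2 * (d / 2 * (d / 2 * (d / 2))) / 2) s y) := by
  have hV : (2:ℝ) ≤ Fintype.card V := by exact_mod_cast hN2.trans hG.large
  have : Nonempty V := ⟨s⟩
  refine pr_markov (fun (y : V) g => Tr ℓ E ((exGad V k ℓ).vs g) ((exGad V k ℓ).ends g) {s} {y})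
    (by positivity) ?_
  let e : V × ((((Fin ℓ ⊕ Fin (k - 2 * ℓ - 1)) ⊕ Fin (ℓ - 1)) → V) × ((V × V) ×
      ((Fin ℓ ⊕ Fin (k - 2 * ℓ - 1)) → V))) ≃
      V × ((((Fin ℓ ⊕ Fin (k - 2 * ℓ - 1)) ⊕ Fin (ℓ - 1)) → V) × ((V × V) ×
      ((Fin ℓ ⊕ Fin (k - 2 * ℓ - 1)) → V))) :=
    { toFun := fun x => (x.2.2.1.2, x.2.1, (x.2.2.1.1, x.1), x.2.2.2)
      invFun := fun x => (x.2.2.1.2, x.2.1, (x.2.2.1.1, x.1), x.2.2.2)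
      left_inv := fun x => rfl
      right_inv := fun x => rfl }
  rw [← pr_equiv e]
  have h0 : (1:ℝ) / 2 ≤ pr (fun b : V => b ≠ s) := by
    have h1 := pr_and_not_ge (fun _ : V => True) (fun b => b = s)
    rw [pr_true, pr_eq_const] at h1
    refine le_trans ?_ (h1.trans (pr_mono fun b hb => hb.2))
    have : 1 / (Fintype.card V : ℝ) ≤ 1 / 2 := by gcongr
    linarith
  have h1 : ∀ b : V, b ≠ s → d / 2 ≤
      pr (fun R : ((Fin ℓ ⊕ Fin (k - 2 * ℓ - 1)) ⊕ Fin (ℓ - 1)) → V => Extends E {s, b} ∅ R) := by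
    intro b hb
    refine hG.extends (f := k) hd0 hd1 hN (by omega) _ (by simp) ?_ ?_
    · rw [card_pair hb.symm]; simp; omega
    · simp; omega
  have h2 : ∀ b : V, b ≠ s → ∀ R : ((Fin ℓ ⊕ Fin (k - 2 * ℓ - 1)) ⊕ Fin (ℓ - 1)) → V,
      Extends E {s, b} ∅ R → d / 2 ≤ pr (fun p : V × V => CanEx E R p.1 b s p.2) := by
    intro b hb R hR
    obtain ⟨k1, k2, k3, -⟩ := hR
    refine (hG.extends_pair (f := k) hd0 hd1 hN (by omega) (S := toF R) {s, b}
      (card_le_two.trans (by omega)) (by rw [card_toF k2]; simp; omega)).trans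
      (pr_mono fun p hp => ?_)
    simp only [disjoint_insert_left, disjoint_singleton_left, mem_insert, mem_singleton,
      not_or] at k3 hp
    refine ⟨by rwa [union_comm], hp.1, k2, ?_, ?_⟩ <;> tauto
  refine (pr_prod_ge (by positivity) h0 fun b hb => pr_prod_ge (by positivity) (h1 b hb)
    fun R hR => pr_prod_ge (by positivity) (h2 b hb R hR) fun p hp =>
      hG.pr_exGad hl hlk hk hd0 hd1 hN hp).trans (pr_mono ?_)
  rintro ⟨b, R, ⟨a, y⟩, Z⟩ h
  exact h.2.2.2

omit [Fintype V] in
theorem Tr.chain {U₁ U₂ U₃ : Finset V} {es₁ es₂ es₃ : List (Finset V × Finset V)}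
    {s t x y : V} (h₁ : Tr ℓ E U₁ es₁ {s} {x}) (h₂ : Tr ℓ E U₂ es₂ {x} {y})
    (h₃ : Tr ℓ E U₃ es₃ {t} {y}) (hxy : x ≠ y)
    (h13 : Disjoint U₁ U₃) (h : Disjoint ({x} ∪ {y} ∪ U₂) (U₁ ∪ U₃))
    (hst : Disjoint ({x} ∪ {y} ∪ U₂ ∪ (U₁ ∪ U₃)) {s, t}) :
    Tr ℓ E ({x} ∪ {y} ∪ U₂ ∪ (U₁ ∪ U₃)) ([] ++ [] ++ es₂ ++ (es₁ ++ es₃)) {s} {t} := by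
  obtain ⟨k1, k2, k3⟩ := h₁
  obtain ⟨l1, l2, l3⟩ := h₂
  obtain ⟨m1, m2, m3⟩ := h₃
  simp only [disjoint_union_left, disjoint_union_right, disjoint_insert_right,
    disjoint_singleton_right, disjoint_singleton_left, mem_union, mem_singleton, not_or] at *
  have a1 := l2.append (k2.append m3 (by
    simp only [disjoint_union_left, disjoint_union_right, disjoint_singleton_right,
      disjoint_singleton_left, mem_union, mem_singleton]
    clear k2 k3 l2 l3 m2 m3
    grind)) (by
    simp only [disjoint_union_left, disjoint_union_right, disjoint_singleton_right,
      disjoint_singleton_left, mem_union, mem_singleton]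
    clear k2 k3 l2 l3 m2 m3
    grind)
  have a2 := l3.append (k3.append m2 (by
    simp only [disjoint_union_left, disjoint_union_right, disjoint_singleton_right,
      disjoint_singleton_left, mem_union, mem_singleton]
    clear k2 k3 l2 l3 m2 m3
    grind)) (by
    simp only [disjoint_union_left, disjoint_union_right, disjoint_singleton_right,
      disjoint_singleton_left, mem_union, mem_singleton]
    clear k2 k3 l2 l3 m2 m3
    grind)
  refine ⟨?_, ?_, ?_⟩
  · simp only [disjoint_union_right, disjoint_singleton_right, mem_union, mem_singleton, not_or]
    tauto
  · show Forest ℓ E (es₂ ++ (es₁ ++ es₃)) _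
    convert a1 using 1
    ext; simp only [mem_union, mem_singleton]; clear * -; tauto
  · show Forest ℓ E (es₂ ++ (es₁ ++ es₃)) _
    convert a2 using 1
    ext; simp only [mem_union, mem_singleton]; clear * -; tauto

end Exchange

section Exchange

/-- The bound for the size of the members of `midGad`. -/
def midQ (k ℓ : ℕ) : ℕ :=
  let r := Fintype.card ((Fin ℓ ⊕ Fin (k - 2 * ℓ - 1)) ⊕ Fin (ℓ - 1))
  15 + (r + r ^ 2) + 15 * (r + r ^ 2)

/-- The central parts of exchange gadgets together with exchanged vertices. -/
def midGad (V : Type) [Fintype V] [DecidableEq V] (k ℓ : ℕ) : Gad V (midQ k ℓ)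
    (((V × V) × (V × V)) × ((Fin ℓ ⊕ Fin (k - 2 * ℓ - 1)) ⊕ Fin (ℓ - 1) → V)) :=
  ((Gad.pair V).prod (Gad.pair V)).prod
    (Gad.tuple V ((Fin ℓ ⊕ Fin (k - 2 * ℓ - 1)) ⊕ Fin (ℓ - 1)))

theorem Good.pr_canEx {V : Type} [Fintype V] [DecidableEq V] {k ℓ : ℕ} {E : Finset (Finset V)}
    {d : ℝ} {N : ℕ} (hG : Good k d N E) (hl : 1 ≤ ℓ) (hlk : 2 * ℓ < k) (hk : 4 ≤ k)
    (hd0 : 0 < d) (hd1 : d ≤ 1) (hN : extN k d k ≤ N) {α : ℝ} (hα : 0 < α)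
    {P Q : V → Prop} (hP : α ≤ pr P) (hQ : α ≤ pr Q)
    (hN1 : avoidN 3 0 (α * α) ≤ N)
    (hN2 : avoidN (midQ k ℓ) 0 ((α * α / 2 * (d / 2)) ^ 2) ≤ N) :
    (α * α / 2 * (d / 2)) ^ 2 / 2 ≤
      pr (fun x : ((V × V) × (V × V)) × ((Fin ℓ ⊕ Fin (k - 2 * ℓ - 1)) ⊕ Fin (ℓ - 1) → V) =>
        CanEx E x.2 x.1.1.1 x.1.2.2 x.1.2.1 x.1.1.2 ∧ P x.1.2.1 ∧ Q x.1.1.2) := by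
  have h1 := (Gad.pair V).pr_and_ge ∅ (f := 0) (by simp) (mul_pos hα hα)
    hN1 hG.large (pr_prod_ge hα.le hP (fun _ _ => hQ))
  have h2 : ∀ x : V × V, x.1 ≠ x.2 → d / 2 ≤
      pr (fun R : (Fin ℓ ⊕ Fin (k - 2 * ℓ - 1)) ⊕ Fin (ℓ - 1) → V =>
        Extends E {x.1, x.2} ∅ R) := by
    intro x hx
    refine hG.extends (f := k) hd0 hd1 hN (by omega) _ (by simp) ?_ ?_
    · rw [card_pair hx]; simp; omega
    · simp; omega
  have h3 := pr_prod_ge (by positivity) h1 (fun x hx => h2 x (by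
    have := hx.2.1.2.2
    simpa [Gad.vertex] using this))
  have h4 := (pow_le_pow_left₀ (by positivity) h3 2).trans
    (pr_doubling (fun (x : V × V) (R : (Fin ℓ ⊕ Fin (k - 2 * ℓ - 1)) ⊕ Fin (ℓ - 1) → V) => 
      ((P x.1 ∧ Q x.2) ∧ (Gad.pair V).wf x ∧ Disjoint ((Gad.pair V).vs x) ∅) ∧
        Extends E {x.1, x.2} ∅ R))
  have h5 := (midGad V k ℓ).pr_and_ge ∅ (f := 0) (by simp) (by positivity) hN2 hG.large h4
  refine h5.trans (pr_mono ?_)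
  rintro ⟨⟨⟨a, y⟩, ⟨x, b⟩⟩, R⟩ ⟨⟨⟨⟨⟨h1, h2⟩, -⟩, e1, -⟩, ⟨⟨⟨h3, h4⟩, -⟩, e2, -⟩⟩, hw, -⟩
  simp only [midGad, Gad.pair, Gad.prod, Gad.vertex, Gad.tuple, disjoint_union_left,
    disjoint_union_right, disjoint_singleton_left, disjoint_singleton_right, mem_singleton,
    true_and] at hw
  clear h5
  refine ⟨⟨by rwa [union_comm], by rwa [union_comm], hw.2.1, ?_, ?_⟩, h3, h2⟩
  · clear e1 e2 h1 h2 h3 h4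
    dsimp only; grind
  · clear e1 e2 h1 h2 h3 h4
    dsimp only; tauto

/-- The bound for the size of the members of `fullGad`. -/
def fullQ (k ℓ : ℕ) : ℕ :=
  (3 + exQ k ℓ + 3 * exQ k ℓ) + (exQ k ℓ + exQ k ℓ + exQ k ℓ * exQ k ℓ) +
    (3 + exQ k ℓ + 3 * exQ k ℓ) * (exQ k ℓ + exQ k ℓ + exQ k ℓ * exQ k ℓ)

/-- Chains of three exchange gadgets. -/
def fullGad (V : Type) [Fintype V] [DecidableEq V] (k ℓ : ℕ) : Gad V (fullQ k ℓ)
    (((V × V) × (((Fin ℓ ⊕ Fin (k - 2 * ℓ - 1)) ⊕ Fin (ℓ - 1) → V) ×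
      (V × V) × (Fin ℓ ⊕ Fin (k - 2 * ℓ - 1) → V))) ×
      ((((Fin ℓ ⊕ Fin (k - 2 * ℓ - 1)) ⊕ Fin (ℓ - 1) → V) ×
      (V × V) × (Fin ℓ ⊕ Fin (k - 2 * ℓ - 1) → V)) ×
      (((Fin ℓ ⊕ Fin (k - 2 * ℓ - 1)) ⊕ Fin (ℓ - 1) → V) ×
      (V × V) × (Fin ℓ ⊕ Fin (k - 2 * ℓ - 1) → V)))) :=
  ((Gad.pair V).prod (exGad V k ℓ)).prod ((exGad V k ℓ).prod (exGad V k ℓ))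

/-- Every pair of vertices can be exchanged by a constant fraction of the gadgets. -/
theorem exists_exchange (k ℓ : ℕ) (hk : 4 ≤ k) (hl : 1 ≤ ℓ) (hlk : 2 * ℓ < k) (d : ℝ)
    (hd0 : 0 < d) (hd1 : d ≤ 1) : ∃ q : ℕ, ∃ α : ℝ, 0 < α ∧ ∃ N : ℕ,
      ∀ (V : Type) [Fintype V] [DecidableEq V] (E : Finset (Finset V)), Good k d N E →
        ∃ (T : Type) (_ : Fintype T) (G : Gad V q T), ∀ s t : V,
          α ≤ pr (fun g => Tr ℓ E (G.vs g) (G.ends g) {s} {t}) := by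
  obtain ⟨β, hβ⟩ : ∃ β : ℝ, β = 1 / 2 * (d / 2 * (d / 2 * (d / 2))) / 2 := ⟨_, rfl⟩
  have hβ0 : 0 < β := by rw [hβ]; positivity
  refine ⟨fullQ k ℓ, ((β * β / 2 * (d / 2)) ^ 2 / 2 * (d / 2) * (β * β)) / 2, by positivity,
    extN k d k + 2 + avoidN 3 0 (β * β) +
    avoidN (midQ k ℓ) 0 ((β * β / 2 * (d / 2)) ^ 2) +
    avoidN (fullQ k ℓ) 2 ((β * β / 2 * (d / 2)) ^ 2 / 2 * (d / 2) * (β * β)),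
    fun V _ _ E hG => ⟨_, inferInstance, fullGad V k ℓ, fun s t => ?_⟩⟩
  have h1 := hG.pr_nb hl hlk hk hd0 hd1 (by omega) (by omega) s
  have h2 := hG.pr_nb hl hlk hk hd0 hd1 (by omega) (by omega) t
  rw [← hβ] at h1 h2
  have h3 := hG.pr_canEx hl hlk hk hd0 hd1 (by omega) hβ0 h1 h2 (by omega) (by omega)
  have h4 := pr_prod_ge (by positivity) h3 (fun x hx =>
    hG.pr_exGad hl hlk hk hd0 hd1 (by omega) hx.1)
  let e : ((V × V) × ((((Fin ℓ ⊕ Fin (k - 2 * ℓ - 1)) ⊕ Fin (ℓ - 1)) → V) × ((V × V) ×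
      ((Fin ℓ ⊕ Fin (k - 2 * ℓ - 1)) → V)))) ≃
      (((V × V) × (V × V)) × ((Fin ℓ ⊕ Fin (k - 2 * ℓ - 1)) ⊕ Fin (ℓ - 1) → V)) ×
      ((Fin ℓ ⊕ Fin (k - 2 * ℓ - 1)) → V) :=
    { toFun := fun x => ((((x.2.2.1.1, x.1.2), (x.1.1, x.2.2.1.2)), x.2.1), x.2.2.2)
      invFun := fun x => ((x.1.1.2.1, x.1.1.1.2), x.1.2, (x.1.1.1.1, x.1.1.2.2), x.2)
      left_inv := fun x => rfl
      right_inv := fun x => rfl }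
  rw [← pr_equiv e] at h4
  have h5 := pr_prod_ge (by positivity) h4 (fun x hx => pr_prod_ge hβ0.le hx.1.2.1
    (fun _ _ => hx.1.2.2))
  refine ((fullGad V k ℓ).pr_and_ge {s, t} (f := 2) card_le_two (by positivity)
      (by omega) hG.large h5).trans (pr_mono ?_)
  rintro ⟨⟨⟨x, y⟩, g⟩, ⟨g₁, g₂⟩⟩ ⟨⟨⟨⟨e1, e2, e3⟩, e4⟩, e5, e6⟩, hw, hst⟩
  refine Tr.chain e5 e4 e6 ?_ hw.2.1.2.2 hw.2.2 hst
  have := hw.1.1.2.2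
  simpa [Gad.vertex] using this

end Exchange

section Absorber

/-- Every pair of disjoint `m`-sets can be exchanged by a constant fraction of the gadgets. -/
theorem exists_exchange_sets (k ℓ : ℕ) (hk : 4 ≤ k) (hl : 1 ≤ ℓ) (hlk : 2 * ℓ < k) (d : ℝ)
    (hd0 : 0 < d) (hd1 : d ≤ 1) (m : ℕ) : ∃ q : ℕ, ∃ α : ℝ, 0 < α ∧ ∃ N : ℕ,
      ∀ (V : Type) [Fintype V] [DecidableEq V] (E : Finset (Finset V)), Good k d N E →
        ∃ (T : Type) (_ : Fintype T) (G : Gad V q T), ∀ A B : Finset V, A.card = m → B.card = m →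
          Disjoint A B → α ≤ pr (fun g => Tr ℓ E (G.vs g) (G.ends g) A B) := by
  induction m with
  | zero =>
    refine ⟨0, 1, one_pos, 0, fun V _ _ E hG => ⟨Unit, inferInstance, Gad.unit V,
      fun A B hA hB _ => ?_⟩⟩
    rw [card_eq_zero] at hA hB
    subst hA hB
    refine le_of_eq_of_le pr_true.symm (pr_mono fun g _ => ?_)
    simp [Tr, Gad.unit, Forest]
  | succ m ih =>
    obtain ⟨q, α, hα, N, h⟩ := ih
    obtain ⟨q', α', hα', N', h'⟩ := exists_exchange k ℓ hk hl hlk d hd0 hd1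
    refine ⟨q + q' + q * q', α * α' / 2, by positivity,
      N + N' + avoidN (q + q' + q * q') (2 * (m + 1)) (α * α'), fun V _ _ E hG => ?_⟩
    obtain ⟨T, _, G, hT⟩ := h V E (hG.mono (by omega))
    obtain ⟨T', _, G', hT'⟩ := h' V E (hG.mono (by omega))
    refine ⟨_, inferInstance, G.prod G', fun A B hA hB hAB => ?_⟩
    obtain ⟨a, A, ha, rfl, hA'⟩ := card_eq_succ.1 hA
    obtain ⟨b, B, hb, rfl, hB'⟩ := card_eq_succ.1 hB
    simp only [disjoint_insert_left, disjoint_insert_right, mem_insert, not_or] at hAB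
    have h1 := pr_prod_ge hα'.le (hT A B hA' hB' hAB.2.2) (fun _ _ => hT' a b)
    refine ((G.prod G').pr_and_ge (insert a A ∪ insert b B) (f := 2 * (m + 1))
      ((card_union_le _ _).trans (by omega)) (by positivity) (by omega) hG.large h1).trans
      (pr_mono ?_)
    rintro ⟨g, g'⟩ ⟨⟨h1, h2⟩, ⟨-, -, h3⟩, h4⟩
    rw [insert_eq, insert_eq, union_comm {a}, union_comm {b}]
    refine h1.append h2 ?_
    clear h1 h2
    simp only [Gad.prod, disjoint_union_left, disjoint_union_right, disjoint_insert_right,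
      disjoint_singleton_right, mem_union, not_or] at *
    tauto

theorem Tr.absorb {V : Type} [DecidableEq V] {ℓ : ℕ} {E : Finset (Finset V)}
    {A B C I₀ I₁ I₂ S U : Finset V} {es : List (Finset V × Finset V)}
    (h₀ : Lk ℓ E A B I₀) (h₁ : Lk ℓ E A C I₁) (h₂ : Lk ℓ E C B I₂)
    (h : Tr ℓ E U es (S ∪ I₀) (I₁ ∪ C ∪ I₂))
    (hd₀ : Disjoint (A ∪ B ∪ C) (I₀ ∪ (I₁ ∪ I₂))) (hd₁ : Disjoint A B) (hd₂ : Disjoint (A ∪ B) C)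
    (hd₃ : Disjoint I₀ (I₁ ∪ I₂)) (hd₄ : Disjoint I₁ I₂)
    (hd₅ : Disjoint (A ∪ B ∪ C ∪ (I₀ ∪ (I₁ ∪ I₂))) U)
    (hd₆ : Disjoint (A ∪ B ∪ C ∪ (I₀ ∪ (I₁ ∪ I₂)) ∪ U) S) :
    Tr ℓ E (A ∪ B ∪ C ∪ (I₀ ∪ (I₁ ∪ I₂)) ∪ U) ((A, B) :: es) S ∅ := by
  obtain ⟨-, f1, f2⟩ := h
  have hL : Lk ℓ E A B (I₁ ∪ C ∪ I₂) := by
    refine Lk.trans h₁ h₂ ?_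
    clear h₀ h₁ h₂ f1 f2
    simp only [disjoint_union_left, disjoint_union_right] at *
    simp only [disjoint_comm] at *
    tauto
  refine ⟨by rwa [union_empty], ?_, ?_⟩
  · convert (Forest.single hL).append f1 ?_ using 1
    · rfl
    · ext; simp only [mem_union]; clear * -; tauto
    · clear h₀ h₁ h₂ f1 f2 hL
      simp only [disjoint_union_left, disjoint_union_right] at *
      simp only [disjoint_comm] at *
      tauto
  · convert (Forest.single h₀).append f2 ?_ using 1
    · rfl
    · ext; simp only [mem_union, notMem_empty]; clear * -; tauto
    · clear h₀ h₁ h₂ f1 f2 hL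
      simp only [disjoint_union_left, disjoint_union_right] at *
      simp only [disjoint_comm] at *
      tauto

/-- The bound for the size of the members of `linkGad`. -/
def linkQ (ℓ qc : ℕ) : ℕ :=
  let r := Fintype.card ((Fin ℓ ⊕ Fin ℓ) ⊕ Fin ℓ)
  let s := Fintype.card (Fin qc)
  let u := s + s ^ 2
  let w := u + (u + u + u * u) + u * (u + u + u * u)
  r + r ^ 2 + w + (r + r ^ 2) * w

/-- Triples of ends together with three connecting sets. -/
def linkGad (V : Type) [Fintype V] [DecidableEq V] (ℓ qc : ℕ) : Gad V (linkQ ℓ qc)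
    (((Fin ℓ ⊕ Fin ℓ) ⊕ Fin ℓ → V) × (Fin qc → V) × (Fin qc → V) × (Fin qc → V)) :=
  (Gad.tuple V _).prod ((Gad.tuple V _).prod ((Gad.tuple V _).prod (Gad.tuple V _)))

/-- Every set of a suitable size can be absorbed by a constant fraction of the gadgets. -/
theorem exists_absorbing (k ℓ : ℕ) (hk : 4 ≤ k) (hl : 1 ≤ ℓ) (hlk : 2 * ℓ < k) (d : ℝ)
    (hd0 : 0 < d) (hd1 : d ≤ 1) {qc : ℕ} {αc : ℝ} (hαc : 0 < αc) : ∃ q : ℕ, ∃ α : ℝ, 0 < α ∧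
      ∃ N : ℕ, ∀ (V : Type) [Fintype V] [DecidableEq V] (E : Finset (Finset V)), Good k d N E →
        Connecting ℓ qc αc E →
        ∃ (T : Type) (_ : Fintype T) (G : Gad V q T), ∀ S : Finset V, S.card = qc + ℓ →
          α ≤ pr (fun g => G.wf g ∧ Tr ℓ E (G.vs g) (G.ends g) S ∅) := by
  obtain ⟨q, α, hα, N, h⟩ := exists_exchange_sets k ℓ hk hl hlk d hd0 hd1 (qc + ℓ + qc)
  obtain ⟨p, hp⟩ : ∃ p, p = linkQ ℓ qc := ⟨_, rfl⟩
  obtain ⟨r, hr⟩ : ∃ r, r = Fintype.card ((Fin ℓ ⊕ Fin ℓ) ⊕ Fin ℓ) := ⟨_, rfl⟩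
  refine ⟨p + q + p * q, (1 / 2 * (αc * (αc * αc))) / 2 * α / 2, by positivity,
    N + 1 + avoidN (r + r ^ 2) 0 1 + avoidN p (qc + ℓ) (1 / 2 * (αc * (αc * αc))) +
    avoidN (p + q + p * q) (qc + ℓ) ((1 / 2 * (αc * (αc * αc))) / 2 * α),
    fun V _ _ E hG hC => ?_⟩
  obtain ⟨T, _, G, hT⟩ := h V E (hG.mono (by omega))
  subst hp
  subst hr
  have : Nonempty V := Fintype.card_pos_iff.1 (by have := hG.large; omega)
  refine ⟨_, inferInstance, ((linkGad V ℓ qc).prod G).withEnds fun g =>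
    (toF (g.1.1 ∘ Sum.inl ∘ Sum.inl), toF (g.1.1 ∘ Sum.inl ∘ Sum.inr)) :: G.ends g.2,
    fun S hS => ?_⟩
  have h1 := (Gad.tuple V ((Fin ℓ ⊕ Fin ℓ) ⊕ Fin ℓ)).pr_and_ge ∅ (f := 0) (N := Fintype.card V)
    (by simp) one_pos (by have := hG.large; omega) le_rfl (le_of_eq pr_true.symm)
  have hcard : ∀ x : (Fin ℓ ⊕ Fin ℓ) ⊕ Fin ℓ → V, Function.Injective x → 
      (toF (x ∘ Sum.inl ∘ Sum.inl)).card = ℓ ∧ (toF (x ∘ Sum.inl ∘ Sum.inr)).card = ℓ ∧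
      (toF (x ∘ Sum.inr)).card = ℓ ∧
      Disjoint (toF (x ∘ Sum.inl ∘ Sum.inl)) (toF (x ∘ Sum.inl ∘ Sum.inr)) ∧
      Disjoint (toF (x ∘ Sum.inl ∘ Sum.inl)) (toF (x ∘ Sum.inr)) ∧
      Disjoint (toF (x ∘ Sum.inr)) (toF (x ∘ Sum.inl ∘ Sum.inr)) := by
    intro x hx
    refine ⟨?_, ?_, ?_, ?_, ?_, ?_⟩
    · rw [card_toF (hx.comp (Sum.inl_injective.comp Sum.inl_injective))]; simp
    · rw [card_toF (hx.comp (Sum.inl_injective.comp Sum.inr_injective))]; simp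
    · rw [card_toF (hx.comp Sum.inr_injective)]; simp
    all_goals
      rw [Finset.disjoint_left]
      intro v hv hv'
      obtain ⟨i, rfl⟩ := mem_toF.1 hv
      obtain ⟨j, hj⟩ := mem_toF.1 hv'
      have := hx hj
      simp at this
  have h2 := pr_prod_ge (by positivity) h1 (Q := fun x (I : (Fin qc → V) × (Fin qc → V) × (Fin qc → V)) =>
      (Function.Injective I.1 ∧ Lk ℓ E (toF (x ∘ Sum.inl ∘ Sum.inl))
        (toF (x ∘ Sum.inl ∘ Sum.inr)) (toF I.1)) ∧
      (Function.Injective I.2.1 ∧ Lk ℓ E (toF (x ∘ Sum.inl ∘ Sum.inl))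
        (toF (x ∘ Sum.inr)) (toF I.2.1)) ∧
      (Function.Injective I.2.2 ∧ Lk ℓ E (toF (x ∘ Sum.inr))
        (toF (x ∘ Sum.inl ∘ Sum.inr)) (toF I.2.2))) (c := αc * (αc * αc)) (by
      intro x hx
      obtain ⟨c1, c2, c3, c4, c5, c6⟩ := hcard x hx.2.1
      exact pr_prod_ge (by positivity) (hC _ _ c1 c2 c4) fun _ _ =>
        pr_prod_ge (by positivity) (hC _ _ c1 c3 c5) fun _ _ => hC _ _ c3 c2 c6)
  have h3 := (linkGad V ℓ qc).pr_and_ge S hS.le (by positivity) (by omega) hG.large h2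
  have h4 := pr_prod_ge hα.le h3 (Q := fun x g => Tr ℓ E (G.vs g) (G.ends g)
      (S ∪ toF x.2.1) (toF x.2.2.1 ∪ toF (x.1 ∘ Sum.inr) ∪ toF x.2.2.2)) (by
    rintro ⟨x, I₀, I₁, I₂⟩ ⟨⟨⟨-, hx, -⟩, ⟨i0, -⟩, ⟨i1, -⟩, ⟨i2, -⟩⟩, hw, hd⟩
    obtain ⟨c1, c2, c3, c4, c5, c6⟩ := hcard x hx
    have hU : toF x = toF (x ∘ Sum.inl ∘ Sum.inl) ∪ toF (x ∘ Sum.inl ∘ Sum.inr) ∪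
        toF (x ∘ Sum.inr) := by rw [toF_sum, toF_sum]; rfl
    obtain ⟨-, ⟨-, ⟨-, -, w1⟩, w2⟩, w3⟩ := hw
    simp only [linkGad, Gad.prod, Gad.tuple, hU] at w1 w2 w3 hd
    refine hT _ _ ?_ ?_ ?_
    · rw [card_union_of_disjoint, hS, card_toF i0, Fintype.card_fin]
      simp only [disjoint_union_left] at hd
      exact hd.2.1.symm
    · simp only [disjoint_union_left, disjoint_union_right] at w3
      rw [card_union_of_disjoint, card_union_of_disjoint, c3, card_toF i1, card_toF i2,
        Fintype.card_fin]
      · exact w3.2.1.2.symm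
      · rw [disjoint_union_left]
        exact ⟨w1, w3.2.2.2⟩
    · clear hT h1 h2 h3 hC i0 i1 i2
      simp only [disjoint_union_left, disjoint_union_right] at *
      simp only [disjoint_comm] at *
      tauto)
  let f : ((((Fin ℓ ⊕ Fin ℓ) ⊕ Fin ℓ → V) × (Fin qc → V) × (Fin qc → V) × (Fin qc → V)) × T) →
      List (Finset V × Finset V) := fun g =>
    (toF (g.1.1 ∘ Sum.inl ∘ Sum.inl), toF (g.1.1 ∘ Sum.inl ∘ Sum.inr)) :: G.ends g.2
  refine (Gad.pr_and_ge (((linkGad V ℓ qc).prod G).withEnds f) S hS.le (by positivity) (by omega)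
    hG.large h4).trans (pr_mono ?_)
  rintro ⟨⟨x, I₀, I₁, I₂⟩, g⟩ ⟨⟨⟨⟨⟨-, hx, -⟩, ⟨-, l0⟩, ⟨-, l1⟩, ⟨-, l2⟩⟩, -⟩, ht⟩, hw, hd⟩
  refine ⟨hw, ?_⟩
  obtain ⟨c1, c2, c3, c4, c5, c6⟩ := hcard x hx
  have hU : toF x = toF (x ∘ Sum.inl ∘ Sum.inl) ∪ toF (x ∘ Sum.inl ∘ Sum.inr) ∪
      toF (x ∘ Sum.inr) := by rw [toF_sum, toF_sum]; rfl
  obtain ⟨⟨-, ⟨-, ⟨-, -, w1⟩, w2⟩, w3⟩, -, w4⟩ := hw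
  simp only [Gad.withEnds, linkGad, Gad.prod, Gad.tuple, hU] at w1 w2 w3 w4 hd ⊢
  exact Tr.absorb l0 l1 l2 ht w3 c4 (by rw [disjoint_union_left]; exact ⟨c5, c6.symm⟩) w2 w1 w4 hd

end Absorber

section Selection

open scoped Classical in
/-- One step of the greedy selection of disjoint gadgets. -/
theorem exists_weight_ge {V T ι : Type*} [Fintype V] [DecidableEq V] [Fintype T]
    (vs : T → Finset V) {q : ℕ} (hit : ∀ v, pr (fun g => v ∈ vs g) ≤ (q : ℝ) / Fintype.card V)
    (J : Finset ι) (P : ι → T → Prop) {α : ℝ} (hP : ∀ j ∈ J, α ≤ pr (P j)) (F : Finset V)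
    (hF : (F.card : ℝ) * q ≤ α / 2 * Fintype.card V) (hV : 0 < Fintype.card V) [Nonempty T]
    (φ : ι → ℝ) (hφ : ∀ j, 0 ≤ φ j) :
    ∃ g, α / 2 * ∑ j ∈ J, φ j ≤ ∑ j ∈ J with P j g ∧ Disjoint (vs g) F, φ j := by
  have h1 : ∀ j ∈ J, α / 2 ≤ pr (fun g => P j g ∧ Disjoint (vs g) F) := by
    intro j hj
    have h2 := pr_and_not_ge (P j) (fun g => ¬ Disjoint (vs g) F)
    have h3 := pr_hit_le vs hit F
    have h4 : (F.card : ℝ) * ((q : ℝ) / Fintype.card V) ≤ α / 2 := by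
      rw [← mul_div_assoc, div_le_iff₀ (by exact_mod_cast hV)]
      exact hF
    simp only [not_not] at h2
    linarith [hP j hj]
  obtain ⟨g, -, hg⟩ := exists_le_of_sum_le (s := (univ : Finset T)) univ_nonempty
    (f := fun _ => α / 2 * ∑ j ∈ J, φ j)
    (g := fun g => ∑ j ∈ J with P j g ∧ Disjoint (vs g) F, φ j) (by
    simp only [sum_filter]
    rw [sum_comm, sum_const, nsmul_eq_mul, mul_sum, mul_sum]
    refine sum_le_sum fun j hj => ?_
    have h2 := h1 j hj
    rw [pr_eq_card, le_div_iff₀ (by exact_mod_cast Fintype.card_pos)] at h2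
    rw [← sum_filter, sum_const, nsmul_eq_mul, card_univ]
    calc _ = (α / 2 * Fintype.card T) * φ j := by ring
      _ ≤ _ := mul_le_mul_of_nonneg_right (h2.trans (le_of_eq (by congr!))) (hφ j))
  exact ⟨g, hg⟩

open scoped Classical in
/-- Greedy selection of disjoint gadgets, balancing the numbers of hits. -/
theorem exists_selection {V T ι : Type*} [Fintype V] [DecidableEq V] [Fintype T]
    (vs : T → Finset V) {q : ℕ} (hcard : ∀ g, (vs g).card ≤ q)
    (hit : ∀ v, pr (fun g => v ∈ vs g) ≤ (q : ℝ) / Fintype.card V)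
    (J : Finset ι) (hJ : J.Nonempty) (P : ι → T → Prop) {W : T → Prop}
    (hW : ∀ j ∈ J, ∀ g, P j g → W g) {α : ℝ} (hα : 0 < α) (hP : ∀ j ∈ J, α ≤ pr (P j))
    (F : Finset V) (hV : 0 < Fintype.card V) (r : ℕ)
    (hF : ((F.card + q * r : ℕ) : ℝ) * q ≤ α / 2 * Fintype.card V) :
    ∃ gs : List T, gs.length = r ∧ gs.Pairwise (fun g g' => Disjoint (vs g) (vs g')) ∧
      (∀ g ∈ gs, W g ∧ Disjoint (vs g) F) ∧
      ∑ j ∈ J, (1 / 2 : ℝ) ^ (gs.countP (P j)) ≤ J.card * (1 - α / 4) ^ r := by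
  obtain ⟨j₀, hj₀⟩ := hJ
  have : Nonempty T := ⟨(exists_of_pr_pos (hα.trans_le (hP j₀ hj₀))).choose⟩
  have hα1 : α ≤ 1 := (hP j₀ hj₀).trans (pr_le_one _)
  induction r with
  | zero => exact ⟨[], by simp⟩
  | succ r ih =>
    obtain ⟨gs, hl, hd, hg, hs⟩ := ih (le_trans (by gcongr; omega) hF)
    let U : Finset V := gs.foldr (fun g U => vs g ∪ U) ∅
    have hU : ∀ gs : List T, (gs.foldr (fun g U => vs g ∪ U) ∅).card ≤ q * gs.length ∧
        ∀ g ∈ gs, vs g ⊆ gs.foldr (fun g U => vs g ∪ U) ∅ := by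
      intro gs
      induction gs with
      | nil => simp
      | cons g gs ih =>
        constructor
        · refine (card_union_le _ _).trans ?_
          have := hcard g
          have := ih.1
          rw [List.length_cons, mul_add]
          omega
        · intro g' hg'
          rcases List.mem_cons.1 hg' with rfl | hg'
          · exact subset_union_left
          · exact (ih.2 g' hg').trans subset_union_right
    obtain ⟨g, hw⟩ := exists_weight_ge vs hit J P hP (F ∪ U) (le_trans (by
        gcongr
        refine (card_union_le _ _).trans ?_
        have := (hU gs).1
        rw [hl] at this
        have h5 : q * r ≤ q * (r + 1) := by gcongr; omega
        exact add_le_add le_rfl (this.trans h5)) hF) hV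
      (fun j => (1 / 2 : ℝ) ^ (gs.countP (P j))) (fun j => by positivity)
    have hpos : 0 < ∑ j ∈ J, (1 / 2 : ℝ) ^ (gs.countP (P j)) :=
      sum_pos (fun j _ => by positivity) ⟨j₀, hj₀⟩
    have hne : ∃ j ∈ J, P j g ∧ Disjoint (vs g) (F ∪ U) := by
      by_contra! h
      rw [filter_false_of_mem (fun j hj hh => h j hj hh.1 hh.2), sum_empty] at hw
      nlinarith
    obtain ⟨j, hj, hjg, hjd⟩ := hne
    rw [disjoint_union_right] at hjd
    refine ⟨g :: gs, by simp [hl], ?_, ?_, ?_⟩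
    · rw [List.pairwise_cons]
      exact ⟨fun g' hg' => hjd.2.mono_right ((hU gs).2 g' hg'), hd⟩
    · intro g' hg'
      rcases List.mem_cons.1 hg' with rfl | hg'
      · exact ⟨hW j hj _ hjg, hjd.1⟩
      · exact hg g' hg'
    · have h1 : ∑ j ∈ J, (1 / 2 : ℝ) ^ ((g :: gs).countP (P j)) ≤
          ∑ j ∈ J, (1 / 2 : ℝ) ^ (gs.countP (P j)) - 1 / 2 *
            ∑ j ∈ J with P j g ∧ Disjoint (vs g) (F ∪ U), (1 / 2 : ℝ) ^ (gs.countP (P j)) := by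
        rw [mul_sum, sum_filter, ← sum_sub_distrib]
        refine sum_le_sum fun i _ => ?_
        rw [List.countP_cons]
        split_ifs with h1 h2 h2
        · rw [pow_succ]; linarith
        · rw [pow_succ]
          have : (0:ℝ) ≤ (1 / 2) ^ gs.countP (P i) := by positivity
          linarith
        · exact absurd (by simpa using h2.1) h1
        · simp
      refine h1.trans ?_
      rw [pow_succ]
      have h2 : (0:ℝ) ≤ 1 - α / 4 := by linarith
      nlinarith

theorem exists_pow_lt_exp (C : ℕ) {c : ℝ} (hc : 0 < c) :
    ∃ N : ℕ, ∀ n : ℕ, N ≤ n → (n : ℝ) ^ C < Real.exp (c * n) := by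
  have h := (Real.tendsto_pow_mul_exp_neg_atTop_nhds_zero C).comp
    (tendsto_natCast_atTop_atTop (R := ℝ).const_mul_atTop hc)
  have h2 := h.eventually (gt_mem_nhds (show (0:ℝ) < c ^ C by positivity))
  obtain ⟨N, hN⟩ := Filter.eventually_atTop.1 h2
  refine ⟨N, fun n hn => ?_⟩
  have h3 := hN n hn
  simp only [Function.comp] at h3
  rw [mul_pow, Real.exp_neg, mul_assoc, mul_lt_iff_lt_one_right (by positivity),
    ← div_eq_mul_inv, div_lt_one (by positivity)] at h3
  exact h3

open scoped Classical in
/-- A linear number of disjoint gadgets such that each of polynomially many properties holds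
linearly often. -/
theorem exists_selection_linear (q C : ℕ) {α β η : ℝ} (hα : 0 < α) (hβ : 0 < β)
    (hq : η * q + β * q ^ 2 ≤ α / 2) : ∃ N : ℕ, ∀ {V T ι : Type} [Fintype V] [DecidableEq V]
    [Fintype T] (vs : T → Finset V), N ≤ Fintype.card V → (∀ g, (vs g).card ≤ q) →
    (∀ v, pr (fun g => v ∈ vs g) ≤ (q : ℝ) / Fintype.card V) → ∀ (J : Finset ι), J.Nonempty →
    J.card ≤ Fintype.card V ^ C → ∀ (P : ι → T → Prop) {W : T → Prop},
    (∀ j ∈ J, ∀ g, P j g → W g) → (∀ j ∈ J, α ≤ pr (P j)) →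
    ∀ F : Finset V, F.card ≤ η * Fintype.card V →
    ∃ gs : List T, gs.length ≤ β * Fintype.card V ∧
      gs.Pairwise (fun g g' => Disjoint (vs g) (vs g')) ∧
      (∀ g ∈ gs, W g ∧ Disjoint (vs g) F) ∧
      ∀ j ∈ J, α * β / 16 * Fintype.card V ≤ gs.countP (P j) := by
  obtain ⟨N, hN⟩ := exists_pow_lt_exp C (c := α * β / 16) (by positivity)
  refine ⟨N + ⌈2 / β⌉₊ + 1, fun {V T ι} _ _ _ vs hV hcard hit J hJ hJc P {W} hW hP F hF => ?_⟩
  obtain ⟨n, hn⟩ : ∃ n, n = Fintype.card V := ⟨_, rfl⟩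
  rw [← hn] at hV hit hJc hF ⊢
  have hr1 : (⌊β * n⌋₊ : ℝ) ≤ β * n := Nat.floor_le (by positivity)
  have hr2 : β * n / 2 ≤ (⌊β * n⌋₊ : ℝ) := by
    have h1 := Nat.lt_floor_add_one (β * n)
    have h2 := le_mul_of_ceil_le hβ (show ⌈2 / β⌉₊ ≤ n by omega)
    linarith
  have hα1 : α ≤ 1 := (hP _ hJ.choose_spec).trans (pr_le_one _)
  obtain ⟨gs, h1, h2, h3, h4⟩ := exists_selection vs hcard (by rwa [← hn]) J hJ P hW hα hP F
    (by omega) ⌊β * n⌋₊ (by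
      rw [← hn]
      push_cast
      calc ((F.card : ℝ) + q * ⌊β * n⌋₊) * q ≤ (η * n + q * (β * n)) * q := by gcongr
        _ = (η * q + β * q ^ 2) * n := by ring
        _ ≤ _ := by gcongr)
  refine ⟨gs, by rwa [h1], h2, h3, fun j hj => ?_⟩
  by_contra! h5
  have h6 : (1 / 2 : ℝ) ^ (gs.countP (P j)) ≤ J.card * (1 - α / 4) ^ ⌊β * n⌋₊ :=
    (single_le_sum (f := fun j => (1 / 2 : ℝ) ^ (gs.countP (P j))) (fun i _ => by positivity)
      hj).trans h4
  have h7 : Real.exp (-(α * β / 16 * n)) ≤ (1 / 2 : ℝ) ^ (gs.countP (P j)) := by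
    have h8 : Real.exp (-1) ≤ 1 / 2 := by
      rw [Real.exp_neg, one_div]
      exact inv_anti₀ (by norm_num) (by have := Real.add_one_le_exp (1:ℝ); linarith)
    calc _ ≤ Real.exp (gs.countP (P j) * (-1)) := Real.exp_le_exp.2 (by linarith)
      _ = Real.exp (-1) ^ (gs.countP (P j)) := Real.exp_nat_mul _ _
      _ ≤ _ := by gcongr
      _ = _ := rfl
  have h9 : (1 - α / 4) ^ ⌊β * n⌋₊ ≤ Real.exp (-(α * β / 8 * n)) := by
    calc _ ≤ Real.exp (-(α / 4)) ^ ⌊β * n⌋₊ := by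
          refine pow_le_pow_left₀ (by linarith) ?_ _
          have := Real.add_one_le_exp (-(α / 4))
          linarith
      _ = Real.exp (⌊β * n⌋₊ * (-(α / 4))) := (Real.exp_nat_mul _ _).symm
      _ ≤ _ := Real.exp_le_exp.2 (by nlinarith)
  have h10 : (J.card : ℝ) < Real.exp (α * β / 16 * n) :=
    lt_of_le_of_lt (by exact_mod_cast hJc) (hN n (by omega))
  have h11 : (J.card : ℝ) * (1 - α / 4) ^ ⌊β * n⌋₊ <
      Real.exp (α * β / 16 * n) * Real.exp (-(α * β / 8 * n)) :=
    (mul_le_mul_of_nonneg_left h9 (by positivity)).trans_lt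
      (mul_lt_mul_of_pos_right h10 (Real.exp_pos _))
  rw [← Real.exp_add] at h11
  have h12 : α * β / 16 * n + -(α * β / 8 * n) = -(α * β / 16 * n) := by ring
  rw [h12] at h11
  linarith

end Selection

section Pairs

variable {V : Type*} [Fintype V]

/-- The number of pairs whose sum of weights is at least `1`, in terms of the numbers of
elements of weight at least `t` and `1 - t`. -/
theorem pr_pair_le [Nonempty V] (u : V → ℝ) {t : ℝ} (ht : 2 * t ≤ 1) :
    pr (fun y : V × V => 1 ≤ u y.1 + u y.2) ≤
      2 * pr (fun v => 1 - t ≤ u v) - 2 * pr (fun v => 1 - t ≤ u v) * pr (fun v => t ≤ u v) +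
        pr (fun v => t ≤ u v) ^ 2 := by
  classical
  obtain ⟨s, hs⟩ : ∃ s, s = pr (fun v => 1 - t ≤ u v) := ⟨_, rfl⟩
  obtain ⟨r, hr⟩ : ∃ r, r = pr (fun v => t ≤ u v) := ⟨_, rfl⟩
  have hn : (0:ℝ) < Fintype.card V := by exact_mod_cast Fintype.card_pos
  have h1 : ∀ y, pr (fun z => 1 ≤ u y + u z) ≤ s + (if 1 - t ≤ u y then 1 else 0) * (1 - r) +
      (if t ≤ u y then 1 else 0) * (r - s) := by
    intro y
    by_cases h : 1 - t ≤ u y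
    · rw [if_pos h, if_pos (by linarith)]
      linarith [pr_le_one (fun z => 1 ≤ u y + u z)]
    · rw [if_neg h]
      by_cases h' : t ≤ u y
      · rw [if_pos h']
        have : pr (fun z => 1 ≤ u y + u z) ≤ r := by
          rw [hr]
          refine pr_mono fun z hz => ?_
          linarith
        linarith
      · rw [if_neg h']
        have : pr (fun z => 1 ≤ u y + u z) ≤ s := by
          rw [hs]
          refine pr_mono fun z hz => ?_
          linarith
        linarith
  rw [pr_prod (fun y z => 1 ≤ u y + u z), ← hs, ← hr, div_le_iff₀ hn]
  refine (sum_le_sum fun y _ => h1 y).trans (le_of_eq ?_)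
  rw [sum_add_distrib, sum_add_distrib, ← sum_mul, ← sum_mul]
  have h2 : ∑ y, (if 1 - t ≤ u y then (1:ℝ) else 0) = s * Fintype.card V := by
    rw [hs, pr, div_mul_cancel₀ _ hn.ne']
  have h3 : ∑ y, (if t ≤ u y then (1:ℝ) else 0) = r * Fintype.card V := by
    rw [hr, pr, div_mul_cancel₀ _ hn.ne']
  rw [h2, h3, sum_const, card_univ, nsmul_eq_mul]
  ring

theorem sum_pr_le (u : V → ℝ) (hu : ∀ v, 0 ≤ u v) {c : ℝ} (hc : 0 ≤ c)
    (hs : ∑ v, u v ≤ c * Fintype.card V) {J : ℕ} (hJ : 0 < J) :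
    ∑ j ∈ Ico 1 J, pr (fun v => (j : ℝ) / J ≤ u v) ≤ J * c := by
  classical
  have hJ' : (0:ℝ) < J := by exact_mod_cast hJ
  have h1 : ∀ v, ∑ j ∈ Ico 1 J, (if (j : ℝ) / J ≤ u v then (1:ℝ) else 0) ≤ J * u v := by
    intro v
    rw [← sum_filter, sum_const, nsmul_eq_mul, mul_one]
    refine le_trans ?_ (Nat.floor_le (mul_nonneg hJ'.le (hu v)))
    have : (Ico 1 J).filter (fun j : ℕ => (j : ℝ) / J ≤ u v) ⊆ Icc 1 ⌊J * u v⌋₊ := by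
      intro j hj
      rw [mem_filter, mem_Ico] at hj
      rw [mem_Icc]
      refine ⟨hj.1.1, Nat.le_floor ?_⟩
      rw [div_le_iff₀ hJ'] at hj
      linarith
    have h2 := card_le_card this
    rw [Nat.card_Icc] at h2
    exact_mod_cast h2
  unfold pr
  rw [← sum_div, sum_comm]
  refine div_le_of_le_mul₀ (by positivity) (by positivity) ?_
  refine (sum_le_sum fun v _ => h1 v).trans ?_
  rw [← mul_sum, mul_assoc]
  gcongr

theorem pair_ineq_lower {c κ s r : ℝ} (hc0 : 0 < c) (hc : c ≤ 1 / 6) (hκ : 0 < κ)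
    (hs : 0 ≤ s) (hsr : s ≤ r) (h : 2 * c - c ^ 2 - κ ≤ 2 * s - 2 * s * r + r ^ 2) :
    2 * c - 2 * κ ≤ s + r := by
  by_contra! hlt
  have h1 : 2 * s - 2 * s * r + r ^ 2 ≤ (s + r) - (s + r) ^ 2 / 4 := by
    nlinarith [mul_nonneg (sub_nonneg.2 hsr) (show 0 ≤ 2 - 5 / 2 * (s + r) by linarith),
      mul_nonneg (sub_nonneg.2 hsr) hs]
  nlinarith [mul_pos (show 0 < 2 * c - (s + r) by linarith) (show 0 < 1 - c by linarith),
    mul_nonneg (show 0 ≤ 2 * c - (s + r) by linarith) (show 0 ≤ 2 * c - (s + r) by linarith)]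

theorem pair_ineq_upper {c κ δ s r : ℝ} (hc0 : 0 < c) (hc : c ≤ 1 / 6) (hκ : κ ≤ δ)
    (hδ0 : 0 < δ) (hδ : δ ≤ 1 / 20)
    (hs : 0 ≤ s) (hsr : s ≤ r) (h : 2 * c - c ^ 2 - κ ≤ 2 * s - 2 * s * r + r ^ 2)
    (h' : s + r ≤ 2 * c + δ) : r ≤ c + 3 * δ := by
  have h1 : 2 * s - 2 * s * r + r ^ 2 ≤ (s + r) - (s + r) ^ 2 / 4 - (r - s) / 2 := by
    nlinarith [mul_nonneg (sub_nonneg.2 hsr) (show 0 ≤ 1 - 5 / 2 * (s + r) by linarith),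
      mul_nonneg (sub_nonneg.2 hsr) hs]
  have h2 : (s + r) - (s + r) ^ 2 / 4 ≤ (2 * c + δ) - (2 * c + δ) ^ 2 / 4 := by
    nlinarith [mul_nonneg (sub_nonneg.2 h') (show 0 ≤ 4 - (s + r) - (2 * c + δ) by linarith)]
  nlinarith [sq_nonneg δ, mul_pos hc0 hδ0]

/-- If the average of `u` is at most `c`, and almost as many pairs as possible have sum at least
`1`, then not much more than `c n` elements have weight at least `c`. -/
theorem pr_ge_le_of_pairs [Nonempty V] (u : V → ℝ) (hu : ∀ v, 0 ≤ u v) {p : ℕ} (hp : 3 ≤ p)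
    {c : ℝ} (hc : c = 1 / (2 * p)) (hs : ∑ v, u v ≤ c * Fintype.card V) {κ δ : ℝ} (hκ0 : 0 < κ)
    (hδ0 : 0 < δ) (hδ : δ ≤ 1 / 20) (hκ : κ ≤ δ / (8 * p))
    (h : 2 * c - c ^ 2 - κ ≤ pr (fun y : V × V => 1 ≤ u y.1 + u y.2)) :
    pr (fun v => c ≤ u v) ≤ c + 3 * δ := by
  have hp' : (3:ℝ) ≤ p := by exact_mod_cast hp
  have hc0 : 0 < c := by rw [hc]; positivity
  have hc1 : c ≤ 1 / 6 := by
    rw [hc]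
    exact one_div_le_one_div_of_le (by norm_num) (by linarith)
  have hcp : c * (2 * p) = 1 := by rw [hc]; field_simp
  have hκδ : κ * (8 * p) ≤ δ := by rwa [le_div_iff₀ (by positivity)] at hκ
  have hκδ' : κ ≤ δ := by nlinarith
  let q : ℕ := ⌈1 / δ⌉₊ + 1
  have hq : 1 ≤ δ * q := by
    have := le_mul_of_ceil_le hδ0 (Nat.le_succ ⌈1 / δ⌉₊)
    exact this
  have hq0 : 1 ≤ q := Nat.le_add_left _ _
  let J : ℕ := 2 * p * q
  have hJ : (J : ℝ) = 2 * p * q := by simp [J]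
  have hJ0 : (0:ℝ) < J := by rw [hJ]; positivity
  have hqJ : 2 * q ≤ J := by
    have : 3 * q ≤ p * q := by gcongr
    have h2 : J = 2 * (p * q) := by simp only [J]; ring
    omega
  let a : ℕ → ℝ := fun j => pr (fun v => (j : ℝ) / J ≤ u v)
  have ha : ∀ j, j ≤ J → a (J - j) = pr (fun v => 1 - (j : ℝ) / J ≤ u v) := by
    intro j hj
    simp only [a]
    rw [Nat.cast_sub hj, sub_div, div_self hJ0.ne']
  have hmono : ∀ i j, i ≤ j → a j ≤ a i := by
    intro i j hij
    refine pr_mono fun v hv => le_trans ?_ hv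
    gcongr
  have hpair : ∀ j, 2 * j ≤ J → 2 * c - c ^ 2 - κ ≤
      2 * a (J - j) - 2 * a (J - j) * a j + a j ^ 2 := by
    intro j hj
    rw [ha j (by omega)]
    refine h.trans (pr_pair_le u ?_)
    rw [← mul_div_assoc, div_le_one hJ0]
    exact_mod_cast hj
  have hlow1 : ∀ j, 2 * j ≤ J → 2 * c - 2 * κ ≤ a (J - j) + a j := fun j hj =>
    pair_ineq_lower hc0 hc1 hκ0 (pr_nonneg _) (hmono _ _ (by omega)) (hpair j hj)
  have hlow : ∀ j ∈ Ico 1 J, 2 * c - 2 * κ ≤ a (J - j) + a j := by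
    intro j hj
    rw [mem_Ico] at hj
    rcases le_total (2 * j) J with h1 | h1
    · exact hlow1 j h1
    · have := hlow1 (J - j) (by omega)
      rw [Nat.sub_sub_self (by omega)] at this
      linarith
  have hsum : ∑ j ∈ Ico 1 J, (a (J - j) + a j) ≤ 2 * (J * c) := by
    have h1 := sum_pr_le u hu hc0.le hs (J := J) (by omega)
    have h2 : ∑ j ∈ Ico 1 J, a (J - j) = ∑ j ∈ Ico 1 J, a j := by
      refine sum_nbij' (fun j => J - j) (fun j => J - j) ?_ ?_ ?_ ?_ fun _ _ => rfl
      all_goals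
        intro j hj
        simp only [mem_Ico] at hj ⊢
        omega
    rw [sum_add_distrib, h2]
    change _ ≤ _ at h1
    linarith
  obtain ⟨j, hj1, hjq, hj⟩ : ∃ j, 1 ≤ j ∧ j ≤ q ∧ a (J - j) + a j ≤ 2 * c + δ := by
    by_contra! hcon
    have h1 : ∑ j ∈ Ico 1 J, (2 * c - 2 * κ + if j ≤ q then δ else 0) ≤
        ∑ j ∈ Ico 1 J, (a (J - j) + a j) := by
      refine sum_le_sum fun j hj => ?_
      split_ifs with h2
      · have := hcon j (mem_Ico.1 hj).1 h2
        linarith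
      · linarith [hlow j hj]
    rw [sum_add_distrib, sum_const, ← sum_filter, sum_const, nsmul_eq_mul, nsmul_eq_mul,
      Nat.card_Ico, Nat.cast_sub (by omega)] at h1
    have h3 : (Ico 1 J).filter (· ≤ q) = Icc 1 q := by
      ext j; simp only [mem_filter, mem_Ico, mem_Icc]; omega
    rw [h3, Nat.card_Icc, Nat.add_sub_cancel] at h1
    push_cast at h1
    have h4 : κ * J ≤ δ * q / 4 := by
      rw [hJ]
      have : (0:ℝ) < q := by exact_mod_cast hq0
      nlinarith
    nlinarith
  have h1 := pair_ineq_upper hc0 hc1 hκδ' hδ0 hδ (pr_nonneg _) (hmono _ _ (by omega))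
    (hpair j (by omega)) hj
  refine le_trans (pr_mono fun v hv => le_trans ?_ hv) h1
  rw [div_le_iff₀ hJ0, hJ]
  have : (j : ℝ) ≤ q := by exact_mod_cast hjq
  calc (j : ℝ) ≤ 1 * q := by linarith
    _ = _ := by rw [← hcp]; ring

end Pairs

section Dual

theorem one_sub_le_pr_not {α : Type*} [Fintype α] [Nonempty α] {P : α → Prop} {p : ℝ}
    (h : pr P ≤ p) : 1 - p ≤ pr (fun x => ¬ P x) := by
  have h1 := pr_and_not_ge (fun _ : α => True) P
  rw [pr_true] at h1
  have h2 : pr (fun x => True ∧ ¬ P x) = pr (fun x => ¬ P x) := pr_congr fun x => by tauto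
  linarith

theorem card_filter_eq_pr {α : Type*} [Fintype α] [Nonempty α] (P : α → Prop) [DecidablePred P] :
    (#{x | P x} : ℝ) = pr P * Fintype.card α := by
  have : (0:ℝ) < Fintype.card α := by exact_mod_cast Fintype.card_pos
  rw [pr_eq_card, div_mul_cancel₀ _ this.ne']
  congr!

theorem exists_quantile {V : Type*} [Fintype V] [Nonempty V] (w : V → ℝ) {η : ℝ} (hη0 : 0 ≤ η)
    (hη : η ≤ 1) :
    ∃ v, η ≤ pr (fun x => w x ≤ w v) ∧ pr (fun x => w x < w v) ≤ η := by
  classical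
  obtain ⟨v₁, -, hv₁⟩ := exists_max_image univ w univ_nonempty
  have hne : (univ.filter fun v => η ≤ pr (fun x => w x ≤ w v)).Nonempty := by
    refine ⟨v₁, ?_⟩
    rw [mem_filter]
    refine ⟨mem_univ _, ?_⟩
    rwa [pr_congr (Q := fun _ => True) (fun x => iff_true_intro (hv₁ x (mem_univ x))), pr_true]
  obtain ⟨v, hv, hmin⟩ := exists_min_image _ w hne
  rw [mem_filter] at hv
  refine ⟨v, hv.2, ?_⟩
  by_cases hlt : (univ.filter fun x => w x < w v).Nonempty
  · obtain ⟨u, hu, hmax⟩ := exists_max_image _ w hlt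
    rw [mem_filter] at hu
    have h1 : ¬ η ≤ pr (fun x => w x ≤ w u) := fun h =>
      absurd (hmin u (by rw [mem_filter]; exact ⟨mem_univ _, h⟩)) (not_le.2 hu.2)
    refine le_trans (pr_mono fun x hx => hmax x ?_) (not_le.1 h1).le
    rw [mem_filter]; exact ⟨mem_univ _, hx⟩
  · rw [pr_eq_card]
    rw [not_nonempty_iff_eq_empty] at hlt
    have : (#{x | w x < w v} : ℝ) = 0 := by
      rw [Nat.cast_eq_zero, card_eq_zero]
      convert hlt
    rw [this, zero_div]; exact hη0

variable {ρ : Type*} [Fintype ρ] [DecidableEq ρ]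

theorem toF_update₂ {V : Type*} [DecidableEq V] {a b : ρ} (hab : a ≠ b) (x : ρ → V) (y z : V) :
    toF (Function.update (Function.update x a y) b z) =
      insert y (insert z (((univ.erase a).erase b).image x)) := by
  ext v
  simp only [mem_toF, mem_insert, mem_image, mem_erase, mem_univ, and_true]
  constructor
  · rintro ⟨i, rfl⟩
    by_cases hib : i = b
    · subst hib; simp
    by_cases hia : i = a
    · subst hia; simp [hib]
    right; right
    exact ⟨i, ⟨hib, hia⟩, by simp [hib, hia]⟩
  · rintro (rfl | rfl | ⟨i, ⟨hib, hia⟩, rfl⟩)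
    · exact ⟨a, by simp [hab]⟩
    · exact ⟨b, by simp⟩
    · exact ⟨i, by simp [hib, hia]⟩

theorem sum_pos_part_le {V : Type*} [Fintype V] {w : V → ℝ} (hw : ∀ v, 0 ≤ w v) {m η : ℝ}
    (hm0 : 0 ≤ m) (h : pr (fun x => w x < m) ≤ η) :
    ∑ v, max (w v - m) 0 ≤ ∑ v, w v - m * Fintype.card V + η * m * Fintype.card V := by
  classical
  rcases isEmpty_or_nonempty V with hV | hV
  · simp
  have hV : (0:ℝ) < Fintype.card V := by exact_mod_cast Fintype.card_pos
  rw [pr_eq_card, div_le_iff₀ hV] at h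
  have h1 : ∀ v, max (w v - m) 0 ≤ w v - m + m * if w v < m then 1 else 0 := by
    intro v
    split_ifs with hv
    · rw [max_eq_right (by linarith)]; linarith [hw v]
    · rw [max_eq_left (by linarith)]; linarith
  refine (sum_le_sum fun v _ => h1 v).trans ?_
  rw [sum_add_distrib, ← mul_sum, sum_sub_distrib, sum_const, card_univ, nsmul_eq_mul, sum_boole]
  have h2 : m * (#{x | w x < m} : ℝ) ≤ m * (η * Fintype.card V) := by
    refine mul_le_mul_of_nonneg_left ?_ hm0
    refine (le_of_eq ?_).trans h
    congr!
  nlinarith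

theorem exists_tuple_few_bad {V : Type*} [Fintype V] [DecidableEq V] [Nonempty V] (a b : ρ)
    {Bad : (ρ → V) → Prop} {L : V → Prop} {η κ ε₁ : ℝ} (hη0 : 0 < η)
    (hκ0 : 0 < κ) (hL : η ≤ pr L) (hε₁ : ε₁ < κ * η ^ Fintype.card ρ / 2)
    (hBad : pr Bad ≤ ε₁)
    (hV : 2 * (Fintype.card ρ : ℝ) ^ 2 ≤ η ^ Fintype.card ρ * Fintype.card V) :
    ∃ x : ρ → V, Function.Injective x ∧ (∀ i, L (x i)) ∧
      pr (fun y : V × V => Bad (Function.update (Function.update x a y.1) b y.2)) ≤ κ := by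
  by_contra! hcon
  have hn : (0:ℝ) < Fintype.card V := by exact_mod_cast Fintype.card_pos
  have h1 : η ^ Fintype.card ρ ≤ pr (fun x : ρ → V => ∀ i, L (x i)) := by
    rw [pr_pi (fun _ => L), prod_const, card_univ]
    gcongr
  have h2 := pr_and_not_ge (fun x : ρ → V => ∀ i, L (x i)) (fun x => ¬ Function.Injective x)
  have h3 := pr_not_injective_le (V := V) (ι := ρ)
  have h4 : (Fintype.card ρ : ℝ) ^ 2 / Fintype.card V ≤ η ^ Fintype.card ρ / 2 := by
    rw [div_le_iff₀ hn]; linarith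
  have h5 : η ^ Fintype.card ρ / 2 ≤
      pr (fun x : ρ → V => (∀ i, L (x i)) ∧ ¬ ¬ Function.Injective x) := by linarith
  have h6 := pr_prod_ge
    (Q := fun x (y : V × V) => Bad (Function.update (Function.update x a y.1) b y.2)) hκ0.le h5
    (fun x hx => (hcon x (not_not.1 hx.2) hx.1).le)
  have h7 := h6.trans (pr_mono (fun x h => h.2))
  have h8 := pr_update₂ a b Bad
  have h9 : η ^ Fintype.card ρ / 2 * κ ≤ pr Bad := by
    rw [← h8]; exact h7
  linarith

theorem weight_bound {a b : ρ} (hab : a ≠ b) (r : ρ → ℝ) (hr : ∀ i, 0 ≤ r i) (hra : r a = 1 / 2)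
    (hrb : r b = 1 / 2) {p k : ℕ} (hp : 3 ≤ p) (hrs : ∑ i, r i = p) (hk : Fintype.card ρ = k)
    {c : ℝ} (hc : c = 1 / (2 * p)) {ξ ξ' κ η : ℝ} (hξ0 : 0 < ξ) (hξ1 : ξ ≤ 3 / 20)
    (hξ' : 0 < ξ')
    (hκ0 : 0 < κ) (hκ : 48 * p * κ ≤ ξ) (hη0 : 0 < η) (hη1 : η ≤ 1) :
    ∃ ε₁ > 0, ∃ N : ℕ, ∀ (V : Type) [Fintype V] [DecidableEq V] (E : Finset (Finset V)),
      N ≤ Fintype.card V → DegCond (2 * c - c ^ 2 - κ) k E →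
      (∀ B : Finset V, (1 - c - ξ) * Fintype.card V ≤ B.card →
        ξ' ≤ pr (fun x : ρ → V => toF x ∈ E ∧ ∀ i, x i ∈ B)) →
      ∀ Bad : (ρ → V) → Prop, pr Bad ≤ ε₁ → ∀ w : V → ℝ, (∀ v, 0 ≤ w v) →
        (∀ x, toF x ∈ E → ¬ Bad x → p ≤ ∑ i, r i * w (x i)) →
        (1 - η) * Fintype.card V ≤ ∑ v, w v := by
  have hp' : (3:ℝ) ≤ p := by exact_mod_cast hp
  have hηk : 0 < η ^ k := by positivity
  refine ⟨min (κ * η ^ k / 4) (ξ' / 2), by positivity, ⌈2 * (k:ℝ) ^ 2 / η ^ k⌉₊ + 1, ?_⟩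
  intro V _ _ E hN hdeg hrob Bad hBad w hw hedge
  have hV : 0 < Fintype.card V := by omega
  have hne : Nonempty V := Fintype.card_pos_iff.1 hV
  have hn : (0:ℝ) < Fintype.card V := by exact_mod_cast hV
  have hVk : 2 * (k:ℝ) ^ 2 ≤ η ^ k * Fintype.card V :=
    le_mul_of_ceil_le hηk (by omega)
  obtain ⟨v₀, hm1, hm2⟩ := exists_quantile w hη0.le hη1
  set m := w v₀ with hm
  have hm0 : 0 ≤ m := hw v₀
  by_cases hmge : 1 ≤ m
  · have h1 : (1 - η) * Fintype.card V ≤ (#{x | ¬ w x < m} : ℝ) := by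
      rw [card_filter_eq_pr]
      gcongr
      exact one_sub_le_pr_not hm2
    refine h1.trans ?_
    rw [← sum_boole]
    refine sum_le_sum fun v _ => ?_
    split_ifs with h
    · exact hw v
    · linarith
  push Not at hmge
  by_contra! hlt
  obtain ⟨x, hxi, hxm, hxb⟩ := exists_tuple_few_bad (L := fun v => w v ≤ m) a b hη0 hκ0 hm1
    (ε₁ := min (κ * η ^ k / 4) (ξ' / 2)) (by
      rw [hk]
      have : 0 < κ * η ^ k := by positivity
      refine (min_le_left _ _).trans_lt ?_
      linarith) hBad (by rw [hk]; exact hVk)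
  have h1m : 0 < 1 - m := by linarith
  have hden : 0 < 2 * p * (1 - m) := by positivity
  let u : V → ℝ := fun v => max (w v - m) 0 / (2 * p * (1 - m))
  have hpairs : 2 * c - c ^ 2 - 2 * κ ≤ pr (fun y : V × V => 1 ≤ u y.1 + u y.2) := by
    have hS : (((univ.erase a).erase b).image x).card = k - 2 := by
      rw [card_image_of_injective _ hxi, card_erase_of_mem (by simp [hab.symm]),
        card_erase_of_mem (by simp), card_univ, hk]
      omega
    have h1 := hdeg _ hS
    have h2 := pr_and_not_ge (fun y : V × V =>
      insert y.1 (insert y.2 (((univ.erase a).erase b).image x)) ∈ E)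
      (fun y => Bad (Function.update (Function.update x a y.1) b y.2))
    have h3 : 2 * c - c ^ 2 - 2 * κ ≤ _ := le_trans (by linarith) h2
    refine h3.trans (pr_mono ?_)
    rintro ⟨y, z⟩ ⟨hyE, hyB⟩
    rw [← toF_update₂ hab] at hyE
    have h4 := hedge _ hyE hyB
    have h5 : ∑ i, r i * w (Function.update (Function.update x a y) b z i) ≤
        ∑ i, (r i * m + if i = a then (w y - m) / 2 else if i = b then (w z - m) / 2 else 0) := by
      refine sum_le_sum fun i _ => ?_
      by_cases hia : i = a
      · subst hia; simp [hab, hra]; linarith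
      by_cases hib : i = b
      · subst hib; simp [hia, hrb]; linarith
      simp only [Function.update_of_ne hib, Function.update_of_ne hia, hia, hib, if_false, add_zero]
      exact mul_le_mul_of_nonneg_left (hxm i) (hr i)
    have h6 : ∑ i, (r i * m +
        if i = a then (w y - m) / 2 else if i = b then (w z - m) / 2 else 0) =
        p * m + ((w y - m) / 2 + (w z - m) / 2) := by
      rw [sum_add_distrib, ← sum_mul, hrs]
      congr 1
      rw [← add_sum_erase _ _ (mem_univ a), if_pos rfl,
        ← add_sum_erase _ _ (mem_erase.2 ⟨hab.symm, mem_univ b⟩), if_neg hab.symm, if_pos rfl,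
        sum_eq_zero, add_zero]
      intro i hi
      simp only [mem_erase] at hi
      simp [hi.1, hi.2.1]
    change 1 ≤ max (w y - m) 0 / (2 * p * (1 - m)) + max (w z - m) 0 / (2 * p * (1 - m))
    rw [← add_div, le_div_iff₀ hden]
    have := le_max_left (w y - m) 0
    have := le_max_left (w z - m) 0
    linarith
  have hsum : ∑ v, u v ≤ c * Fintype.card V := by
    have h1 := sum_pos_part_le hw hm0 hm2
    change ∑ v, max (w v - m) 0 / (2 * p * (1 - m)) ≤ _
    rw [← sum_div, div_le_iff₀ hden, hc]
    have h2 : 1 / (2 * (p:ℝ)) * Fintype.card V * (2 * p * (1 - m)) =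
        (1 - m) * Fintype.card V := by
      field_simp
    rw [h2]
    have h3 : η * m * Fintype.card V ≤ η * 1 * Fintype.card V := by gcongr
    linarith
  have h1 := pr_ge_le_of_pairs u (fun v => by positivity) hp hc hsum (κ := 2 * κ) (δ := ξ / 3)
    (by positivity) (by positivity) (by linarith) (by
      rw [le_div_iff₀ (by positivity)]; linarith) hpairs
  have h2 : pr (fun v => ¬ w v < 1) ≤ c + ξ := by
    refine (pr_mono fun v hv => ?_).trans (h1.trans (by linarith))
    rw [not_lt] at hv
    change c ≤ max (w v - m) 0 / (2 * p * (1 - m))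
    rw [le_div_iff₀ hden, hc]
    refine le_trans (le_of_eq ?_) ((by linarith : 1 - m ≤ w v - m).trans (le_max_left _ _))
    field_simp
  have h3 := hrob (univ.filter fun v => w v < 1) (by
    rw [card_filter_eq_pr]
    gcongr
    have := one_sub_le_pr_not h2
    simp only [not_not] at this
    linarith)
  have h4 : pr (fun x : ρ → V => toF x ∈ E ∧ ∀ i, x i ∈ univ.filter fun v => w v < 1) ≤
      pr Bad := by
    refine pr_mono fun x hx => ?_
    by_contra hb
    have h5 := hedge x hx.1 hb
    have h6 : ∑ i, r i * w (x i) < ∑ i, r i := by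
      refine sum_lt_sum (fun i _ => ?_) ⟨a, mem_univ a, ?_⟩
      · have := (mem_filter.1 (hx.2 i)).2
        nlinarith [hr i]
      · have := (mem_filter.1 (hx.2 a)).2
        rw [hra]; linarith
    linarith
  have := min_le_right (κ * η ^ k / 4) (ξ' / 2)
  linarith

end Dual

section Partition

theorem pr_fiber {α κ : Type*} [Fintype α] [Fintype κ] (f : α → κ) (P : α → Prop) :
    pr P = ∑ t, pr (fun x => f x = t ∧ P x) := by
  classical
  unfold pr
  rw [← sum_div, sum_comm]
  congr 1
  refine sum_congr rfl fun x _ => ?_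
  rw [sum_eq_single (f x)]
  · congr 1; simp
  · intro t _ ht; rw [if_neg]; tauto
  · simp

variable {ρ : Type} [Fintype ρ] [DecidableEq ρ] {V : Type} [Fintype V] [DecidableEq V]

open scoped Classical in
/-- The box of vertex classes with the labels `t`. -/
noncomputable def cell {L : Type} (χ : V → L) (t : ρ → L) (i : ρ) : Finset V :=
  univ.filter fun v => χ v = t i

omit [Fintype ρ] [DecidableEq ρ] [DecidableEq V] in
theorem mem_cell {L : Type} {χ : V → L} {t : ρ → L} {i : ρ} {v : V} :
    v ∈ cell χ t i ↔ χ v = t i := by simp [cell]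

/-- The box `Q` fails `Em` although a box contained in `Q` with parts of relative size at least
`ε` satisfies it. -/
def IrregularBox (Em : (ρ → Finset V) → Prop) (ε : ℝ) (Q : ρ → Finset V) : Prop :=
  ¬ Em Q ∧ ∃ Q' : ρ → Finset V, (∀ i, Q' i ⊆ Q i) ∧ (∀ i, ε * (Q i).card ≤ (Q' i).card) ∧ Em Q'

theorem pr_cell_refine {Em : (ρ → Finset V) → Prop}
    (hEm : ∀ Q Q' : ρ → Finset V, (∀ i, Q' i ⊆ Q i) → Em Q → Em Q') {ε : ℝ} (hε : 0 ≤ ε)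
    {L : Type} [Fintype L] (χ : V → L) :
    ∃ χ' : V → L × ((ρ → L) → ρ → Bool),
      pr (fun x : ρ → V => Em (cell χ (χ ∘ x))) + ε ^ Fintype.card ρ *
        pr (fun x : ρ → V => IrregularBox Em ε (cell χ (χ ∘ x))) ≤
      pr (fun x : ρ → V => Em (cell χ' (χ' ∘ x))) := by
  classical
  have hch : ∀ t : ρ → L, ∃ Q' : ρ → Finset V, IrregularBox Em ε (cell χ t) →
      (∀ i, Q' i ⊆ cell χ t i) ∧ (∀ i, ε * (cell χ t i).card ≤ (Q' i).card) ∧ Em Q' := by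
    intro t
    by_cases h : IrregularBox Em ε (cell χ t)
    · obtain ⟨-, Q', hQ⟩ := h
      exact ⟨Q', fun _ => hQ⟩
    · exact ⟨fun _ => ∅, fun h' => absurd h' h⟩
  choose Q hQ using hch
  refine ⟨fun v => (χ v, fun t i => decide (v ∈ Q t i)), ?_⟩
  set χ' : V → L × ((ρ → L) → ρ → Bool) := fun v => (χ v, fun t i => decide (v ∈ Q t i)) with hχ'
  have h1 : ∀ x : ρ → V, Em (cell χ (χ ∘ x)) → Em (cell χ' (χ' ∘ x)) := by
    intro x hx
    refine hEm _ _ (fun i v hv => ?_) hx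
    rw [mem_cell] at hv ⊢
    exact congrArg Prod.fst hv
  have h2 : ∀ x : ρ → V, IrregularBox Em ε (cell χ (χ ∘ x)) → (∀ i, x i ∈ Q (χ ∘ x) i) →
      Em (cell χ' (χ' ∘ x)) := by
    intro x hx hxQ
    refine hEm _ _ (fun i v hv => ?_) (hQ _ hx).2.2
    rw [mem_cell] at hv
    have := congrFun (congrFun (congrArg Prod.snd hv) (χ ∘ x)) i
    simp only [hχ', Function.comp, decide_eq_decide] at this
    exact this.2 (hxQ i)
  have h3 : ε ^ Fintype.card ρ * pr (fun x : ρ → V => IrregularBox Em ε (cell χ (χ ∘ x))) ≤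
      pr (fun x : ρ → V => IrregularBox Em ε (cell χ (χ ∘ x)) ∧ ∀ i, x i ∈ Q (χ ∘ x) i) := by
    rw [pr_fiber (fun x : ρ → V => χ ∘ x), mul_sum, pr_fiber (fun x : ρ → V => χ ∘ x)]
    refine sum_le_sum fun t _ => ?_
    by_cases ht : IrregularBox Em ε (cell χ t)
    · have e1 : pr (fun x : ρ → V => χ ∘ x = t ∧ IrregularBox Em ε (cell χ (χ ∘ x))) =
          pr (fun x : ρ → V => ∀ i, x i ∈ cell χ t i) := by
        refine pr_congr fun x => ?_
        simp only [mem_cell]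
        constructor
        · rintro ⟨rfl, -⟩ i; rfl
        · intro h
          obtain rfl : χ ∘ x = t := funext h
          exact ⟨rfl, ht⟩
      have e2 : pr (fun x : ρ → V => ∀ i, x i ∈ Q t i) ≤ pr (fun x : ρ → V => χ ∘ x = t ∧
          IrregularBox Em ε (cell χ (χ ∘ x)) ∧ ∀ i, x i ∈ Q (χ ∘ x) i) := by
        refine pr_mono fun x hx => ?_
        have : χ ∘ x = t := funext fun i => mem_cell (χ := χ) |>.1 ((hQ t ht).1 i (hx i))
        subst this
        exact ⟨rfl, ht, hx⟩
      rw [e1]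
      refine le_trans ?_ e2
      rw [pr_pi (fun i v => v ∈ cell χ t i), pr_pi (fun i v => v ∈ Q t i), ← card_univ,
        ← prod_const, ← prod_mul_distrib]
      refine prod_le_prod (fun i _ => mul_nonneg hε (pr_nonneg _)) fun i _ => ?_
      rw [pr_mem, pr_mem, ← mul_div_assoc]
      gcongr
      exact (hQ t ht).2.1 i
    · rw [pr_congr (Q := fun _ => False)]
      · have : pr (fun _ : ρ → V => False) = 0 := by simp [pr]
        rw [this, mul_zero]
        exact pr_nonneg _
      · intro x
        constructor
        · rintro ⟨rfl, h⟩; exact ht h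
        · exact False.elim
  have h4 := pr_and_not_ge (fun x : ρ → V => Em (cell χ' (χ' ∘ x)))
    (fun x => Em (cell χ (χ ∘ x)))
  have h5 : pr (fun x : ρ → V => IrregularBox Em ε (cell χ (χ ∘ x)) ∧ ∀ i, x i ∈ Q (χ ∘ x) i) ≤
      pr (fun x : ρ → V => Em (cell χ' (χ' ∘ x)) ∧ ¬ Em (cell χ (χ ∘ x))) :=
    pr_mono fun x hx => ⟨h2 x hx.1 hx.2, hx.1.1⟩
  have h6 := pr_or_le (fun x : ρ → V => IrregularBox Em ε (cell χ (χ ∘ x)) ∧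
    ∀ i, x i ∈ Q (χ ∘ x) i) (fun x : ρ → V => Em (cell χ (χ ∘ x)))
  have h7 : pr (fun x : ρ → V => Em (cell χ (χ ∘ x))) +
      pr (fun x : ρ → V => Em (cell χ' (χ' ∘ x)) ∧ ¬ Em (cell χ (χ ∘ x))) ≤
      pr (fun x : ρ → V => Em (cell χ' (χ' ∘ x))) := by
    unfold pr
    rw [← add_div, ← sum_add_distrib]
    gcongr with x
    split_ifs <;> first | tauto | norm_num
  linarith

omit V [Fintype V] [DecidableEq V] in
variable (ρ) in
theorem exists_partition {ε : ℝ} (hε : 0 < ε) :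
    ∃ M : ℕ, ∀ (V : Type) [Fintype V] [DecidableEq V] (Em : (ρ → Finset V) → Prop),
      (∀ Q Q' : ρ → Finset V, (∀ i, Q' i ⊆ Q i) → Em Q → Em Q') →
      ∃ (L : Type) (_ : Fintype L) (χ : V → L), Fintype.card L ≤ M ∧
        pr (fun x : ρ → V => IrregularBox Em ε (cell χ (χ ∘ x))) ≤ ε := by
  have key : ∀ s : ℕ, ∃ M : ℕ, ∀ (V : Type) [Fintype V] [DecidableEq V]
      (Em : (ρ → Finset V) → Prop),
      (∀ Q Q' : ρ → Finset V, (∀ i, Q' i ⊆ Q i) → Em Q → Em Q') →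
      ∃ (L : Type) (_ : Fintype L) (χ : V → L), Fintype.card L ≤ M ∧
        (pr (fun x : ρ → V => IrregularBox Em ε (cell χ (χ ∘ x))) ≤ ε ∨
          s * ε ^ (Fintype.card ρ + 1) ≤ pr (fun x : ρ → V => Em (cell χ (χ ∘ x)))) := by
    intro s
    induction s with
    | zero =>
      refine ⟨1, fun V _ _ Em _ => ⟨Unit, inferInstance, fun _ => (), by simp, Or.inr ?_⟩⟩
      simpa using pr_nonneg _
    | succ s ih =>
      obtain ⟨M, hM⟩ := ih
      refine ⟨M * (2 ^ Fintype.card ρ) ^ (M ^ Fintype.card ρ) + M, fun V _ _ Em hEm => ?_⟩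
      obtain ⟨L, _, χ, hL, h⟩ := hM V Em hEm
      classical
      by_cases hb : pr (fun x : ρ → V => IrregularBox Em ε (cell χ (χ ∘ x))) ≤ ε
      · exact ⟨L, inferInstance, χ, by omega, Or.inl hb⟩
      have h' := h.resolve_left hb
      obtain ⟨χ', hχ'⟩ := pr_cell_refine hEm hε.le χ
      refine ⟨_, inferInstance, χ', ?_, Or.inr ?_⟩
      · rw [Fintype.card_prod, Fintype.card_fun, Fintype.card_fun, Fintype.card_fun,
          Fintype.card_bool]
        refine le_add_right ?_
        gcongr
        exact Nat.one_le_two_pow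
      · refine le_trans ?_ hχ'
        push Not at hb
        have : ε ^ Fintype.card ρ * ε ≤ ε ^ Fintype.card ρ *
          pr (fun x : ρ → V => IrregularBox Em ε (cell χ (χ ∘ x))) := by gcongr
        push_cast
        rw [pow_succ] at h' ⊢
        linarith
  obtain ⟨s, hs⟩ := exists_nat_gt (1 / ε ^ (Fintype.card ρ + 1))
  rw [div_lt_iff₀ (by positivity)] at hs
  obtain ⟨M, hM⟩ := key s
  refine ⟨M, fun V _ _ Em hEm => ?_⟩
  obtain ⟨L, _, χ, hL, h⟩ := hM V Em hEm
  refine ⟨L, inferInstance, χ, hL, h.resolve_right fun h' => ?_⟩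
  have := pr_le_one (fun x : ρ → V => Em (cell χ (χ ∘ x)))
  linarith

end Partition

section Duality

theorem exists_fractional_packing {T L : Type*} [Fintype T] [Fintype L] (a : T → L → ℝ)
    {s : L → ℝ} (hs : ∀ j, 0 ≤ s j) {X : ℝ} (hX : 0 ≤ X)
    (h : ∀ w : L → ℝ, (∀ j, 0 ≤ w j) → (∀ t, 1 ≤ ∑ j, a t j * w j) → X ≤ ∑ j, s j * w j) :
    ∃ x : T → ℝ, (∀ t, 0 ≤ x t) ∧ (∀ j, ∑ t, x t * a t j ≤ s j) ∧ ∑ t, x t = X := by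
  classical
  rcases hX.eq_or_lt with rfl | hX
  · exact ⟨fun _ => 0, by simp, by simpa using hs, by simp⟩
  let φ : (T → ℝ) →L[ℝ] (L → ℝ) := LinearMap.toContinuousLinearMap
    { toFun := fun x j => ∑ t, x t * a t j
      map_add' := fun x y => by ext j; simp [add_mul, sum_add_distrib]
      map_smul' := fun c x => by ext j; simp [mul_assoc, mul_sum] }
  have hφ : ∀ x j, φ x j = ∑ t, x t * a t j := fun _ _ => rfl
  let D : Set (L → ℝ) := {y | ∀ j, y j ≤ s j / X}
  have hDc : IsClosed D := by
    have : D = ⋂ j, {y | y j ≤ s j / X} := by ext; simp [D]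
    rw [this]
    exact isClosed_iInter fun j => isClosed_le (continuous_apply j) continuous_const
  have hDx : Convex ℝ D := by
    intro y hy z hz p q hp hq hpq j
    have h1 := mul_le_mul_of_nonneg_left (hy j) hp
    have h2 := mul_le_mul_of_nonneg_left (hz j) hq
    have h3 : p * (s j / X) + q * (s j / X) = s j / X := by rw [← add_mul, hpq, one_mul]
    simp only [Pi.add_apply, Pi.smul_apply, smul_eq_mul]
    linarith
  by_cases hd : Disjoint (φ '' stdSimplex ℝ T) D
  · exfalso
    obtain ⟨f, u, v, hu, huv, hv⟩ := geometric_hahn_banach_compact_closed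
      ((convex_stdSimplex ℝ T).linear_image φ.toLinearMap)
      ((isCompact_stdSimplex (𝕜 := ℝ) (ι := T)).image φ.continuous) hDx hDc hd
    have hf : ∀ y, f y = ∑ j, y j * f (Pi.single j 1) := by
      intro y
      conv_lhs => rw [← univ_sum_single y]
      rw [map_sum]
      refine sum_congr rfl fun j _ => ?_
      rw [← smul_eq_mul, ← map_smul, ← Pi.single_smul, smul_eq_mul, mul_one]
    have hneg : ∀ j, f (Pi.single j 1) ≤ 0 := by
      intro j
      by_contra! hpos
      obtain ⟨m, hm⟩ := exists_nat_gt ((f (fun j => s j / X) - v) / f (Pi.single j 1))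
      rw [div_lt_iff₀ hpos] at hm
      have := hv ((fun j => s j / X) - (m:ℝ) • Pi.single j 1) (by
        intro i
        simp only [Pi.sub_apply, Pi.smul_apply, smul_eq_mul]
        have : 0 ≤ (m:ℝ) * (Pi.single j 1 : L → ℝ) i := by
          rw [Pi.single_apply]; split_ifs <;> simp
        linarith)
      rw [map_sub, map_smul, smul_eq_mul] at this
      linarith
    have h1 := hv (fun j => s j / X) (fun j => le_rfl)
    rw [hf] at h1
    have h2 : ∑ j, s j / X * f (Pi.single j 1) ≤ 0 :=
      sum_nonpos fun j _ => mul_nonpos_of_nonneg_of_nonpos (div_nonneg (hs j) hX.le) (hneg j)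
    have hu0 : u < 0 := by linarith
    have h3 := h (fun j => f (Pi.single j 1) / u)
      (fun j => div_nonneg_of_nonpos (hneg j) hu0.le) (fun t => by
        have h4 := hu (φ (Pi.single t 1)) ⟨_, single_mem_stdSimplex ℝ t, rfl⟩
        rw [hf] at h4
        have h5 : ∀ j, φ (Pi.single t 1) j = a t j := by
          intro j; rw [hφ, sum_eq_single t] <;> simp +contextual
        simp only [h5] at h4
        simp only [← mul_div_assoc]
        rw [← sum_div, le_div_iff_of_neg hu0]
        linarith)
    simp only [← mul_div_assoc] at h3
    rw [← sum_div, le_div_iff_of_neg hu0] at h3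
    have h6 : ∑ j, s j / X * f (Pi.single j 1) = (∑ j, s j * f (Pi.single j 1)) / X := by
      rw [sum_div]; exact sum_congr rfl fun j _ => by ring
    rw [h6, lt_div_iff₀ hX] at h1
    nlinarith
  · rw [Set.not_disjoint_iff] at hd
    obtain ⟨_, ⟨x, hx, rfl⟩, hxD⟩ := hd
    refine ⟨fun t => X * x t, fun t => mul_nonneg hX.le (hx.1 t), fun j => ?_, ?_⟩
    · have := hxD j
      rw [hφ, le_div_iff₀ hX] at this
      refine le_trans (le_of_eq ?_) this
      rw [sum_mul]; exact sum_congr rfl fun t _ => by ring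
    · rw [← mul_sum, hx.2, mul_one]

end Duality

section Cleaning

theorem exists_min_degree {α μ β : Type*} [Fintype α] [Fintype μ] [Fintype β]
    (R : α → μ → β → Prop) {δ : ℝ} (hδ : 0 < δ)
    (h : δ ≤ pr (fun x : α × μ × β => R x.1 x.2.1 x.2.2)) :
    ∃ (A : Finset α) (B : Finset β), A.Nonempty ∧
      (∀ a ∈ A, δ / 4 ≤ pr (fun y : μ × β => y.2 ∈ B ∧ R a y.1 y.2)) ∧
      ∀ b ∈ B, δ / 4 ≤ pr (fun y : α × μ => y.1 ∈ A ∧ R y.1 y.2 b) := by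
  classical
  obtain ⟨⟨a₀, m₀, b₀⟩, -⟩ := exists_of_pr_pos (hδ.trans_le h)
  have hα : (0:ℝ) < Fintype.card α := by exact_mod_cast Fintype.card_pos_iff.2 ⟨a₀⟩
  have hμ : (0:ℝ) < Fintype.card μ := by exact_mod_cast Fintype.card_pos_iff.2 ⟨m₀⟩
  have hβ : (0:ℝ) < Fintype.card β := by exact_mod_cast Fintype.card_pos_iff.2 ⟨b₀⟩
  set nα := (Fintype.card α : ℝ)
  set nμ := (Fintype.card μ : ℝ)
  set nβ := (Fintype.card β : ℝ)
  let D : α → β → ℝ := fun a b => ∑ m, if R a m b then 1 else 0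
  let g : Finset α × Finset β → ℝ := fun p =>
    ∑ a ∈ p.1, ∑ b ∈ p.2, D a b - δ / 4 * (p.1.card * (nμ * nβ) + p.2.card * (nα * nμ))
  obtain ⟨⟨A, B⟩, -, hmax⟩ := exists_max_image univ g univ_nonempty
  have hfull : δ * (nα * nμ * nβ) ≤ ∑ a, ∑ b, D a b := by
    rw [pr, le_div_iff₀ (by simp only [Fintype.card_prod, Nat.cast_mul]; positivity)] at h
    simp only [Fintype.card_prod, Nat.cast_mul, Fintype.sum_prod_type] at h
    refine le_trans (le_of_eq ?_) (h.trans (le_of_eq ?_))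
    · simp only [nα, nμ, nβ]; ring
    · refine sum_congr rfl fun a _ => ?_
      exact sum_comm
  have hpos : 0 < g (A, B) := by
    have h1 := hmax (univ, univ) (mem_univ _)
    simp only [g, card_univ] at h1
    have h2 : 0 < nα * nμ * nβ := by positivity
    have h3 : (Fintype.card α : ℝ) * (nμ * nβ) + Fintype.card β * (nα * nμ) =
      2 * (nα * nμ * nβ) := by simp only [nα, nμ, nβ]; ring
    rw [h3] at h1
    refine lt_of_lt_of_le ?_ h1
    nlinarith
  refine ⟨A, B, ?_, fun a ha => ?_, fun b hb => ?_⟩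
  · rw [nonempty_iff_ne_empty]
    rintro rfl
    simp only [g, sum_empty, card_empty, Nat.cast_zero, zero_mul, zero_add, zero_sub] at hpos
    have : 0 ≤ δ / 4 * ((B.card : ℝ) * (nα * nμ)) := by positivity
    linarith
  · have h1 := hmax (A.erase a, B) (mem_univ _)
    simp only [g] at h1
    rw [← add_sum_erase _ _ ha, card_erase_of_mem ha, Nat.cast_sub (card_pos.2 ⟨a, ha⟩)] at h1
    rw [pr, Fintype.card_prod, le_div_iff₀ (by push_cast; positivity), Nat.cast_mul,
      Fintype.sum_prod_type, sum_comm]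
    have h2 : ∑ b ∈ B, D a b =
        ∑ b, ∑ m, if (m, b).2 ∈ B ∧ R a (m, b).1 (m, b).2 then (1:ℝ) else 0 := by
      refine (sum_congr rfl fun b hb => ?_).trans (sum_subset (subset_univ B) fun b _ hb => ?_)
      · exact sum_congr rfl fun m _ => by simp [hb]
      · exact sum_eq_zero fun m _ => by simp [hb]
    refine le_trans ?_ (h2.le.trans (le_of_eq (by congr!)))
    push_cast at h1
    linarith
  · have h1 := hmax (A, B.erase b) (mem_univ _)
    simp only [g] at h1
    rw [sum_comm, sum_comm (s := A), ← add_sum_erase _ _ hb, card_erase_of_mem hb,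
      Nat.cast_sub (card_pos.2 ⟨b, hb⟩)] at h1
    rw [pr, Fintype.card_prod, le_div_iff₀ (by push_cast; positivity), Nat.cast_mul,
      Fintype.sum_prod_type]
    have h2 : ∑ a ∈ A, D a b =
        ∑ a, ∑ m, if (a, m).1 ∈ A ∧ R (a, m).1 (a, m).2 b then (1:ℝ) else 0 := by
      refine (sum_congr rfl fun a ha => ?_).trans (sum_subset (subset_univ A) fun a _ ha => ?_)
      · exact sum_congr rfl fun m _ => by simp [ha]
      · exact sum_eq_zero fun m _ => by simp [ha]
    refine le_trans ?_ (h2.le.trans (le_of_eq (by congr!)))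
    push_cast at h1
    linarith

end Cleaning

section Ladder

variable {V : Type} [Fintype V] [DecidableEq V] {ℓ q : ℕ} {E : Finset (Finset V)}

omit [Fintype V] in
theorem lk_edge_of_union_toF {k : ℕ} (hE : ∀ e ∈ E, e.card = k) (hk : k = ℓ + q + ℓ)
    {a b : Fin ℓ → V} {m : Fin q → V} (h : toF a ∪ toF m ∪ toF b ∈ E) :
    Lk ℓ E (toF a) (toF b) (toF m) ∧ (toF m).card = q := by
  have h0 := hE _ h
  have h1 := card_union_add_card_inter (toF a ∪ toF m) (toF b)
  have h2 := card_union_add_card_inter (toF a) (toF m)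
  have ha := card_toF_le a
  have hb := card_toF_le b
  have hm := card_toF_le m
  simp only [Fintype.card_fin] at ha hb hm
  have h3 : Disjoint (toF a ∪ toF m) (toF b) := by
    rw [disjoint_iff_inter_eq_empty, ← card_eq_zero]; omega
  have h4 : Disjoint (toF a) (toF m) := by
    rw [disjoint_iff_inter_eq_empty, ← card_eq_zero]; omega
  rw [disjoint_union_left] at h3
  exact ⟨.edge (by omega) (by omega) h3.1 h4 h3.2 h, by omega⟩

omit [Fintype V] in
theorem exists_ladder {k : ℕ} (hE : ∀ e ∈ E, e.card = k) (hk : k = ℓ + q + ℓ)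
    {QM : Fin q → Finset V} {f t : ℕ} (ht : 1 ≤ t) :
    ∀ {QA QB : Fin ℓ → Finset V} {PA PB : (Fin ℓ → V) → Prop},
    (∀ a, PA a → ∀ i, a i ∈ QA i) → (∀ b, PB b → ∀ i, b i ∈ QB i) →
    (∀ a, PA a → ∀ F : Finset V, F.card ≤ f → ∃ m b, PB b ∧ toF a ∪ toF m ∪ toF b ∈ E ∧
      (∀ i, m i ∈ QM i) ∧ Disjoint (toF m ∪ toF b) F) →
    (∀ b, PB b → ∀ F : Finset V, F.card ≤ f → ∃ m a, PA a ∧ toF b ∪ toF m ∪ toF a ∈ E ∧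
      (∀ i, m i ∈ QM i) ∧ Disjoint (toF m ∪ toF a) F) →
    ∀ a, PA a → ∀ F : Finset V, F.card + t * k ≤ f →
    ∃ (Y W : Finset V) (SA SB : Fin ℓ → Finset V) (SM : Fin q → Finset V),
      Lk ℓ E (toF a) Y W ∧ W.card + ℓ = t * (k - ℓ) ∧ Disjoint (W ∪ Y) F ∧
      (∀ i, SA i ⊆ QA i ∧ (SA i).card ≤ t / 2 + 1) ∧
      (∀ i, SB i ⊆ QB i ∧ (SB i).card ≤ (t + 1) / 2) ∧
      (∀ i, SM i ⊆ QM i ∧ (SM i).card ≤ t) ∧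
      toF a ∪ W ∪ Y ⊆ univ.biUnion SA ∪ univ.biUnion SB ∪ univ.biUnion SM := by
  induction t, ht using Nat.le_induction with
  | base =>
    intro QA QB PA PB hQA hQB hA hB a ha F hF
    obtain ⟨m, b, hb, he, hm, hd⟩ := hA a ha F (by omega)
    obtain ⟨h1, h2⟩ := lk_edge_of_union_toF hE hk he
    refine ⟨toF b, toF m, fun i => {a i}, fun i => {b i}, fun i => {m i}, h1, by omega, hd,
      fun i => ⟨by simpa using hQA a ha i, by simp⟩, fun i => ⟨by simpa using hQB b hb i, by simp⟩,
      fun i => ⟨by simpa using hm i, by simp⟩, ?_⟩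
    intro v
    simp only [mem_union, mem_toF, mem_biUnion, mem_univ, true_and, mem_singleton, eq_comm]
    tauto
  | succ t ht ih =>
    intro QA QB PA PB hQA hQB hA hB a ha F hF
    obtain ⟨m, b, hb, he, hm, hd⟩ := hA a ha F (by omega)
    obtain ⟨h1, h2⟩ := lk_edge_of_union_toF hE hk he
    have hcard : (F ∪ (toF a ∪ toF m ∪ toF b)).card ≤ F.card + k :=
      (card_union_le _ _).trans (by rw [hE _ he])
    obtain ⟨Y, W, SB, SA, SM, hlk, hW, hdW, hSB, hSA, hSM, hsub⟩ := ih hQB hQA hB hA b hb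
      (F ∪ (toF a ∪ toF m ∪ toF b)) (by rw [add_mul] at hF; omega)
    have h3 := hlk.disjoint
    have h4 := h1.disjoint
    refine ⟨Y, toF m ∪ toF b ∪ W, fun i => insert (a i) (SA i), SB, fun i => insert (m i) (SM i),
      h1.trans hlk ?_, ?_, ?_, ?_, ?_, ?_, ?_⟩
    · clear * - hdW
      simp only [disjoint_union_left, disjoint_union_right] at *
      simp only [disjoint_comm] at *; tauto
    · have e1 : Disjoint (toF m ∪ toF b) W := by
        clear * - hdW
        simp only [disjoint_union_left, disjoint_union_right] at *
        simp only [disjoint_comm] at *; tauto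
      rw [card_union_of_disjoint e1, card_union_of_disjoint h4.2.2, h2, h1.card_right, add_mul]
      omega
    · clear * - hdW hd
      simp only [disjoint_union_left, disjoint_union_right] at *
      simp only [disjoint_comm] at *; tauto
    · intro i
      refine ⟨insert_subset (hQA a ha i) (hSA i).1, (card_insert_le _ _).trans ?_⟩
      have := (hSA i).2
      omega
    · intro i
      have := (hSB i).2
      exact ⟨(hSB i).1, by omega⟩
    · intro i
      refine ⟨insert_subset (hm i) (hSM i).1, (card_insert_le _ _).trans ?_⟩
      have := (hSM i).2
      omega
    · intro v hv
      have h5 := @hsub v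
      simp only [mem_union, mem_toF, mem_biUnion, mem_univ, true_and, mem_insert] at hv h5 ⊢
      rcases hv with ((⟨i, rfl⟩ | (⟨i, rfl⟩ | hv) | hv)) | hv
      · exact Or.inl (Or.inl ⟨i, Or.inl rfl⟩)
      · exact Or.inr ⟨i, Or.inl rfl⟩
      all_goals
        rcases h5 (by tauto) with (⟨i, hi⟩ | ⟨i, hi⟩) | ⟨i, hi⟩
        · exact Or.inl (Or.inr ⟨i, hi⟩)
        · exact Or.inl (Or.inl ⟨i, Or.inr hi⟩)
        · exact Or.inr ⟨i, Or.inr hi⟩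

end Ladder

section Tiles

/-- The roles of the vertices of an edge of an `ℓ`-path: the two overlaps, and the `q` vertices
between them. -/
abbrev Role (ℓ q : ℕ) := Fin ℓ ⊕ Fin q ⊕ Fin ℓ

/-- The maximal number of vertices with a given role in a path with `t` edges. -/
def roleCost (ℓ q t : ℕ) : Role ℓ q → ℕ :=
  Sum.elim (fun _ => t / 2 + 1) (Sum.elim (fun _ => t) (fun _ => t / 2 + 1))

variable {V : Type} [Fintype V] [DecidableEq V] {ℓ q t : ℕ} {E : Finset (Finset V)}

/-- There is a path with `t` edges in the box `Q`. -/
def HasTile (ℓ q t : ℕ) (E : Finset (Finset V)) (Q : Role ℓ q → Finset V) : Prop :=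
  ∃ (X Y W : Finset V) (P : Role ℓ q → Finset V), Lk ℓ E X Y W ∧ W.card + ℓ = t * (ℓ + q) ∧
    (∀ i, P i ⊆ Q i ∧ (P i).card ≤ roleCost ℓ q t i) ∧ X ∪ W ∪ Y ⊆ univ.biUnion P

theorem pr_pair_hit_le {ι κ : Type*} [Fintype ι] [DecidableEq ι] [Fintype κ] [DecidableEq κ]
    [Nonempty V] (F : Finset V) :
    pr (fun y : (ι → V) × (κ → V) => ¬ Disjoint (toF y.1 ∪ toF y.2) F) ≤
      F.card * ((Fintype.card ι + Fintype.card κ) / Fintype.card V) := by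
  refine pr_hit_le _ (fun v => ?_) F
  have h1 := pr_or_le (fun y : (ι → V) × (κ → V) => v ∈ toF y.1) (fun y => v ∈ toF y.2)
  rw [pr_fst (fun x : ι → V => v ∈ toF x), pr_snd (fun x : κ → V => v ∈ toF x)] at h1
  have h2 := pr_mem_toF_le (ι := ι) v
  have h3 := pr_mem_toF_le (ι := κ) v
  rw [add_div]
  refine le_trans (pr_mono fun y hy => ?_) (h1.trans (add_le_add h2 h3))
  simpa using hy

theorem exists_extension_avoiding {ι κ : Type*} [Fintype ι] [DecidableEq ι] [Fintype κ]
    [DecidableEq κ] {R : (ι → V) → (κ → V) → Prop} {δ : ℝ}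
    (h : δ ≤ pr (fun y : (ι → V) × (κ → V) => R y.1 y.2)) {F : Finset V} {f : ℕ}
    (hF : F.card ≤ f) (hδ : 0 < δ)
    (hV : (f : ℝ) * (Fintype.card ι + Fintype.card κ) < δ * Fintype.card V) :
    ∃ x y, R x y ∧ Disjoint (toF x ∪ toF y) F := by
  have hV0 : (0:ℝ) < Fintype.card V := by
    by_contra! h0
    have : (0:ℝ) ≤ (f : ℝ) * (Fintype.card ι + Fintype.card κ) := by positivity
    nlinarith
  have : Nonempty V := Fintype.card_pos_iff.1 (by exact_mod_cast hV0)
  have h1 := pr_and_not_ge (fun y : (ι → V) × (κ → V) => R y.1 y.2)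
    (fun y => ¬ Disjoint (toF y.1 ∪ toF y.2) F)
  have h2 := pr_pair_hit_le (ι := ι) (κ := κ) F
  have h3 : (F.card : ℝ) * ((Fintype.card ι + Fintype.card κ) / Fintype.card V) < δ := by
    rw [← mul_div_assoc, div_lt_iff₀ hV0]
    refine lt_of_le_of_lt ?_ hV
    gcongr
  obtain ⟨⟨x, y⟩, hR, hd⟩ := exists_of_pr_pos ((by linarith : (0:ℝ) <
    pr (fun y : (ι → V) × (κ → V) => R y.1 y.2) -
      pr (fun y : (ι → V) × (κ → V) => ¬ Disjoint (toF y.1 ∪ toF y.2) F)).trans_le h1)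
  exact ⟨x, y, hR, not_not.1 hd⟩

omit V [Fintype V] [DecidableEq V] E in
theorem exists_hasTile {k : ℕ} (hk : k = ℓ + q + ℓ) (ht : 1 ≤ t) {δ : ℝ} (hδ : 0 < δ) :
    ∃ N : ℕ, ∀ (V : Type) [Fintype V] [DecidableEq V] (E : Finset (Finset V)),
      (∀ e ∈ E, e.card = k) → N ≤ Fintype.card V → ∀ Q : Role ℓ q → Finset V,
      δ ≤ pr (fun x : Role ℓ q → V => toF x ∈ E ∧ ∀ i, x i ∈ Q i) → HasTile ℓ q t E Q := by
  refine ⟨⌈((t * k : ℕ) : ℝ) * (q + ℓ) / (δ / 4)⌉₊ + 1, fun V _ _ E hE hN Q h => ?_⟩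
  have hV : ((t * k : ℕ) : ℝ) * (q + ℓ) < δ / 4 * Fintype.card V := by
    rw [mul_comm (δ / 4), ← div_lt_iff₀ (by positivity)]
    refine (Nat.le_ceil _).trans_lt ?_
    exact_mod_cast hN
  let R : (Fin ℓ → V) → (Fin q → V) → (Fin ℓ → V) → Prop := fun a m b =>
    toF a ∪ toF m ∪ toF b ∈ E ∧ (∀ i, a i ∈ Q (.inl i)) ∧ (∀ i, m i ∈ Q (.inr (.inl i))) ∧
      ∀ i, b i ∈ Q (.inr (.inr i))
  let e : (Role ℓ q → V) ≃ (Fin ℓ → V) × (Fin q → V) × (Fin ℓ → V) :=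
    (Equiv.sumArrowEquivProdArrow _ _ _).trans
      (Equiv.prodCongr (Equiv.refl _) (Equiv.sumArrowEquivProdArrow _ _ _))
  have hR : δ ≤ pr (fun x : (Fin ℓ → V) × (Fin q → V) × (Fin ℓ → V) => R x.1 x.2.1 x.2.2) := by
    rw [← pr_equiv e]
    refine h.trans (pr_mono fun x hx => ?_)
    refine ⟨?_, fun i => hx.2 _, fun i => hx.2 _, fun i => hx.2 _⟩
    convert hx.1 using 1
    rw [toF_sum x, toF_sum (x ∘ Sum.inr), union_assoc]
    rfl
  obtain ⟨A, B, ⟨a, ha⟩, hA, hB⟩ := exists_min_degree R hδ hR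
  obtain ⟨Y, W, SA, SB, SM, hlk, hW, -, hSA, hSB, hSM, hsub⟩ := exists_ladder (f := t * k) hE hk ht
    (QM := fun i => Q (.inr (.inl i)))
    (QA := fun i => Q (.inl i)) (QB := fun i => Q (.inr (.inr i)))
    (PA := fun a => a ∈ A ∧ ∀ i, a i ∈ Q (.inl i))
    (PB := fun b => b ∈ B ∧ ∀ i, b i ∈ Q (.inr (.inr i)))
    (fun a ha => ha.2) (fun b hb => hb.2)
    (by
      rintro a ⟨ha, -⟩ F hF
      obtain ⟨m, b, ⟨hb, hR⟩, hd⟩ := exists_extension_avoiding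
        (R := fun m b => b ∈ B ∧ R a m b) (hA a ha) hF (by positivity) (by simpa using hV)
      exact ⟨m, b, ⟨hb, hR.2.2.2⟩, hR.1, hR.2.2.1, hd⟩)
    (by
      rintro b ⟨hb, -⟩ F hF
      obtain ⟨a, m, ⟨ha, hR⟩, hd⟩ := exists_extension_avoiding
        (R := fun a m => a ∈ A ∧ R a m b) (hB b hb) hF (by positivity)
        (by simpa [add_comm] using hV)
      refine ⟨m, a, ⟨ha, hR.2.1⟩, ?_, hR.2.2.1, by rwa [union_comm]⟩
      have := hR.1
      rwa [union_comm (toF b ∪ toF m), union_comm (toF b), ← union_assoc])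
    a ⟨ha, by
      obtain ⟨y, hy⟩ := exists_of_pr_pos ((by positivity : 0 < δ / 4).trans_le (hA a ha))
      exact hy.2.2.1⟩ ∅ (by simp)
  refine ⟨toF a, Y, W, Sum.elim SA (Sum.elim SM SB), hlk, ?_, ?_, ?_⟩
  · rw [hW, hk]; congr 1; omega
  · rintro (i | i | i)
    · exact hSA i
    · exact hSM i
    · exact ⟨(hSB i).1, (hSB i).2.trans (show (t + 1) / 2 ≤ t / 2 + 1 by omega)⟩
  · refine hsub.trans fun v hv => ?_
    simp only [mem_union, mem_biUnion, mem_univ, true_and] at hv ⊢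
    rcases hv with (⟨i, hi⟩ | ⟨i, hi⟩) | ⟨i, hi⟩
    · exact ⟨.inl i, hi⟩
    · exact ⟨.inr (.inr i), hi⟩
    · exact ⟨.inr (.inl i), hi⟩

end Tiles

section Tiling

variable {V : Type} [Fintype V] [DecidableEq V] {ℓ q t : ℕ} {E : Finset (Finset V)}

open scoped Classical in
/-- The number of vertices in the class `j` used by a path in a box with labels `τ`. -/
noncomputable def labelUse {L : Type} (ℓ q t : ℕ) (τ : Role ℓ q → L) (j : L) : ℕ :=
  ∑ i, if τ i = j then roleCost ℓ q t i else 0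

open scoped Classical in
/-- The class of vertices with label `j`. -/
noncomputable def labelClass {L : Type} (χ : V → L) (j : L) : Finset V :=
  univ.filter fun v => χ v = j

omit [Fintype V] in
theorem Lk.card_verts {X Y W : Finset V} (h : Lk ℓ E X Y W) :
    (X ∪ W ∪ Y).card = W.card + ℓ + ℓ := by
  have h1 := h.disjoint
  rw [card_union_of_disjoint (by rw [disjoint_union_left]; tauto), card_union_of_disjoint h1.2.1,
    h.card_left, h.card_right]
  omega

theorem exists_forest_of_labels {L T : Type} [Fintype T] {χ : V → L} {τ : T → Role ℓ q → L}
    {ε : ℝ} (hτ : ∀ a, HasTile ℓ q t E (cell χ (τ a)) ∧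
      ¬ IrregularBox (fun Q => ¬ HasTile ℓ q t E Q) ε (cell χ (τ a)))
    {y : T → ℕ}
    (hy : ∀ j, (∑ a, y a * labelUse ℓ q t (τ a) j : ℝ) ≤ (1 - ε) * (labelClass χ j).card) :
    ∀ s ≤ ∑ a, y a, ∃ (y' : T → ℕ) (es : List (Finset V × Finset V)) (U : Finset V),
      (∀ a, y' a ≤ y a) ∧ ∑ a, y' a = s ∧ es.length = s ∧ Forest ℓ E es U ∧
      U.card = s * (t * (ℓ + q) + ℓ) ∧
      ∀ j, (U ∩ labelClass χ j).card ≤ ∑ a, y' a * labelUse ℓ q t (τ a) j := by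
  classical
  intro s
  induction s with
  | zero => exact fun _ => ⟨fun _ => 0, [], ∅, by simp, by simp, rfl, rfl, by simp, by simp⟩
  | succ s ih =>
    intro hs
    obtain ⟨y', es, U, hle, hsum, hlen, hfor, hcard, huse⟩ := ih (by omega)
    obtain ⟨a, ha⟩ : ∃ a, y' a < y a := by
      by_contra! hcon
      have := sum_le_sum fun a (_ : a ∈ univ) => hcon a
      omega
    have hsize : ∀ j, ε * (labelClass χ j).card ≤ (labelClass χ j \ U).card := by
      intro j
      have h1 := card_sdiff_add_card_inter (labelClass χ j) U
      have h2 : ((U ∩ labelClass χ j).card : ℝ) ≤ (1 - ε) * (labelClass χ j).card := by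
        refine le_trans ?_ (hy j)
        have h3 : ∑ a, y' a * labelUse ℓ q t (τ a) j ≤ ∑ a, y a * labelUse ℓ q t (τ a) j :=
          sum_le_sum fun a _ => Nat.mul_le_mul_right _ (hle a)
        exact_mod_cast (huse j).trans h3
      rw [inter_comm] at h1
      have h4 : ((labelClass χ j \ U).card : ℝ) + (U ∩ labelClass χ j).card =
        (labelClass χ j).card := by exact_mod_cast h1
      linarith
    have htile : HasTile ℓ q t E (fun i => cell χ (τ a) i \ U) := by
      by_contra hno
      exact (hτ a).2 ⟨not_not.2 (hτ a).1, _, fun i => sdiff_subset,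
        fun i => hsize (τ a i), hno⟩
    obtain ⟨X, Y, W, P, hlk, hW, hP, hsub⟩ := htile
    have hd : Disjoint (X ∪ W ∪ Y) U := by
      rw [disjoint_left]
      intro v hv
      obtain ⟨i, -, hi⟩ := mem_biUnion.1 (hsub hv)
      exact (mem_sdiff.1 ((hP i).1 hi)).2
    refine ⟨fun b => y' b + if b = a then 1 else 0, (X, Y) :: es, X ∪ W ∪ Y ∪ U, ?_, ?_, ?_,
      ⟨W, U, hlk, hd, hfor, rfl⟩, ?_, ?_⟩
    · intro b
      have := hle b
      by_cases h : b = a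
      · subst h; simpa using ha
      · simpa [h] using this
    · rw [sum_add_distrib, hsum]; simp
    · simp [hlen]
    · rw [card_union_of_disjoint hd, hcard, hlk.card_verts, hW]; ring
    · intro j
      have h1 : ((X ∪ W ∪ Y) ∩ labelClass χ j).card ≤ labelUse ℓ q t (τ a) j := by
        have h2 : (X ∪ W ∪ Y) ∩ labelClass χ j ⊆
            univ.biUnion fun i => if τ a i = j then P i else ∅ := by
          intro v hv
          rw [mem_inter] at hv
          obtain ⟨i, -, hi⟩ := mem_biUnion.1 (hsub hv.1)
          have h3 : χ v = τ a i := mem_cell.1 (mem_sdiff.1 ((hP i).1 hi)).1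
          have h4 : χ v = j := by simpa [labelClass] using hv.2
          refine mem_biUnion.2 ⟨i, mem_univ _, ?_⟩
          rw [if_pos (h3.symm.trans h4)]; exact hi
        refine (card_le_card h2).trans (card_biUnion_le.trans (sum_le_sum fun i _ => ?_))
        split_ifs
        · exact (hP i).2
        · simp
      rw [union_inter_distrib_right]
      refine (card_union_le _ _).trans ?_
      simp only [add_mul, sum_add_distrib]
      have h5 : ∑ b, (if b = a then 1 else 0) * labelUse ℓ q t (τ b) j =
        labelUse ℓ q t (τ a) j := by simp
      rw [h5]
      have := huse j
      omega

/-- The normalised number of vertices with a given role in a long path. -/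
noncomputable def roleWeight (ℓ q : ℕ) : Role ℓ q → ℝ :=
  Sum.elim (fun _ => 1 / 2) (Sum.elim (fun _ => 1) (fun _ => 1 / 2))

theorem roleCost_le (ℓ q t : ℕ) (i : Role ℓ q) :
    (roleCost ℓ q t i : ℝ) ≤ (t + 2) * roleWeight ℓ q i := by
  have h : (((t / 2 : ℕ) : ℝ)) ≤ t / 2 := Nat.cast_div_le
  rcases i with i | i | i <;> simp only [roleCost, roleWeight, Sum.elim_inl, Sum.elim_inr] <;>
    push_cast <;> linarith

theorem sum_roleWeight (ℓ q : ℕ) : ∑ i, roleWeight ℓ q i = (ℓ + q : ℕ) := by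
  simp [roleWeight]; ring

omit [Fintype V] in
theorem HasTile.mono {Q Q' : Role ℓ q → Finset V} (hQ : ∀ i, Q' i ⊆ Q i)
    (h : HasTile ℓ q t E Q') : HasTile ℓ q t E Q := by
  obtain ⟨X, Y, W, P, h1, h2, h3, h4⟩ := h
  exact ⟨X, Y, W, P, h1, h2, fun i => ⟨(h3 i).1.trans (hQ i), (h3 i).2⟩, h4⟩

theorem pr_cell_irregular_le {L : Type} [Fintype L] {χ : V → L} {δ : ℝ} {M : ℕ} (hδ : 0 ≤ δ)
    (hL : Fintype.card L ≤ M)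
    (h : ∀ Q : Role ℓ q → Finset V, δ ≤ pr (fun x : Role ℓ q → V => toF x ∈ E ∧ ∀ i, x i ∈ Q i) →
      HasTile ℓ q t E Q) :
    pr (fun x : Role ℓ q → V => toF x ∈ E ∧ ¬ HasTile ℓ q t E (cell χ (χ ∘ x))) ≤
      (M ^ Fintype.card (Role ℓ q) : ℕ) * δ := by
  classical
  rw [pr_fiber (fun x : Role ℓ q → V => χ ∘ x)]
  have h1 : ∀ τ : Role ℓ q → L, pr (fun x : Role ℓ q → V => χ ∘ x = τ ∧ toF x ∈ E ∧
      ¬ HasTile ℓ q t E (cell χ (χ ∘ x))) ≤ δ := by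
    intro τ
    by_contra! hcon
    have h2 := h (cell χ τ) (hcon.le.trans (pr_mono fun x hx =>
      ⟨hx.2.1, fun i => mem_cell.2 (congrFun hx.1 i)⟩))
    obtain ⟨x, rfl, -, h3⟩ := exists_of_pr_pos (hδ.trans_lt hcon)
    exact h3 h2
  refine (sum_le_sum fun τ _ => h1 τ).trans ?_
  rw [sum_const, card_univ, nsmul_eq_mul, Fintype.card_fun]
  gcongr

end Tiling

section Tiling

theorem tile_count_le {n p t D K ε s : ℝ} (hn : 0 ≤ n) (hp : 0 < p) (hε0 : 0 < ε) (hε1 : ε ≤ 1)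
    (ht : 8 ≤ ε * t) (hD : t * p ≤ D) (hK : K * D ≤ ε / 4 * n) (hs : s * D ≤ (1 - ε) * n) :
    s ≤ (1 - ε / 4) * ((1 - ε / 4) * n / p) / (t + 2) - K := by
  have ht0 : 0 < t := by
    by_contra! h
    nlinarith
  have hD0 : 0 < D := lt_of_lt_of_le (by positivity) hD
  have h1 : p * (t + 2) ≤ (1 + ε / 4) * D := by
    have : p * (t + 2) ≤ (1 + ε / 4) * (t * p) := by nlinarith
    refine this.trans (mul_le_mul_of_nonneg_left hD (by positivity))
  have h2 : (s + K) * D ≤ (1 - 3 / 4 * ε) * n := by linarith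
  have h3 : s + K ≤ (1 - 3 / 4 * ε) * n / D := by rw [le_div_iff₀ hD0]; exact h2
  have h4 : (1 - 3 / 4 * ε) * n / D ≤ (1 - ε / 4) * ((1 - ε / 4) * n / p) / (t + 2) := by
    rw [← mul_div_assoc, div_div, div_le_div_iff₀ hD0 (by positivity)]
    have h5 : 0 ≤ (1 - 3 / 4 * ε) * n := mul_nonneg (by linarith) hn
    have h6 : (1 - 3 / 4 * ε) * n * (p * (t + 2)) ≤ (1 - 3 / 4 * ε) * n * ((1 + ε / 4) * D) :=
      mul_le_mul_of_nonneg_left h1 h5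
    have h7 : 0 ≤ n * D := by positivity
    have h8 : 0 ≤ ε ^ 2 * (n * D) := by positivity
    nlinarith
  linarith

theorem exists_tiling {k ℓ q t : ℕ} (hl : 1 ≤ ℓ) (hk : k = ℓ + q + ℓ) (hp : 3 ≤ ℓ + q)
    {c ξ ξ' κ ε : ℝ} (hc : c = 1 / (2 * (ℓ + q : ℕ))) (hξ0 : 0 < ξ) (hξ1 : ξ ≤ 3 / 20)
    (hξ' : 0 < ξ') (hκ0 : 0 < κ) (hκ : 48 * (ℓ + q : ℕ) * κ ≤ ξ) (hε0 : 0 < ε) (hε1 : ε ≤ 1)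
    (ht : 8 ≤ ε * t) :
    ∃ N : ℕ, ∀ (V : Type) [Fintype V] [DecidableEq V] (E : Finset (Finset V)),
      (∀ e ∈ E, e.card = k) → N ≤ Fintype.card V → DegCond (2 * c - c ^ 2 - κ) k E →
      (∀ B : Finset V, (1 - c - ξ) * Fintype.card V ≤ B.card →
        ξ' ≤ pr (fun x : Role ℓ q → V => toF x ∈ E ∧ ∀ i, x i ∈ B)) →
      ∀ s : ℕ, (s : ℝ) * (t * (ℓ + q) + ℓ : ℕ) ≤ (1 - ε) * Fintype.card V →
      ∃ (es : List (Finset V × Finset V)) (U : Finset V), es.length = s ∧ Forest ℓ E es U ∧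
        U.card = s * (t * (ℓ + q) + ℓ) := by
  have ht1 : 1 ≤ t := by
    rcases Nat.eq_zero_or_pos t with rfl | h
    · norm_num at ht
    · exact h
  have hk' : Fintype.card (Role ℓ q) = k := by simp [hk]; omega
  have hr0 : ∀ i, 0 ≤ roleWeight ℓ q i := by
    rintro (i | i | i) <;> simp [roleWeight]
  obtain ⟨ε₁, hε₁, N₁, hN₁⟩ := weight_bound (a := (Sum.inl ⟨0, hl⟩ : Role ℓ q))
    (b := Sum.inr (Sum.inr ⟨0, hl⟩)) (by simp) (roleWeight ℓ q) hr0 rfl rfl hp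
    (sum_roleWeight ℓ q) hk' hc hξ0 hξ1 hξ' hκ0 hκ (η := ε / 4) (by positivity) (by linarith)
  obtain ⟨ν, hν⟩ : ∃ ν, ν = min (ε / 4) (ε₁ / 2) := ⟨_, rfl⟩
  have hν0 : 0 < ν := by rw [hν]; positivity
  have hν1 : ν ≤ ε / 4 := by rw [hν]; exact min_le_left _ _
  have hν2 : ν ≤ ε₁ / 2 := by rw [hν]; exact min_le_right _ _
  obtain ⟨M, hM⟩ := exists_partition (Role ℓ q) hν0
  obtain ⟨K, hK⟩ : ∃ K, K = M ^ Fintype.card (Role ℓ q) := ⟨_, rfl⟩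
  have hδ : 0 < ε₁ / (2 * (K + 1)) := by positivity
  obtain ⟨N₂, hN₂⟩ := exists_hasTile (t := t) hk ht1 hδ
  refine ⟨N₁ + N₂ + ⌈(K : ℝ) * (t * (ℓ + q) + ℓ : ℕ) / (ε / 4)⌉₊, ?_⟩
  intro V _ _ E hE hN hdeg hrob s hs
  obtain ⟨L, _, χ, hL, hirr⟩ := hM V (fun Q => ¬ HasTile ℓ q t E Q)
    (fun Q Q' hQ h h' => h (h'.mono hQ))
  classical
  let T := {τ : Role ℓ q → L // HasTile ℓ q t E (cell χ τ) ∧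
    ¬ IrregularBox (fun Q => ¬ HasTile ℓ q t E Q) ν (cell χ τ)}
  have hT : Fintype.card T ≤ K := by
    refine (Fintype.card_subtype_le _).trans ?_
    rw [Fintype.card_fun, hK]
    exact Nat.pow_le_pow_left hL _
  have hbad : pr (fun x : Role ℓ q → V => (toF x ∈ E ∧ ¬ HasTile ℓ q t E (cell χ (χ ∘ x))) ∨
      IrregularBox (fun Q => ¬ HasTile ℓ q t E Q) ν (cell χ (χ ∘ x))) ≤ ε₁ := by
    refine (pr_or_le _ _).trans ?_
    have h1 := pr_cell_irregular_le (χ := χ) hδ.le hL (hN₂ V E hE (by omega))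
    rw [← hK] at h1
    have h2 : (K : ℝ) * (ε₁ / (2 * (K + 1))) ≤ ε₁ / 2 := by
      rw [← mul_div_assoc, div_le_div_iff₀ (by positivity) (by norm_num)]
      nlinarith
    linarith
  have hp0 : (0:ℝ) < (ℓ + q : ℕ) := by exact_mod_cast (by omega : 0 < ℓ + q)
  have hfrac := exists_fractional_packing
    (fun (a : T) j => ∑ i, if a.1 i = j then roleWeight ℓ q i else 0)
    (s := fun j => ((labelClass χ j).card : ℝ)) (fun j => by positivity)
    (X := (1 - ε / 4) * Fintype.card V / (ℓ + q : ℕ))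
    (div_nonneg (mul_nonneg (by linarith) (by positivity)) hp0.le) (by
      intro w hw hge
      have h1 := hN₁ V E (by omega) hdeg hrob _ hbad (fun v => (ℓ + q : ℕ) * w (χ v))
        (fun v => mul_nonneg hp0.le (hw _)) (by
          intro x hxE hxb
          push Not at hxb
          have h2 := hge ⟨χ ∘ x, hxb.1 hxE, hxb.2⟩
          simp only [sum_mul, ite_mul, zero_mul] at h2
          rw [sum_comm] at h2
          simp only [sum_ite_eq, mem_univ, if_true, Function.comp] at h2
          have h3 : ∑ i, roleWeight ℓ q i * ((ℓ + q : ℕ) * w (χ (x i))) =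
              (ℓ + q : ℕ) * ∑ i, roleWeight ℓ q i * w (χ (x i)) := by
            rw [mul_sum]; exact sum_congr rfl fun i _ => by ring
          rw [h3]
          nlinarith)
      rw [div_le_iff₀' hp0]
      refine h1.trans (le_of_eq ?_)
      rw [← mul_sum, ← sum_fiberwise univ χ]
      congr 1
      refine sum_congr rfl fun j _ => ?_
      rw [sum_congr rfl (g := fun _ => w j) (fun v hv => by rw [(mem_filter.1 hv).2]), sum_const,
        nsmul_eq_mul]
      congr!)
  obtain ⟨x, hx0, hxs, hxX⟩ := hfrac
  let y : T → ℕ := fun a => ⌊(1 - ν) * x a / (t + 2)⌋₊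
  have ht2 : (0:ℝ) < t + 2 := by positivity
  have hν3 : 0 ≤ 1 - ν := by linarith
  obtain ⟨y', es, U, -, -, hes, hfor, hcard, -⟩ := exists_forest_of_labels (χ := χ)
    (τ := fun a : T => a.1) (ε := ν) (y := y) (fun a => a.2) (by
      intro j
      refine le_trans ?_ (mul_le_mul_of_nonneg_left (hxs j) hν3)
      rw [mul_sum]
      refine sum_le_sum fun a _ => ?_
      have h1 : (y a : ℝ) ≤ (1 - ν) * x a / (t + 2) :=
        Nat.floor_le (div_nonneg (mul_nonneg hν3 (hx0 a)) ht2.le)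
      have h2 : (labelUse ℓ q t a.1 j : ℝ) ≤
          (t + 2) * ∑ i, if a.1 i = j then roleWeight ℓ q i else 0 := by
        unfold labelUse
        push_cast
        rw [mul_sum]
        refine sum_le_sum fun i _ => ?_
        split_ifs
        · exact roleCost_le ℓ q t i
        · simp
      have h3 : 0 ≤ ∑ i, if a.1 i = j then roleWeight ℓ q i else 0 :=
        sum_nonneg fun i _ => by
          split_ifs
          · exact hr0 i
          · exact le_rfl
      calc (y a : ℝ) * labelUse ℓ q t a.1 j
          ≤ (1 - ν) * x a / (t + 2) *
            ((t + 2) * ∑ i, if a.1 i = j then roleWeight ℓ q i else 0) :=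
            mul_le_mul h1 h2 (by positivity) (div_nonneg (mul_nonneg hν3 (hx0 a)) ht2.le)
        _ = _ := by field_simp) s (by
      have h1 : (1 - ν) * ((1 - ε / 4) * Fintype.card V / (ℓ + q : ℕ)) / (t + 2) - K ≤
          ((∑ a, y a : ℕ) : ℝ) := by
        rw [← hxX, mul_sum, sum_div]
        push_cast
        have h2 : ∑ a : T, ((1 - ν) * x a / (t + 2) - 1) ≤ ∑ a, (y a : ℝ) :=
          sum_le_sum fun a _ => (Nat.sub_one_lt_floor _).le
        rw [sum_sub_distrib, sum_const, card_univ, nsmul_eq_mul, mul_one] at h2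
        have h3 : (Fintype.card T : ℝ) ≤ K := by exact_mod_cast hT
        linarith
      have h2 := tile_count_le (n := Fintype.card V) (p := (ℓ + q : ℕ)) (t := t)
        (D := (t * (ℓ + q) + ℓ : ℕ)) (K := K) (ε := ε) (s := s) (by positivity) hp0 hε0 hε1 ht
        (by push_cast; nlinarith [(Nat.cast_nonneg ℓ : (0:ℝ) ≤ ℓ)])
        (le_mul_of_ceil_le (by positivity) (by omega)) hs
      have h3 : (1 - ε / 4) * ((1 - ε / 4) * Fintype.card V / (ℓ + q : ℕ)) / (t + 2) ≤
          (1 - ν) * ((1 - ε / 4) * Fintype.card V / (ℓ + q : ℕ)) / ((t:ℝ) + 2) := by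
        have : 0 ≤ (1 - ε / 4) * Fintype.card V / (ℓ + q : ℕ) :=
          div_nonneg (mul_nonneg (by linarith) (by positivity)) hp0.le
        gcongr
      have h4 : (s : ℝ) ≤ ((∑ a, y a : ℕ) : ℝ) := by linarith
      exact_mod_cast h4)
  exact ⟨es, U, hes, hfor, hcard⟩

end Tiling

section Transfer

theorem pr_le_pr_comp {α β : Type*} [Fintype α] [Fintype β] {f : α → β}
    (hf : Function.Injective f) {P : β → Prop} (hP : ∀ b, P b → ∃ a, f a = b) :
    pr P ≤ pr (fun a => P (f a)) := by
  classical
  rw [pr_eq_card, pr_eq_card]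
  rcases isEmpty_or_nonempty α with hα | hα
  · have : (univ.filter P) = ∅ := by
      refine filter_eq_empty_iff.2 fun b _ hb => ?_
      obtain ⟨a, -⟩ := hP b hb
      exact hα.elim a
    rw [this]
    simp
  · have h1 : (0:ℝ) < Fintype.card α := by exact_mod_cast Fintype.card_pos
    have h2 : (Fintype.card α : ℝ) ≤ Fintype.card β := by
      exact_mod_cast Fintype.card_le_of_injective f hf
    have h3 : #(univ.filter P) ≤ #(univ.filter fun a => P (f a)) := by
      rw [← card_image_of_injective _ hf]
      refine card_le_card fun b hb => ?_
      rw [mem_filter] at hb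
      obtain ⟨a, rfl⟩ := hP b hb.2
      exact mem_image_of_mem _ (mem_filter.2 ⟨mem_univ _, hb.2⟩)
    gcongr

/-- The subhypergraph induced on the complement of `W`. -/
def deleteVerts {V : Type*} [Fintype V] [DecidableEq V] (W : Finset V) (E : Finset (Finset V)) :
    Finset (Finset {v // v ∉ W}) :=
  univ.filter fun e => e.map (Function.Embedding.subtype _) ∈ E

variable {V : Type*} [Fintype V] [DecidableEq V] {W : Finset V} {E : Finset (Finset V)}

theorem mem_deleteVerts {e : Finset {v // v ∉ W}} :
    e ∈ deleteVerts W E ↔ e.map (Function.Embedding.subtype _) ∈ E := by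
  simp [deleteVerts]

theorem card_eq_of_mem_deleteVerts {k : ℕ} (hE : ∀ e ∈ E, e.card = k) :
    ∀ e ∈ deleteVerts W E, e.card = k := by
  intro e he
  rw [← card_map (Function.Embedding.subtype fun v => v ∉ W)]
  exact hE _ (mem_deleteVerts.1 he)

theorem Lk.of_deleteVerts {ℓ : ℕ} {X Y Z : Finset {v // v ∉ W}}
    (h : Lk ℓ (deleteVerts W E) X Y Z) :
    Lk ℓ E (X.map (Function.Embedding.subtype _)) (Y.map (Function.Embedding.subtype _))
      (Z.map (Function.Embedding.subtype _)) := by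
  induction h with
  | edge hX hY hXY hXW hWY he =>
    refine Lk.edge (by simpa) (by simpa) ?_ ?_ ?_ ?_
    · exact (disjoint_map _).2 hXY
    · exact (disjoint_map _).2 hXW
    · exact (disjoint_map _).2 hWY
    · rw [← map_union, ← map_union]; exact mem_deleteVerts.1 he
  | trans _ _ hd ih1 ih2 =>
    rw [map_union, map_union]
    refine Lk.trans ih1 ih2 ?_
    rw [← map_union, ← map_union]
    exact (disjoint_map _).2 hd

theorem Forest.of_deleteVerts {ℓ : ℕ} {es : List (Finset {v // v ∉ W} × Finset {v // v ∉ W})}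
    {U : Finset {v // v ∉ W}} (h : Forest ℓ (deleteVerts W E) es U) :
    Forest ℓ E (es.map fun p => (p.1.map (Function.Embedding.subtype _),
      p.2.map (Function.Embedding.subtype _))) (U.map (Function.Embedding.subtype _)) := by
  induction es generalizing U with
  | nil =>
    obtain rfl : U = ∅ := h
    rfl
  | cons p es ih =>
    obtain ⟨I, Z, h1, h2, h3, rfl⟩ := h
    refine ⟨_, _, h1.of_deleteVerts, ?_, ih h3, ?_⟩
    · rw [← map_union, ← map_union]
      exact (disjoint_map _).2 h2
    · simp only [map_union]

theorem card_compl_verts (W : Finset V) :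
    (Fintype.card {v // v ∉ W} : ℝ) = Fintype.card V - W.card := by
  have h1 : Fintype.card {v // v ∉ W} = Fintype.card V - W.card := by
    rw [Fintype.card_subtype_compl]
    simp
  rw [h1, Nat.cast_sub (card_le_univ _)]

theorem DegCond.deleteVerts {d η : ℝ} {k : ℕ} (h : DegCond d k E)
    (hη0 : 0 ≤ η)     (hW : (W.card : ℝ) ≤ η * Fintype.card V) :
    DegCond (d - 2 * η) k (deleteVerts W E) := by
  intro S hS
  have h1 := h (S.map (Function.Embedding.subtype _)) (by simpa using hS)
  have hη : 2 * ((W.card : ℝ) / Fintype.card V) ≤ 2 * η := by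
    rcases isEmpty_or_nonempty V with hV | hV
    · simpa using hη0
    · have : (0:ℝ) < Fintype.card V := by exact_mod_cast Fintype.card_pos
      gcongr
      rwa [div_le_iff₀ this]
  have h2 : pr (fun p : V × V => p.1 ∈ W ∨ p.2 ∈ W) ≤ 2 * ((W.card : ℝ) / Fintype.card V) := by
    refine (pr_or_le _ _).trans ?_
    rcases isEmpty_or_nonempty V with hV | hV
    · simp [pr]
    · rw [pr_fst (fun v => v ∈ W), pr_snd (fun v => v ∈ W), pr_mem]
      linarith
  have h3 := pr_and_not_ge (fun p : V × V => insert p.1 (insert p.2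
    (S.map (Function.Embedding.subtype _))) ∈ E) (fun p : V × V => p.1 ∈ W ∨ p.2 ∈ W)
  have h4 : Function.Injective (fun p : {v // v ∉ W} × {v // v ∉ W} => ((p.1 : V), (p.2 : V))) := by
    intro p p' hp
    simp only [Prod.mk.injEq] at hp
    exact Prod.ext (Subtype.ext hp.1) (Subtype.ext hp.2)
  have h5 := pr_le_pr_comp h4 (P := fun p : V × V => insert p.1 (insert p.2
    (S.map (Function.Embedding.subtype _))) ∈ E ∧ ¬ (p.1 ∈ W ∨ p.2 ∈ W)) (by
      rintro ⟨a, b⟩ ⟨-, hab⟩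
      push Not at hab
      exact ⟨(⟨a, hab.1⟩, ⟨b, hab.2⟩), rfl⟩)
  have h6 : d - 2 * η ≤ pr (fun p : V × V => insert p.1 (insert p.2
    (S.map (Function.Embedding.subtype _))) ∈ E ∧ ¬ (p.1 ∈ W ∨ p.2 ∈ W)) := by
    linarith
  refine h6.trans (h5.trans (pr_mono ?_))
  rintro ⟨a, b⟩ ⟨hab, -⟩
  rw [mem_deleteVerts, map_insert, map_insert]
  exact hab

theorem robust_deleteVerts {ι : Type*} [Fintype ι] [DecidableEq ι] {b b' δ : ℝ}
    (h : ∀ B : Finset V, b * Fintype.card V ≤ B.card →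
      δ ≤ pr (fun x : ι → V => toF x ∈ E ∧ ∀ i, x i ∈ B))
    (hb : b * Fintype.card V ≤ b' * Fintype.card {v // v ∉ W}) (B : Finset {v // v ∉ W})
    (hB : b' * Fintype.card {v // v ∉ W} ≤ B.card) :
    δ ≤ pr (fun x : ι → {v // v ∉ W} => toF x ∈ deleteVerts W E ∧ ∀ i, x i ∈ B) := by
  refine (h (B.map (Function.Embedding.subtype _)) ?_).trans ?_
  · rw [card_map]; exact hb.trans hB
  · refine (pr_le_pr_comp (f := fun (x : ι → {v // v ∉ W}) i => (x i : V)) ?_ ?_).trans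
      (pr_mono ?_)
    · intro x y hxy
      exact funext fun i => Subtype.ext (congrFun hxy i)
    · rintro x ⟨-, hx⟩
      choose y hy using fun i => mem_map.1 (hx i)
      exact ⟨y, funext fun i => (hy i).2⟩
    · rintro x ⟨h1, h2⟩
      refine ⟨?_, fun i => ?_⟩
      · rw [mem_deleteVerts]
        convert h1 using 1
        ext v
        simp [toF]
      · obtain ⟨y, hy, hxy⟩ := mem_map.1 (h2 i)
        rwa [← Subtype.ext hxy]

end Transfer

section FromDegrees

theorem two_mul_deg_le {n k : ℕ} {E : Finset (Finset (Fin n))} (hE : Uniform n k E) (hk : 2 ≤ k)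
    {S : Finset (Fin n)} (hS : S.card = k - 2) :
    2 * deg E S ≤ #(univ.filter fun p : Fin n × Fin n => insert p.1 (insert p.2 S) ∈ E) := by
  rw [deg, card_eq_sum_card_fiberwise (t := E.filter fun e => S ⊆ e)
    (f := fun p : Fin n × Fin n => insert p.1 (insert p.2 S)) (by
      intro p hp
      simp only [coe_filter, mem_univ, true_and, Set.mem_ofPred_eq] at hp ⊢
      exact ⟨hp, fun x hx => by simp [hx]⟩), mul_comm]
  refine (smul_eq_mul (α := ℕ) _ _) ▸ card_nsmul_le_sum _ _ _ fun e he => ?_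
  rw [mem_filter] at he
  have h1 : #(e \ S) = 2 := by
    rw [card_sdiff_of_subset he.2, hE e he.1, hS]
    omega
  obtain ⟨a, b, hab, h2⟩ := card_eq_two.1 h1
  have h3 : insert a (insert b S) = e := by
    rw [← union_sdiff_of_subset he.2, h2]
    ext x
    simp only [mem_insert, mem_union, mem_singleton]
    tauto
  rw [← card_pair (a := (a, b)) (b := (b, a)) (by simp [hab])]
  refine card_le_card fun p hp => ?_
  rw [mem_insert, mem_singleton] at hp
  rw [mem_filter, mem_filter]
  rcases hp with rfl | rfl
  · exact ⟨⟨mem_univ _, h3 ▸ he.1⟩, h3⟩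
  · rw [insert_comm] at h3
    exact ⟨⟨mem_univ _, h3 ▸ he.1⟩, h3⟩

theorem degCond_of_minDeg {n k : ℕ} {E : Finset (Finset (Fin n))} (hE : Uniform n k E)
    (hk : 2 ≤ k) (hn : 0 < n) {d : ℝ} (hd : d ≤ 1)
    (h : d * (n.choose 2 : ℝ) ≤ (minDeg n E (k - 2) : ℝ)) : DegCond (d - 1 / n) k E := by
  intro S hS
  have h1 : minDeg n E (k - 2) ≤ deg E S := Nat.sInf_le ⟨S, hS, rfl⟩
  have h2 := two_mul_deg_le hE hk hS
  have hn' : (0:ℝ) < n := by exact_mod_cast hn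
  have h3 : (2:ℝ) * minDeg n E (k - 2) ≤
      #(univ.filter fun p : Fin n × Fin n => insert p.1 (insert p.2 S) ∈ E) := by
    exact_mod_cast (Nat.mul_le_mul_left 2 h1).trans h2
  rw [Nat.cast_choose_two] at h
  rw [pr_eq_card, Fintype.card_prod, Fintype.card_fin, le_div_iff₀ (by positivity)]
  refine le_trans ?_ (h3.trans (le_of_eq (by congr!)))
  push_cast
  have h4 : (d - 1 / n) * ((n:ℝ) * n) = d * n * n - n := by field_simp
  nlinarith

theorem card_edges_le_pr {V ι : Type*} [Fintype V] [DecidableEq V] [Fintype ι] [DecidableEq ι]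
    [Nonempty V] {E : Finset (Finset V)} (hE : ∀ e ∈ E, e.card = Fintype.card ι) (B : Finset V) :
    (#(E.filter fun e => e ⊆ B) : ℝ) ≤
      pr (fun x : ι → V => toF x ∈ E ∧ ∀ i, x i ∈ B) * Fintype.card V ^ Fintype.card ι := by
  classical
  rw [pr_eq_card, Fintype.card_fun, Nat.cast_pow, div_mul_cancel₀ _ (by positivity)]
  norm_cast
  refine card_le_card_of_surjOn toF fun e he => ?_
  simp only [coe_filter, Set.mem_ofPred_eq] at he
  have e' : ι ≃ e := Fintype.equivOfCardEq (by rw [Fintype.card_coe, hE e he.1])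
  have h1 : toF (fun i => (e' i : V)) = e := by
    ext v
    rw [mem_toF]
    exact ⟨by rintro ⟨i, rfl⟩; exact (e' i).2, fun hv => ⟨e'.symm ⟨v, hv⟩, by simp⟩⟩
  refine ⟨fun i => (e' i : V), ?_, h1⟩
  simp only [coe_filter, mem_univ, true_and, Set.mem_ofPred_eq]
  exact ⟨h1.symm ▸ he.1, fun i => he.2 (e' i).2⟩

theorem le_choose_of_two_mul_le {n k : ℕ} (h : 2 * k ≤ n) :
    (n : ℝ) ^ k / (2 ^ k * k.factorial) ≤ n.choose k := by
  have h1 := Nat.pow_le_choose (α := ℝ) k n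
  refine le_trans ?_ h1
  rw [← div_div, ← div_pow]
  have h3 : (n : ℝ) / 2 ≤ ((n + 1 - k : ℕ) : ℝ) := by
    rw [Nat.cast_sub (by omega)]
    push_cast
    have : (2:ℝ) * k ≤ n := by exact_mod_cast h
    linarith
  gcongr

theorem lt_edgesIn_of_not_isExtremal {n k ℓ : ℕ} {E : Finset (Finset (Fin n))} {ξ : ℝ}
    (hlk : ℓ < k) (hn : 0 < n) (h : ¬ IsExtremal n k ℓ E ξ) {B : Finset (Fin n)}
    (hB : B.card = ⌊(2 * ((k - ℓ : ℕ) : ℝ) - 1) * (n : ℝ) / (2 * ((k - ℓ : ℕ) : ℝ)) + 1⌋₊) :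
    ξ * (n.choose k : ℝ) < edgesIn E B := by
  by_contra! hcon
  refine h ⟨Bᶜ, B, disjoint_compl_left, by rw [union_comm, union_compl], ?_, hB, hcon⟩
  rw [card_compl, hB, Fintype.card_fin]
  have hp : (1:ℝ) ≤ ((k - ℓ : ℕ) : ℝ) := by exact_mod_cast (by omega : 1 ≤ k - ℓ)
  have hn' : (0:ℝ) < n := by exact_mod_cast hn
  set p : ℝ := ((k - ℓ : ℕ) : ℝ)
  have hx : 0 < (n:ℝ) / (2 * p) := by positivity
  have hxn : (n:ℝ) / (2 * p) ≤ n := by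
    rw [div_le_iff₀ (by positivity)]; nlinarith
  have h1 : (2 * p - 1) * (n : ℝ) / (2 * p) + 1 = n + 1 - n / (2 * p) := by
    field_simp; ring
  have h2 : 0 < ⌈(n:ℝ) / (2 * p)⌉₊ := Nat.ceil_pos.2 hx
  have h3 : ⌈(n:ℝ) / (2 * p)⌉₊ ≤ n := Nat.ceil_le.2 hxn
  have h4 : ⌊(n:ℝ) + 1 - n / (2 * p)⌋₊ = n + 1 - ⌈(n:ℝ) / (2 * p)⌉₊ := by
    rw [Nat.floor_eq_iff (by linarith), Nat.cast_sub (by omega)]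
    have := Nat.le_ceil ((n:ℝ) / (2 * p))
    have := Nat.ceil_lt_add_one hx.le
    push_cast
    constructor <;> linarith
  rw [h1, h4]
  omega

theorem robust_of_not_isExtremal {n k ℓ : ℕ} {E : Finset (Finset (Fin n))} {ξ δ : ℝ}
    {ι : Type*} [Fintype ι] [DecidableEq ι] (hι : Fintype.card ι = k) (hlk : ℓ < k)
    (hE : Uniform n k E) (h : ¬ IsExtremal n k ℓ E ξ) (hξ : 0 < ξ)
    (hδ : δ = ξ / (2 ^ k * k.factorial)) (hn : 2 * k ≤ n) (hn2 : 4 * k ≤ δ * n)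
    (B : Finset (Fin n))
    (hB : (1 - 1 / (2 * ((k - ℓ : ℕ) : ℝ)) - δ / (4 * k)) * n ≤ B.card) :
    δ / 2 ≤ pr (fun x : ι → Fin n => toF x ∈ E ∧ ∀ i, x i ∈ B) := by
  have hn0 : 0 < n := by omega
  have hn' : (0:ℝ) < n := by exact_mod_cast hn0
  have hk0 : (0:ℝ) < k := by exact_mod_cast (by omega : 0 < k)
  have hp : (1:ℝ) ≤ ((k - ℓ : ℕ) : ℝ) := by exact_mod_cast (by omega : 1 ≤ k - ℓ)
  have hδ0 : 0 < δ := by rw [hδ]; positivity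
  have : Nonempty (Fin n) := ⟨⟨0, hn0⟩⟩
  set b := ⌊(2 * ((k - ℓ : ℕ) : ℝ) - 1) * (n : ℝ) / (2 * ((k - ℓ : ℕ) : ℝ)) + 1⌋₊ with hb
  have key : ∀ B' : Finset (Fin n), B'.card = b →
      δ ≤ pr (fun x : ι → Fin n => toF x ∈ E ∧ ∀ i, x i ∈ B') := by
    intro B' hB'
    have h1 := lt_edgesIn_of_not_isExtremal hlk hn0 h hB'
    have h2 := card_edges_le_pr (ι := ι) (E := E) (fun e he => by rw [hι]; exact hE e he) B'
    have h3 := le_choose_of_two_mul_le hn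
    rw [hι, Fintype.card_fin] at h2
    have h4 : δ * n ^ k ≤ ξ * n.choose k := by
      refine le_trans (le_of_eq ?_) (mul_le_mul_of_nonneg_left h3 hξ.le)
      rw [hδ]; ring
    have h5 : δ * (n:ℝ) ^ k ≤ pr (fun x : ι → Fin n => toF x ∈ E ∧ ∀ i, x i ∈ B') * n ^ k :=
      h4.trans (h1.le.trans h2)
    exact le_of_mul_le_mul_right h5 (by positivity)
  have hbn : b ≤ n := by
    rw [hb, ← Nat.lt_succ_iff, Nat.floor_lt' (by omega)]
    have h1 : (2 * ((k - ℓ : ℕ) : ℝ) - 1) * (n : ℝ) / (2 * ((k - ℓ : ℕ) : ℝ)) + 1 =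
        n + 1 - n / (2 * ((k - ℓ : ℕ) : ℝ)) := by
      field_simp
      ring
    have h2 : 0 < (n:ℝ) / (2 * ((k - ℓ : ℕ) : ℝ)) := by positivity
    rw [h1]
    push_cast
    linarith
  rcases le_total b B.card with hbB | hbB
  · obtain ⟨B', hB', hB''⟩ := exists_subset_card_eq hbB
    exact le_trans (by linarith) ((key B' hB'').trans
      (pr_mono fun x hx => ⟨hx.1, fun i => hB' (hx.2 i)⟩))
  · obtain ⟨B', hB', -, hB''⟩ := exists_subsuperset_card_eq (subset_univ B) hbB (by simpa using hbn)
    have h1 := pr_and_not_ge (fun x : ι → Fin n => toF x ∈ E ∧ ∀ i, x i ∈ B')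
      (fun x => ¬ Disjoint (toF x) (B' \ B))
    have h2 := pr_toF_hit_le (ι := ι) (B' \ B)
    have h3 := key B' hB''
    have h4 : (((B' \ B).card : ℕ) : ℝ) = b - B.card := by
      rw [card_sdiff_of_subset hB', hB'', Nat.cast_sub hbB]
    have h5 : (b:ℝ) ≤ (1 - 1 / (2 * ((k - ℓ : ℕ) : ℝ))) * n + 1 := by
      refine (Nat.floor_le (by apply add_nonneg <;> [apply div_nonneg <;> [apply mul_nonneg; skip]; skip] <;> linarith)).trans (le_of_eq ?_)
      field_simp
    rw [h4, hι, Fintype.card_fin] at h2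
    have h6 : ((b:ℝ) - B.card) * (k / n) ≤ δ / 2 := by
      rw [← mul_div_assoc, div_le_iff₀ hn']
      have h7 : (b:ℝ) - B.card ≤ δ / (4 * k) * n + 1 := by linarith
      calc ((b:ℝ) - B.card) * k ≤ (δ / (4 * k) * n + 1) * k := by gcongr
        _ = δ / 4 * n + k := by field_simp
        _ ≤ _ := by linarith
    refine le_trans (by linarith) (h1.trans (pr_mono ?_))
    rintro x ⟨⟨h7, h8⟩, h9⟩
    refine ⟨h7, fun i => ?_⟩
    push Not at h9
    by_contra hi
    exact disjoint_left.1 h9 (mem_toF.2 ⟨i, rfl⟩) (mem_sdiff.2 ⟨h8 i, hi⟩)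

end FromDegrees

section Avoiding

theorem exists_tiling_avoiding {k ℓ q : ℕ} (hl : 1 ≤ ℓ) (hk : k = ℓ + q + ℓ) (hp : 3 ≤ ℓ + q)
    {c ξ ξ' : ℝ} (hc : c = 1 / (2 * (ℓ + q : ℕ))) (hξ : 0 < ξ) (hξ1 : ξ ≤ 3 / 20) (hξ' : 0 < ξ') :
    ∃ η : ℝ, 0 < η ∧ η ≤ 1 / 100 ∧ ∀ (t : ℕ) (ε : ℝ), 0 < ε → ε ≤ 1 → 8 ≤ ε * t →
      ∃ N : ℕ, ∀ (V : Type) [Fintype V] [DecidableEq V] (E : Finset (Finset V)),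
        (∀ e ∈ E, e.card = k) → N ≤ Fintype.card V → DegCond (2 * c - c ^ 2 - η) k E →
        (∀ B : Finset V, (1 - c - ξ) * Fintype.card V ≤ B.card →
          ξ' ≤ pr (fun x : Role ℓ q → V => toF x ∈ E ∧ ∀ i, x i ∈ B)) →
        ∀ W : Finset V, (W.card : ℝ) ≤ η * Fintype.card V →
        ∀ s : ℕ, (s : ℝ) * (t * (ℓ + q) + ℓ : ℕ) ≤ (1 - ε) * (Fintype.card V - W.card) →
        ∃ es U, es.length = s ∧ Forest ℓ E es U ∧ U.card = s * (t * (ℓ + q) + ℓ) ∧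
          Disjoint U W := by
  have hp' : (3:ℝ) ≤ (ℓ + q : ℕ) := by exact_mod_cast hp
  have hc0 : 0 < c := by rw [hc]; positivity
  have hc1 : c ≤ 1 / 6 := by
    rw [hc]
    apply one_div_le_one_div_of_le <;> linarith
  set κ : ℝ := ξ / 2 / (48 * (ℓ + q : ℕ)) with hκ
  have hκ0 : 0 < κ := by positivity
  have hκ1 : 48 * (ℓ + q : ℕ) * κ = ξ / 2 := by rw [hκ]; field_simp
  have hκ2 : κ ≤ ξ / 288 := by nlinarith
  refine ⟨κ / 3, by positivity, by linarith, fun t ε hε0 hε1 ht => ?_⟩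
  obtain ⟨N, hN⟩ := exists_tiling hl hk hp (t := t) hc (ξ := ξ / 2) (by positivity) (by linarith)
    hξ' hκ0 hκ1.le hε0 hε1 ht
  refine ⟨2 * N, fun V _ _ E hE hV hdeg hrob W hW s hs => ?_⟩
  have hn0 : (0:ℝ) ≤ Fintype.card V := by positivity
  have hcard := card_compl_verts W
  obtain ⟨es, U, h1, h2, h3⟩ := hN {v // v ∉ W} (deleteVerts W E) (card_eq_of_mem_deleteVerts hE)
    (by
      have h4 : (2:ℝ) * N ≤ Fintype.card V := by exact_mod_cast hV
      have : (N:ℝ) ≤ Fintype.card {v // v ∉ W} := by rw [hcard]; nlinarith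
      exact_mod_cast this)
    (by
      have := hdeg.deleteVerts (by positivity) hW
      convert this using 1
      ring)
    (robust_deleteVerts (b := 1 - c - ξ) hrob (by rw [hcard]; nlinarith)) s (by rw [hcard]; exact hs)
  refine ⟨_, _, ?_, h2.of_deleteVerts, ?_, ?_⟩
  · rw [List.length_map, h1]
  · rw [card_map, h3]
  · rw [disjoint_left]
    intro v hv
    obtain ⟨x, -, rfl⟩ := mem_map.1 hv
    exact x.2

end Avoiding

section Assembly

variable {V : Type} [DecidableEq V] {ℓ k : ℕ} {E : Finset (Finset V)}

theorem Joins.append {es es' : List (Finset V × Finset V)} {Y Z Z' : Finset V}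
    (h : Joins ℓ E Y es Z) (h' : Joins ℓ E (lastEnd Y es) es' Z') (hd : Disjoint Z Z') :
    Joins ℓ E Y (es ++ es') (Z ∪ Z') := by
  induction es generalizing Y Z with
  | nil =>
    obtain rfl : Z = ∅ := h
    simpa [lastEnd] using h'
  | cons p es ih =>
    obtain ⟨I, Z1, h1, h2, h3, rfl⟩ := h
    rw [disjoint_union_left] at hd
    exact ⟨I, Z1 ∪ Z', h1, disjoint_union_right.2 ⟨h2, hd.1⟩, ih h3 h' hd.2, union_assoc _ _ _⟩

omit [DecidableEq V] in
theorem lastEnd_append (es es' : List (Finset V × Finset V)) (Y : Finset V) :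
    lastEnd Y (es ++ es') = lastEnd (lastEnd Y es) es' := by
  induction es generalizing Y with
  | nil => rfl
  | cons p es ih => exact ih p.2

theorem lastEnd_subset {es : List (Finset V × Finset V)} {Y U F : Finset V}
    (h : Forest ℓ E es U) (hY : Y ⊆ F) (hYc : Y.card = ℓ) (hU : U ⊆ F) :
    lastEnd Y es ⊆ F ∧ (lastEnd Y es).card = ℓ := by
  induction es generalizing Y U with
  | nil => exact ⟨hY, hYc⟩
  | cons p es ih =>
    obtain ⟨h1, h2, h3, h4⟩ := h.ends_subset p (by simp)
    obtain ⟨I, Z, -, -, h5, rfl⟩ := h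
    exact ih h5 (h2.trans hU) h4 (subset_union_right.trans hU)

/-- Lists of pairs of ends can be joined successively by disjoint connecting paths, if connecting
paths from a given supply can be chosen disjoint from fewer than `m` given ones. -/
theorem exists_joins {Q : Finset V → Prop} {m : ℝ}
    (hQ : ∀ X Y : Finset V, X.card = ℓ → Y.card = ℓ → Disjoint X Y → ∀ L : List (Finset V),
      (L.length : ℝ) < m → (∀ I ∈ L, Q I) → ∃ I, Q I ∧ Lk ℓ E X Y I ∧ ∀ J ∈ L, Disjoint I J)
    {es : List (Finset V × Finset V)} {U Y : Finset V} (hY : Y.card = ℓ) (hF : Forest ℓ E es U)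
    (hd : Disjoint Y U) (L : List (Finset V)) (hL : ∀ I ∈ L, Q I)
    (hlen : (L.length : ℝ) + es.length ≤ m) :
    ∃ (L' : List (Finset V)) (Z : Finset V), L'.length = es.length ∧ (∀ I ∈ L', Q I) ∧
      Joins ℓ E Y es Z ∧ (∀ I ∈ L, Disjoint Z I) ∧ Z.card = (L'.map card).sum ∧
      (∀ v, v ∈ Z ↔ ∃ I ∈ L', v ∈ I) := by
  induction es generalizing U Y L with
  | nil => exact ⟨[], ∅, rfl, by simp, rfl, by simp, by simp, by simp⟩
  | cons p es ih =>
    obtain ⟨W, Z, h1, h2, h3, rfl⟩ := hF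
    simp only [disjoint_union_left, disjoint_union_right] at hd h2
    obtain ⟨I, hI, hI', hIL⟩ := hQ Y p.1 hY h1.card_left hd.1.1.1 L
      (by rw [List.length_cons] at hlen; push_cast at hlen; linarith) hL
    obtain ⟨L', Z', h4, h5, h6, h7, h8, h9⟩ := ih h1.card_right h3 h2.2 (I :: L)
      (by simpa using ⟨hI, hL⟩) (by
        rw [List.length_cons] at hlen ⊢; push_cast at hlen ⊢; linarith)
    refine ⟨I :: L', I ∪ Z', by simp [h4], by simpa using ⟨hI, h5⟩,
      ⟨I, Z', hI', (h7 I (by simp)).symm, h6, rfl⟩, ?_, ?_, ?_⟩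
    · intro J hJ
      rw [disjoint_union_left]
      exact ⟨hIL J hJ, h7 J (by simp [hJ])⟩
    · rw [card_union_of_disjoint (h7 I (by simp)).symm, h8]; simp
    · intro v; simp [h9]

theorem Forest.length_le {es : List (Finset V × Finset V)} {U : Finset V} (hl : 1 ≤ ℓ)
    (h : Forest ℓ E es U) : es.length ≤ U.card := by
  induction es generalizing U with
  | nil => simp
  | cons p es ih =>
    obtain ⟨W, Z, h1, h2, h3, rfl⟩ := h
    rw [card_union_of_disjoint h2, Lk.card_verts h1, List.length_cons]
    have := ih h3
    omega

theorem Forest.card_eq {es : List (Finset V × Finset V)} {U : Finset V}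
    (hE : ∀ e ∈ E, e.card = k) (hlk : 2 * ℓ < k) (h : Forest ℓ E es U) :
    ∃ m, U.card = m * (k - ℓ) + es.length * ℓ := by
  induction es generalizing U with
  | nil =>
    obtain rfl : U = ∅ := h
    exact ⟨0, by simp⟩
  | cons p es ih =>
    obtain ⟨W, Z, h1, h2, h3, rfl⟩ := h
    obtain ⟨m, hm⟩ := ih h3
    obtain ⟨t, -, ht⟩ := h1.interior_card hE hlk
    refine ⟨t + m, ?_⟩
    rw [card_union_of_disjoint h2, Lk.card_verts h1, hm, List.length_cons, ht]
    ring

open scoped Classical in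
/-- Disjoint gadgets, sufficiently many of which absorb any given small set, absorb larger sets
together. -/
theorem Forest.absorb {T : Type} {vs : T → Finset V} {ends : T → List (Finset V × Finset V)} {N' : ℕ}
    (r : ℕ) (gs : List T) (hdis : gs.Pairwise fun g g' => Disjoint (vs g) (vs g'))
    (hfor : ∀ g ∈ gs, Forest ℓ E (ends g) (vs g)) {U : Finset V} (hUc : U.card = r * N')
    (hU : ∀ g ∈ gs, Disjoint (vs g) U)
    (h : ∀ S : Finset V, S.card = N' → S ⊆ U →
      r ≤ gs.countP fun g => Forest ℓ E (ends g) (vs g ∪ S)) :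
    Forest ℓ E (gs.flatMap ends) ((gs.toFinset.biUnion vs) ∪ U) := by
  induction r generalizing gs U with
  | zero =>
    obtain rfl : U = ∅ := by simpa using hUc
    rw [union_empty]
    clear h hU hUc
    induction gs with
    | nil => rfl
    | cons g gs ih =>
      rw [List.pairwise_cons] at hdis
      rw [List.flatMap_cons, List.toFinset_cons, biUnion_insert]
      refine (hfor g (by simp)).append (ih hdis.2 fun g' hg' => hfor g' (by simp [hg'])) ?_
      rw [disjoint_biUnion_right]
      exact fun g' hg' => hdis.1 g' (by simpa using hg')
  | succ r ih =>
    obtain ⟨S, hSU, hS⟩ := exists_subset_card_eq (s := U) (n := N') (by rw [hUc, add_mul]; omega)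
    have h1 := h S hS hSU
    obtain ⟨g, hg, hgS⟩ := List.countP_pos_iff.1 (lt_of_lt_of_le r.succ_pos h1)
    have hgS : Forest ℓ E (ends g) (vs g ∪ S) := by simpa using hgS
    have hperm := List.perm_cons_erase hg
    have hdis' := (hperm.pairwise_iff (fun {a b} (h : Disjoint (vs a) (vs b)) => h.symm)).1 hdis
    rw [List.pairwise_cons] at hdis'
    have hmem : ∀ g' ∈ gs.erase g, g' ∈ gs := fun g' hg' => List.mem_of_mem_erase hg'
    have h2 := ih (gs.erase g) hdis'.2 (fun g' hg' => hfor g' (hmem g' hg')) (U := U \ S)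
      (by rw [card_sdiff_of_subset hSU, hUc, hS, add_mul]; omega)
      (fun g' hg' => (hU g' (hmem g' hg')).mono_right sdiff_subset) (by
        intro S' hS' hS'U
        have h3 := h S' hS' (hS'U.trans sdiff_subset)
        rw [hperm.countP_eq, List.countP_cons] at h3
        split_ifs at h3 <;> omega)
    have h3 := hgS.append h2 (by
      rw [disjoint_union_left, disjoint_union_right, disjoint_union_right, disjoint_biUnion_right,
        disjoint_biUnion_right]
      refine ⟨⟨fun g' hg' => hdis'.1 g' (by simpa using hg'),
        (hU g hg).mono_right sdiff_subset⟩,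
        fun g' hg' => ((hU g' (hmem g' (by simpa using hg'))).mono_right hSU).symm,
        disjoint_sdiff⟩)
    have h4 := Forest.perm (hperm.flatMap_right ends).symm h3
    convert h4 using 1
    rw [List.toFinset_eq_of_perm _ _ hperm, List.toFinset_cons, biUnion_insert]
    nth_rewrite 1 [← union_sdiff_of_subset hSU]
    ext x
    simp only [mem_union]
    clear * -
    tauto

end Assembly

section Structures

theorem card_biUnion_toFinset_le {V T : Type} [DecidableEq V] [DecidableEq T] (vs : T → Finset V)
    {q : ℕ} (hq : ∀ g, (vs g).card ≤ q) (gs : List T) :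
    (gs.toFinset.biUnion vs).card ≤ gs.length * q :=
  card_biUnion_le.trans ((sum_le_card_nsmul _ _ q fun g _ => hq g).trans
    (Nat.mul_le_mul_right q gs.toFinset_card_le))

theorem exists_absorber (k ℓ : ℕ) (hk : 4 ≤ k) (hl : 1 ≤ ℓ) (hlk : 2 * ℓ < k) (d : ℝ)
    (hd0 : 0 < d) (hd1 : d ≤ 1) {qc : ℕ} {αc η : ℝ} (hαc : 0 < αc) (hη : 0 < η) :
    ∃ h : ℝ, 0 < h ∧ ∃ N : ℕ, ∀ (V : Type) [Fintype V] [DecidableEq V] (E : Finset (Finset V)),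
      Good k d N E → Connecting ℓ qc αc E →
      ∃ es U, Forest ℓ E es U ∧ (U.card : ℝ) ≤ η * Fintype.card V ∧ es ≠ [] ∧
        ∀ (S : Finset V) (r : ℕ), Disjoint U S → S.card = r * (qc + ℓ) →
          (r : ℝ) ≤ h * Fintype.card V → Forest ℓ E es (U ∪ S) := by
  classical
  obtain ⟨q, α, hα, N, hN⟩ := exists_absorbing k ℓ hk hl hlk d hd0 hd1 (qc := qc) hαc
  obtain ⟨β, hβ0, hβ1, hβ2⟩ : ∃ β : ℝ, 0 < β ∧ β * q ^ 2 ≤ α / 2 ∧ β * q ≤ η := by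
    refine ⟨min (α / 2 / (q ^ 2 + 1)) (η / (q + 1)), by positivity, ?_, ?_⟩
    · calc _ ≤ α / 2 / (q ^ 2 + 1) * q ^ 2 := by gcongr; exact min_le_left _ _
        _ ≤ α / 2 / (q ^ 2 + 1) * (q ^ 2 + 1) := by gcongr; linarith
        _ = _ := by field_simp
    · calc _ ≤ η / (q + 1) * q := by gcongr; exact min_le_right _ _
        _ ≤ η / (q + 1) * (q + 1) := by gcongr; linarith
        _ = _ := by field_simp
  obtain ⟨N₁, hN₁⟩ := exists_selection_linear q (qc + ℓ) (η := 0) hα hβ0 (by simpa using hβ1)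
  refine ⟨α * β / 16, by positivity, N + N₁ + qc + ℓ + 1, fun V _ _ E hG hC => ?_⟩
  have hV := hG.large
  obtain ⟨T, _, G, hT⟩ := hN V E (hG.mono (by omega)) hC
  have hJ : (powersetCard (qc + ℓ) (univ : Finset V)).Nonempty := by
    rw [powersetCard_nonempty, card_univ]; omega
  obtain ⟨gs, h1, h2, h3, h4⟩ := hN₁ G.vs (by omega) G.card_le G.hit
    (powersetCard (qc + ℓ) (univ : Finset V)) hJ (by
      rw [card_powersetCard, card_univ]; exact Nat.choose_le_pow _ _)
    (fun S g => G.wf g ∧ Tr ℓ E (G.vs g) (G.ends g) S ∅)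
    (W := fun g => Forest ℓ E (G.ends g) (G.vs g))
    (fun S _ g hg => by simpa using hg.2.2.2)
    (fun S hS => hT S (mem_powersetCard.1 hS).2) ∅ (by simp)
  have h5 : ∀ S : Finset V, S.card = qc + ℓ → α * β / 16 * Fintype.card V ≤
      gs.countP (fun g => Forest ℓ E (G.ends g) (G.vs g ∪ S)) := by
    intro S hS
    refine (h4 S (mem_powersetCard.2 ⟨subset_univ _, hS⟩)).trans ?_
    norm_cast
    refine List.countP_mono_left fun g _ hg => ?_
    exact decide_eq_true (@of_decide_eq_true _ (Classical.propDecidable _) hg).2.2.1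
  have hn : (0:ℝ) < Fintype.card V := by exact_mod_cast (by omega : 0 < Fintype.card V)
  have hne : gs.flatMap G.ends ≠ [] := by
    obtain ⟨S, hS⟩ := hJ
    have hSc := (mem_powersetCard.1 hS).2
    have h6 : 0 < gs.countP (fun g => Forest ℓ E (G.ends g) (G.vs g ∪ S)) := by
      have : (0:ℝ) < α * β / 16 * Fintype.card V := by positivity
      exact_mod_cast this.trans_le (h5 S hSc)
    obtain ⟨g, hg, hgS⟩ := List.countP_pos_iff.1 h6
    have hgS := of_decide_eq_true hgS
    intro hcon
    rw [List.flatMap_eq_nil_iff.1 hcon g hg] at hgS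
    have h7 : G.vs g ∪ S = ∅ := hgS
    rw [union_eq_empty] at h7
    rw [h7.2, card_empty] at hSc
    omega
  have habs : ∀ (S : Finset V) (r : ℕ), Disjoint (gs.toFinset.biUnion G.vs) S →
      S.card = r * (qc + ℓ) → (r : ℝ) ≤ α * β / 16 * Fintype.card V →
      Forest ℓ E (gs.flatMap G.ends) (gs.toFinset.biUnion G.vs ∪ S) := by
    intro S r hd hS hr
    rw [disjoint_biUnion_left] at hd
    convert Forest.absorb r gs h2 (fun g hg => (h3 g hg).1) hS (fun g hg => hd g (by simpa using hg))
      (fun S' hS' _ => by exact_mod_cast hr.trans (h5 S' hS'))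
  refine ⟨gs.flatMap G.ends, gs.toFinset.biUnion G.vs, ?_, ?_, hne, habs⟩
  · simpa using habs ∅ 0 (disjoint_empty_right _) (by simp) (by rw [Nat.cast_zero]; positivity)
  · calc ((gs.toFinset.biUnion G.vs).card : ℝ) ≤ (gs.length * q : ℕ) := by
          exact_mod_cast card_biUnion_toFinset_le G.vs G.card_le gs
      _ = gs.length * q := by push_cast; ring
      _ ≤ β * Fintype.card V * q := by gcongr
      _ = β * q * Fintype.card V := by ring
      _ ≤ _ := by gcongr

theorem exists_reservoir (ℓ qc : ℕ) {αc η β : ℝ} (hαc : 0 < αc) (hqc : 1 ≤ qc)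
    (hη : η * qc ≤ αc / 4) (hβ : 0 < β) : ∃ h : ℝ, 0 < h ∧ ∃ N : ℕ,
      ∀ (V : Type) [Fintype V] [DecidableEq V] (E : Finset (Finset V)), N ≤ Fintype.card V →
      Connecting ℓ qc αc E → ∀ F : Finset V, (F.card : ℝ) ≤ η * Fintype.card V →
      ∃ (R : Finset V) (Q : Finset V → Prop), (R.card : ℝ) ≤ β * Fintype.card V ∧ Disjoint R F ∧
        (∀ I, Q I → I ⊆ R ∧ I.card = qc) ∧
        ∀ X Y : Finset V, X.card = ℓ → Y.card = ℓ → Disjoint X Y → ∀ L : List (Finset V),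
          (L.length : ℝ) < h * Fintype.card V → (∀ I ∈ L, Q I) →
          ∃ I, Q I ∧ Lk ℓ E X Y I ∧ ∀ J ∈ L, Disjoint I J := by
  classical
  have hqc' : (1:ℝ) ≤ qc := by exact_mod_cast hqc
  obtain ⟨b, hb0, hb1, hb2⟩ : ∃ b : ℝ, 0 < b ∧ b * qc ^ 2 ≤ αc / 4 ∧ b * qc ≤ β := by
    refine ⟨min (αc / 4 / qc ^ 2) (β / qc), by positivity, ?_, ?_⟩
    · calc _ ≤ αc / 4 / qc ^ 2 * qc ^ 2 := by gcongr; exact min_le_left _ _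
        _ = _ := by field_simp
    · calc _ ≤ β / qc * qc := by gcongr; exact min_le_right _ _
        _ = _ := by field_simp
  obtain ⟨N, hN⟩ := exists_selection_linear qc (ℓ + ℓ) (η := η) hαc hb0 (by linarith)
  refine ⟨αc * b / 16, by positivity, N + ℓ + ℓ + 1, fun V _ _ E hV hC F hF => ?_⟩
  set J : Finset (Finset V × Finset V) :=
    (powersetCard ℓ univ ×ˢ powersetCard ℓ univ).filter fun p => Disjoint p.1 p.2 with hJ
  have hJm : ∀ p, p ∈ J ↔ (p.1.card = ℓ ∧ p.2.card = ℓ) ∧ Disjoint p.1 p.2 := by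
    intro p; simp [hJ, mem_powersetCard]
  obtain ⟨gs, h1, h2, h3, h4⟩ := hN (V := V) (T := Fin qc → V) toF (by omega)
    (fun z => by simpa using card_toF_le z) (fun v => by simpa using pr_mem_toF_le (ι := Fin qc) v)
    J (by
      obtain ⟨S, -, hS⟩ := exists_subset_card_eq (s := (univ : Finset V)) (n := ℓ + ℓ)
        (by rw [card_univ]; omega)
      obtain ⟨X, hX, hXc⟩ := exists_subset_card_eq (s := S) (n := ℓ) (by omega)
      exact ⟨(X, S \ X), (hJm _).2 ⟨⟨hXc, by rw [card_sdiff_of_subset hX]; omega⟩,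
        disjoint_sdiff⟩⟩)
    (by
      refine (card_filter_le _ _).trans ?_
      rw [card_product, card_powersetCard, card_univ, pow_add]
      exact Nat.mul_le_mul (Nat.choose_le_pow _ _) (Nat.choose_le_pow _ _))
    (fun p z => Function.Injective z ∧ Lk ℓ E p.1 p.2 (toF z)) (W := Function.Injective)
    (fun p _ z hz => hz.1) (fun p hp => by
      obtain ⟨⟨h5, h6⟩, h7⟩ := (hJm p).1 hp
      exact hC p.1 p.2 h5 h6 h7) F hF
  refine ⟨gs.toFinset.biUnion toF, fun I => ∃ z ∈ gs, toF z = I, ?_, ?_, ?_, ?_⟩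
  · calc ((gs.toFinset.biUnion toF).card : ℝ) ≤ (gs.length * qc : ℕ) := by
          exact_mod_cast card_biUnion_toFinset_le toF (fun z => by simpa using card_toF_le z) gs
      _ = gs.length * qc := by push_cast; ring
      _ ≤ b * Fintype.card V * qc := by gcongr
      _ = b * qc * Fintype.card V := by ring
      _ ≤ _ := by gcongr
  · rw [disjoint_biUnion_left]
    exact fun z hz => (h3 z (by simpa using hz)).2
  · rintro _ ⟨z, hz, rfl⟩
    exact ⟨subset_biUnion_of_mem toF (by simpa using hz), by
      simpa using card_toF (h3 z hz).1⟩
  · intro X Y hX hY hXY L hLl hL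
    have h5 := h4 (X, Y) ((hJm _).2 ⟨⟨hX, hY⟩, hXY⟩)
    obtain ⟨z, hz, hzX, hzL⟩ : ∃ z ∈ gs, Lk ℓ E X Y (toF z) ∧ toF z ∉ L := by
      by_contra! hcon
      have hnd : (gs.map toF).Nodup := by
        rw [List.Nodup, List.pairwise_map]
        refine h2.imp_of_mem fun {a b} _ hb hab heq => ?_
        have h6 := card_toF (h3 b hb).1
        rw [heq, disjoint_self] at hab
        rw [hab] at h6
        simp at h6
        omega
      refine absurd (h5.trans (Nat.cast_le.2 (?_ : _ ≤ L.length))) (not_le.2 hLl)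
      rw [List.countP_eq_length_filter, ← List.length_map (f := toF)]
      refine List.Subperm.length_le (List.subperm_of_subset
        (hnd.sublist (List.filter_sublist.map toF)) fun I hI => ?_)
      obtain ⟨z, hz, rfl⟩ := List.mem_map.1 hI
      have hz := List.mem_filter.1 hz
      exact hcon z hz.1 (@of_decide_eq_true _ (Classical.propDecidable _) hz.2).2
    refine ⟨toF z, ⟨z, hz, rfl⟩, hzX, fun I hI => ?_⟩
    obtain ⟨z', hz', rfl⟩ := hL I hI
    have hne : z ≠ z' := by rintro rfl; exact hzL hI
    have : Std.Symm fun a b : Fin qc → V => Disjoint (toF a) (toF b) := ⟨fun _ _ h => h.symm⟩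
    exact h2.forall hz hz' hne

end Structures

section Final

theorem sum_map_card_eq {V : Type} {qc : ℕ} {L : List (Finset V)}
    (h : ∀ I ∈ L, I.card = qc) : (L.map card).sum = L.length * qc := by
  rw [List.map_congr_left (g := fun _ => qc) h]
  simp

theorem Connecting.avoiding {V : Type} [Fintype V] [DecidableEq V] {ℓ qc : ℕ} {αc m : ℝ}
    {E : Finset (Finset V)} (hC : Connecting ℓ qc αc E) (F : Finset V)
    (hm : (F.card + m * qc) * qc < αc * Fintype.card V) (X Y : Finset V) (hX : X.card = ℓ)
    (hY : Y.card = ℓ) (hXY : Disjoint X Y) (L : List (Finset V)) (hL : (L.length : ℝ) < m)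
    (hLQ : ∀ I ∈ L, I.card = qc ∧ Disjoint I F) :
    ∃ I : Finset V, (I.card = qc ∧ Disjoint I F) ∧ Lk ℓ E X Y I ∧ ∀ J ∈ L, Disjoint I J := by
  have h1 : (F ∪ L.toFinset.biUnion id).card ≤ F.card + L.length * qc := by
    refine (card_union_le _ _).trans (Nat.add_le_add_left (card_biUnion_le.trans
      ((sum_le_card_nsmul _ _ qc fun I hI => ?_).trans
        (Nat.mul_le_mul_right qc L.toFinset_card_le))) _)
    exact (hLQ I (by simpa using hI)).1.le
  have h2 := pr_toF_hit_le (ι := Fin qc) (F ∪ L.toFinset.biUnion id)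
  have h3 := pr_and_not_ge (fun z : Fin qc → V => Function.Injective z ∧ Lk ℓ E X Y (toF z))
    (fun z => ¬ Disjoint (toF z) (F ∪ L.toFinset.biUnion id))
  have h4 := hC X Y hX hY hXY
  have h5 : pr (fun z : Fin qc → V => ¬ Disjoint (toF z) (F ∪ L.toFinset.biUnion id)) < αc := by
    refine h2.trans_lt ?_
    rw [Fintype.card_fin]
    have h6 : ((F ∪ L.toFinset.biUnion id).card : ℝ) ≤ F.card + m * qc := by
      calc _ ≤ ((F.card + L.length * qc : ℕ) : ℝ) := by exact_mod_cast h1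
        _ = F.card + L.length * qc := by push_cast; ring
        _ ≤ _ := by gcongr
    have h7 := (mul_le_mul_of_nonneg_right h6 (Nat.cast_nonneg qc)).trans_lt hm
    rcases (Nat.cast_nonneg (α := ℝ) (Fintype.card V)).eq_or_lt with h0 | h0
    · rw [← h0] at h7
      have : (0:ℝ) ≤ #(F ∪ L.toFinset.biUnion id) * qc := by positivity
      linarith
    · rw [← mul_div_assoc, div_lt_iff₀ h0]
      exact h7
  obtain ⟨z, ⟨h6, h7⟩, h8⟩ := exists_of_pr_pos (lt_of_lt_of_le (by linarith) h3)
  rw [not_not, disjoint_union_right, disjoint_biUnion_right] at h8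
  exact ⟨toF z, ⟨by simpa using card_toF h6, h8.1⟩, h7, fun J hJ => h8.2 J (by simpa using hJ)⟩

theorem exists_joined_absorber (k ℓ : ℕ) (hk : 4 ≤ k) (hl : 1 ≤ ℓ) (hlk : 2 * ℓ < k) (d : ℝ)
    (hd0 : 0 < d) (hd1 : d ≤ 1) {qc : ℕ} {αc η : ℝ} (hαc : 0 < αc) (hη : 0 < η) :
    ∃ h : ℝ, 0 < h ∧ ∃ N : ℕ, ∀ (V : Type) [Fintype V] [DecidableEq V] (E : Finset (Finset V)),
      Good k d N E → Connecting ℓ qc αc E →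
      ∃ X Y es U Z, Forest ℓ E ((X, Y) :: es) U ∧ Joins ℓ E Y es Z ∧ Disjoint U Z ∧
        (U.card + Z.card : ℝ) ≤ η * Fintype.card V ∧ Z.card = es.length * qc ∧
        ∀ (S : Finset V) (r : ℕ), Disjoint U S → S.card = r * (qc + ℓ) →
          (r : ℝ) ≤ h * Fintype.card V → Forest ℓ E ((X, Y) :: es) (U ∪ S) := by
  obtain ⟨η', hη'0, hη'1, hη'2⟩ : ∃ η' : ℝ, 0 < η' ∧ η' * (1 + qc) ≤ η ∧
      η' * (1 + qc) * qc < αc := by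
    refine ⟨min η (αc / (qc + 1)) / (qc + 1), by positivity, ?_, ?_⟩
    · calc _ = min η (αc / (qc + 1)) := by field_simp; ring
        _ ≤ _ := min_le_left _ _
    · calc _ = min η (αc / (qc + 1)) * qc := by field_simp; ring
        _ ≤ αc / (qc + 1) * qc := by gcongr; exact min_le_right _ _
        _ < αc / (qc + 1) * (qc + 1) := by gcongr; linarith
        _ = αc := by field_simp
  obtain ⟨h, hh, N, hN⟩ := exists_absorber k ℓ hk hl hlk d hd0 hd1 (qc := qc) hαc hη'0
  refine ⟨h, hh, N + 1, fun V _ _ E hG hC => ?_⟩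
  obtain ⟨es, U, h1, h2, h3, h4⟩ := hN V E (hG.mono (by omega)) hC
  have hn : (0:ℝ) < Fintype.card V := by
    have := hG.large
    exact_mod_cast (by omega : 0 < Fintype.card V)
  have hlen : ((es.length : ℕ) : ℝ) ≤ η' * Fintype.card V :=
    le_trans (by exact_mod_cast h1.length_le hl) h2
  obtain ⟨⟨X, Y⟩, es, rfl⟩ := List.exists_cons_of_ne_nil h3
  obtain ⟨W, Z₀, h5, h6, h7, rfl⟩ := id h1
  have hsub : Y ⊆ X ∪ W ∪ Y ∪ Z₀ := fun v hv => by simp [hv]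
  have hlen' : (es.length : ℝ) ≤ η' * Fintype.card V := by
    refine le_trans ?_ hlen
    simp
  obtain ⟨L, Z, a1, a2, a3, -, a5, a6⟩ := exists_joins (m := η' * Fintype.card V)
    (hC.avoiding (X ∪ W ∪ Y ∪ Z₀) (by
      have : (((X ∪ W ∪ Y ∪ Z₀).card : ℝ) + η' * Fintype.card V * qc) * qc ≤
          (η' * Fintype.card V + η' * Fintype.card V * qc) * qc := by gcongr
      nlinarith)) h5.card_right h7 (h6.mono_left fun v hv => by simp [hv]) [] (by simp)
    (by simpa using hlen')
  rw [sum_map_card_eq (fun I hI => (a2 I hI).1), a1] at a5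
  refine ⟨X, Y, es, _, Z, h1, a3, ?_, ?_, a5, h4⟩
  · rw [disjoint_right]
    intro v hv
    obtain ⟨I, hI, hvI⟩ := (a6 v).1 hv
    exact disjoint_left.1 (a2 I hI).2 hvI
  · rw [a5]
    push_cast
    calc _ ≤ η' * Fintype.card V + η' * Fintype.card V * qc := by
          refine add_le_add h2 ?_
          gcongr
      _ = η' * (1 + qc) * Fintype.card V := by ring
      _ ≤ _ := by gcongr

theorem exists_le_modEq {tc a : ℕ} (h1 : 1 ≤ tc) (h : tc ≤ a) (z : ℤ) :
    ∃ s : ℕ, s ≤ a ∧ a < s + tc ∧ (tc : ℤ) ∣ z - s := by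
  have h2 := Int.emod_nonneg ((a:ℤ) - z) (b := tc) (by omega)
  have h3 := Int.emod_lt_of_pos ((a:ℤ) - z) (b := tc) (by omega)
  have h4 := Int.mul_ediv_add_emod ((a:ℤ) - z) tc
  set r := ((a:ℤ) - z) % tc
  refine ⟨a - r.toNat, by omega, by omega, -(((a:ℤ) - z) / tc), ?_⟩
  rw [Nat.cast_sub (by omega), Int.toNat_of_nonneg h2]
  linarith

theorem DegCond.mono {V : Type*} [Fintype V] [DecidableEq V] {d d' : ℝ} {k : ℕ}
    {E : Finset (Finset V)} (h : DegCond d k E) (hd : d' ≤ d) : DegCond d' k E :=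
  fun S hS => hd.trans (h S hS)

end Final

section Assembly

variable {V : Type} [Fintype V] [DecidableEq V] {ℓ : ℕ} {E : Finset (Finset V)}

omit [Fintype V] in
theorem Forest.concat_join {X Y V₀ U Z Z' : Finset V} {es es' : List (Finset V × Finset V)}
    (h : Forest ℓ E ((X, Y) :: es) V₀) (hJ : Joins ℓ E Y es Z) (h' : Forest ℓ E es' U)
    (hJ' : Joins ℓ E (lastEnd Y es) es' Z') (d1 : Disjoint V₀ U) (d2 : Disjoint V₀ Z)
    (d3 : Disjoint V₀ Z') (d4 : Disjoint U Z) (d5 : Disjoint U Z') (d6 : Disjoint Z Z') :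
    ∃ W, Lk ℓ E X (lastEnd (lastEnd Y es) es') W ∧
      X ∪ W ∪ lastEnd (lastEnd Y es) es' = V₀ ∪ U ∪ Z ∪ Z' := by
  obtain ⟨W, Z₀, h1, h2, h3, rfl⟩ := h
  have d7 : Disjoint Z₀ U ∧ Disjoint (X ∪ W ∪ Y) (Z₀ ∪ U) ∧ Disjoint (X ∪ W ∪ Y) (Z ∪ Z') ∧
      Disjoint (Z₀ ∪ U) (Z ∪ Z') := by
    clear * - d1 d2 d3 d4 d5 d6 h2
    simp only [disjoint_union_left, disjoint_union_right] at *
    simp only [disjoint_comm] at *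
    tauto
  rw [← lastEnd_append]
  obtain ⟨W', h4, h5⟩ := Joins.concat h1 (h3.append h' d7.1) (hJ.append hJ' d6) d7.2.1 d7.2.2.1
    d7.2.2.2
  refine ⟨W', h4, h5.trans ?_⟩
  ext
  simp only [mem_union]
  clear * -
  tauto

theorem exists_closed_chain_of_absorber {p tc qc t M s m n' : ℕ} {a b : ℝ}
    (hℓ : 1 ≤ ℓ) (hqc : qc + ℓ = tc * p) (ht : t = tc * M + 1)
    {X Y U Z : Finset V} {es : List (Finset V × Finset V)}
    (f1 : Forest ℓ E ((X, Y) :: es) U) (f2 : Joins ℓ E Y es Z) (f3 : Disjoint U Z)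
    (hU : U.card = m * p + (es.length + 1) * ℓ) (hZ : Z.card = es.length * qc)
    (f6 : ∀ (S : Finset V) (r : ℕ), Disjoint U S → S.card = r * (qc + ℓ) → (r : ℝ) ≤ b →
      Forest ℓ E ((X, Y) :: es) (U ∪ S))
    {R : Finset V} {Q : Finset V → Prop} (r2 : Disjoint R (U ∪ Z))
    (r3 : ∀ I, Q I → I ⊆ R ∧ I.card = qc)
    (r4 : ∀ X Y : Finset V, X.card = ℓ → Y.card = ℓ → Disjoint X Y → ∀ L : List (Finset V),
      (L.length : ℝ) < a → (∀ I ∈ L, Q I) → ∃ I, Q I ∧ Lk ℓ E X Y I ∧ ∀ J ∈ L, Disjoint I J)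
    {U' : Finset V} {es' : List (Finset V × Finset V)} (t1 : es'.length = s)
    (t2 : Forest ℓ E es' U') (t3 : U'.card = s * (t * p + ℓ)) (t4 : Disjoint U' (U ∪ Z ∪ R))
    (hs : (s : ℝ) < a) (hn : Fintype.card V = p * n')
    (hdvd : (tc : ℤ) ∣ (n' : ℤ) - (m + (es.length + 1) * tc) - s)
    (hb : (Fintype.card V : ℝ) ≤ U.card + Z.card + s * (t * p + ℓ : ℕ) + b) :
    ∃ X Y W W' : Finset V, Lk ℓ E X Y W ∧ Lk ℓ E Y X W' ∧ Disjoint (X ∪ W ∪ Y) W' ∧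
      X ∪ W ∪ Y ∪ W' = univ := by
  obtain ⟨hXU, hYU, hXc, hYc⟩ := f1.ends_subset (X, Y) (by simp)
  simp only at hXU hYU hXc hYc
  have hY' : lastEnd Y es ⊆ U ∧ (lastEnd Y es).card = ℓ := by
    obtain ⟨W, Z₀, -, -, h3, rfl⟩ := id f1
    exact lastEnd_subset h3 hYU hYc subset_union_right
  have hUU' : Disjoint U U' := t4.symm.mono_left fun v hv => by simp [hv]
  obtain ⟨L, Z', l1, l2, l3, -, l5, l6⟩ := exists_joins (m := a) r4 hY'.2 t2
    (hUU'.mono_left hY'.1) [] (by simp) (by simpa [t1] using hs.le)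
  have hZ'R : Z' ⊆ R := fun v hv => by
    obtain ⟨I, hI, hv⟩ := (l6 v).1 hv
    exact (r3 I (l2 I hI)).1 hv
  rw [sum_map_card_eq (fun I hI => (r3 I (l2 I hI)).2), l1, t1] at l5
  have key : ∀ S : Finset V, Forest ℓ E ((X, Y) :: es) (U ∪ S) → Disjoint S (Z ∪ U' ∪ Z') →
      ∃ W, Lk ℓ E X (lastEnd (lastEnd Y es) es') W ∧
        X ∪ W ∪ lastEnd (lastEnd Y es) es' = U ∪ S ∪ U' ∪ Z ∪ Z' := by
    intro S h1 h2
    refine h1.concat_join f2 t2 l3 ?_ ?_ ?_ ?_ ?_ ?_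
    all_goals
      have r2' := r2.mono_left hZ'R
      have t4' := t4.mono_right (union_subset_union_right hZ'R)
      clear * - f3 r2' t4' h2
      simp only [disjoint_union_left, disjoint_union_right] at *
      simp only [disjoint_comm] at *
      tauto
  obtain ⟨W₀, h1, -⟩ := key ∅ (by simpa using f1) (disjoint_empty_left _)
  obtain ⟨I, i1, i2, i3⟩ := r4 _ _ h1.card_right h1.card_left h1.disjoint.1.symm L
    (by rw [l1, t1]; exact hs) l2
  have hIZ' : Disjoint Z' I := by
    rw [disjoint_right]
    intro v hv hv'
    obtain ⟨J, hJ, hvJ⟩ := (l6 v).1 hv'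
    exact disjoint_left.1 (i3 J hJ) hv hvJ
  obtain ⟨i4, i5⟩ := r3 I i1
  have e1 : Disjoint (U ∪ Z) U' := t4.symm.mono_left subset_union_left
  have e2 : Disjoint (U ∪ Z ∪ U') R := by
    clear * - r2 t4
    simp only [disjoint_union_left, disjoint_union_right] at *
    simp only [disjoint_comm] at *
    tauto
  have e3 : Disjoint (U ∪ Z ∪ U' ∪ Z') I :=
    disjoint_union_left.2 ⟨e2.mono_right i4, hIZ'⟩
  have hT : (U ∪ Z ∪ U' ∪ Z' ∪ I).card = U.card + Z.card + U'.card + Z'.card + I.card := by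
    rw [card_union_of_disjoint e3, card_union_of_disjoint (e2.mono_right hZ'R),
      card_union_of_disjoint e1, card_union_of_disjoint f3]
  have hS : (univ \ (U ∪ Z ∪ U' ∪ Z' ∪ I)).card + (U.card + Z.card + U'.card + Z'.card + I.card) =
      Fintype.card V := by
    rw [← hT, card_sdiff_add_card_eq_card (subset_univ _), card_univ]
  set S := univ \ (U ∪ Z ∪ U' ∪ Z' ∪ I) with hSdef
  obtain ⟨r, hr⟩ : ∃ r, S.card = r * (qc + ℓ) := by
    obtain ⟨z, hz⟩ := hdvd
    have : ((qc + ℓ : ℕ) : ℤ) ∣ (S.card : ℕ) := by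
      refine ⟨z - s * (M + 1), ?_⟩
      rw [hU, hZ, t3, l5, i5, hn, ht] at hS
      have hqc' : (qc : ℤ) = tc * p - ℓ := by rw [eq_sub_iff_add_eq]; exact_mod_cast hqc
      zify at hS
      push_cast
      rw [hqc'] at hS ⊢
      linear_combination hS + (p:ℤ) * hz
    obtain ⟨r, hr⟩ := Int.natCast_dvd_natCast.1 this
    exact ⟨r, by rw [hr, mul_comm]⟩
  have hdS : Disjoint S (U ∪ Z ∪ U' ∪ Z' ∪ I) := sdiff_disjoint
  have hrb : (r : ℝ) ≤ b := by
    have h3 : r * 1 ≤ r * (qc + ℓ) := by gcongr; omega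
    have h4 : r + (U.card + Z.card + s * (t * p + ℓ)) ≤ Fintype.card V := by omega
    have h5 : ((r + (U.card + Z.card + s * (t * p + ℓ)) : ℕ) : ℝ) ≤ Fintype.card V := by
      exact_mod_cast h4
    push_cast at h5 hb
    linarith
  obtain ⟨W, w1, w2⟩ := key S (f6 S r (hdS.symm.mono_left fun v hv => by simp [hv]) hr hrb) (by
    clear * - hdS
    simp only [disjoint_union_right] at *
    tauto)
  refine ⟨_, _, W, I, w1, i2, ?_, ?_⟩
  · rw [w2]
    clear * - hdS e3
    simp only [disjoint_union_left, disjoint_union_right] at *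
    tauto
  · rw [w2, hSdef]
    ext v
    simp only [mem_union, mem_sdiff, mem_univ, true_and, iff_true]
    clear * -
    tauto

set_option maxHeartbeats 1000000 in
theorem exists_closed_chain {q : ℕ} {k : ℕ} (hl : 1 ≤ ℓ) (hk : k = ℓ + q + ℓ) (hk4 : 4 ≤ k)
    (hp : 3 ≤ ℓ + q) (hq : 1 ≤ q)
    {c ξ ξ' : ℝ} (hc : c = 1 / (2 * ((ℓ + q : ℕ) : ℝ))) (hξ : 0 < ξ) (hξ1 : ξ ≤ 3 / 20)
    (hξ' : 0 < ξ') :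
    ∃ η : ℝ, 0 < η ∧ ∃ N : ℕ, ∀ (V : Type) [Fintype V] [DecidableEq V] (E : Finset (Finset V)),
      (∀ e ∈ E, e.card = k) → N ≤ Fintype.card V → (k - ℓ) ∣ Fintype.card V →
      DegCond (2 * c - c ^ 2 - η) k E →
      (∀ B : Finset V, (1 - c - ξ) * Fintype.card V ≤ B.card →
        ξ' ≤ pr (fun x : Role ℓ q → V => toF x ∈ E ∧ ∀ i, x i ∈ B)) →
      ∃ X Y W W' : Finset V, Lk ℓ E X Y W ∧ Lk ℓ E Y X W' ∧ Disjoint (X ∪ W ∪ Y) W' ∧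
        X ∪ W ∪ Y ∪ W' = univ := by
  have hkl : k - ℓ = ℓ + q := by omega
  have hc0 : 0 < c := by rw [hc]; positivity
  have hc6 : c ≤ 1 / 6 := by
    rw [hc]
    have : (3:ℝ) ≤ ((ℓ + q : ℕ) : ℝ) := by exact_mod_cast hp
    gcongr
    linarith
  obtain ⟨ηT, hηT, hηT1, hT⟩ := exists_tiling_avoiding hl hk hp hc hξ hξ1 hξ'
  obtain ⟨tc, htc, αc, hαc, Nc, hNc⟩ := exists_connecting k ℓ hk4 hl (by omega) (c / 2)
    (by positivity) (by linarith)
  rw [hkl] at hNc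
  obtain ⟨qc, hqc⟩ : ∃ qc, qc = tc * (ℓ + q) - ℓ := ⟨_, rfl⟩
  have hqcl : qc + ℓ = tc * (ℓ + q) := by
    have : 1 * (ℓ + q) ≤ tc * (ℓ + q) := by gcongr
    omega
  have hqc1 : 1 ≤ qc := by
    have : 1 * (ℓ + q) ≤ tc * (ℓ + q) := by gcongr
    omega
  rw [← hqc] at hNc
  obtain ⟨η₃, hη₃, hη₃T, hη₃c⟩ : ∃ η₃ : ℝ, 0 < η₃ ∧ η₃ ≤ ηT / 4 ∧ η₃ * qc ≤ αc / 4 := by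
    have : (0:ℝ) < qc := by exact_mod_cast hqc1
    refine ⟨min (ηT / 4) (αc / 4 / qc), by positivity, min_le_left _ _, ?_⟩
    rw [← le_div_iff₀ this]
    exact min_le_right _ _
  obtain ⟨hA, hA0, NA, hNA⟩ := exists_joined_absorber k ℓ hk4 hl (by omega) (c / 2)
    (by positivity) (by linarith) (qc := qc) hαc hη₃
  obtain ⟨β, hβ, hβA, hβT⟩ : ∃ β : ℝ, 0 < β ∧ β ≤ hA / 4 ∧ β ≤ ηT / 4 :=
    ⟨min (hA / 4) (ηT / 4), by positivity, min_le_left _ _, min_le_right _ _⟩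
  obtain ⟨hR, hR0, NR, hNR⟩ := exists_reservoir ℓ qc hαc hqc1 hη₃c hβ
  obtain ⟨ε, hε, hε2, hεA⟩ : ∃ ε : ℝ, 0 < ε ∧ ε ≤ 1 / 2 ∧ ε ≤ hA / 4 :=
    ⟨min (1 / 2) (hA / 4), by positivity, min_le_left _ _, min_le_right _ _⟩
  obtain ⟨M, hM⟩ := exists_nat_ge (max (8 / ε) (1 / hR))
  obtain ⟨t, ht⟩ : ∃ t, t = tc * M + 1 := ⟨_, rfl⟩
  have hMt : (M:ℝ) < t := by
    have : 1 * M ≤ tc * M := by gcongr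
    exact_mod_cast (by omega : M < t)
  have htε : 8 ≤ ε * t := by
    have := (le_max_left _ _).trans hM
    rw [div_le_iff₀ hε] at this
    exact (this.trans (mul_le_mul_of_nonneg_right hMt.le hε.le)).trans_eq (mul_comm _ _)
  have htR : 1 < hR * t := by
    have := (le_max_right _ _).trans hM
    rw [div_le_iff₀ hR0] at this
    exact (this.trans_lt (mul_lt_mul_of_pos_right hMt hR0)).trans_eq (mul_comm _ _)
  obtain ⟨NT, hNT⟩ := hT t ε hε (by linarith) htε
  obtain ⟨P, hP⟩ : ∃ P : ℕ, P = t * (ℓ + q) + ℓ := ⟨_, rfl⟩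
  have hPt : t ≤ P := by
    have : t * 1 ≤ t * (ℓ + q) := by gcongr; omega
    omega
  have hP0 : (0:ℝ) < P := by exact_mod_cast (by omega : 0 < P)
  rw [← hP] at hNT
  refine ⟨min ηT (c / 2), by positivity,
    Nc + NA + NR + NT + 4 * tc * P + ⌈(4 * tc * P : ℝ) / hA⌉₊ + 1,
    fun V _ _ E hE hN hdvd hdeg hrob => ?_⟩
  have hG : ∀ N ≤ Fintype.card V, Good k (c / 2) N E := fun N hN => by
    refine ⟨hE, hdeg.mono ?_, hN⟩
    have := min_le_right ηT (c / 2)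
    nlinarith
  have hC := hNc V E (hG _ (by omega))
  have hn1 : 4 * tc * P ≤ Fintype.card V := by omega
  have hn2 : (4 * tc * P : ℝ) ≤ hA * Fintype.card V := le_mul_of_ceil_le hA0 (by omega)
  have hn0 : (0:ℝ) < Fintype.card V := by exact_mod_cast (by omega : 0 < Fintype.card V)
  obtain ⟨X, Y, es, U, Z, f1, f2, f3, f4, f5, f6⟩ := hNA V E (hG _ (by omega)) hC
  obtain ⟨R, Q, r1, r2, r3, r4⟩ := hNR V E (by omega) hC (U ∪ Z) (by
    rw [card_union_of_disjoint f3]; exact_mod_cast f4)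
  have hW : (U ∪ Z ∪ R).card = U.card + Z.card + R.card := by
    rw [card_union_of_disjoint r2.symm, card_union_of_disjoint f3]
  have hWle : ((U ∪ Z ∪ R).card : ℝ) ≤ ηT / 2 * Fintype.card V := by
    rw [hW]; push_cast
    have h1 := mul_le_mul_of_nonneg_right hη₃T hn0.le
    have h2 := mul_le_mul_of_nonneg_right hβT hn0.le
    linarith
  have hWn : ((U ∪ Z ∪ R).card : ℝ) ≤ Fintype.card V / 2 := by
    have := mul_le_mul_of_nonneg_right hηT1 hn0.le
    linarith
  obtain ⟨n', hn'⟩ := hdvd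
  obtain ⟨m, hm⟩ := f1.card_eq hE (by omega)
  have hx0 : 0 ≤ (1 - ε) * (Fintype.card V - (U ∪ Z ∪ R).card) / P := by
    refine div_nonneg (mul_nonneg (by linarith) ?_) hP0.le
    linarith
  have hatc : tc ≤ ⌊(1 - ε) * (Fintype.card V - (U ∪ Z ∪ R).card) / P⌋₊ := by
    refine Nat.le_floor ?_
    rw [le_div_iff₀ hP0]
    have h1 : (4 * tc * P : ℝ) ≤ Fintype.card V := by exact_mod_cast hn1
    have h2 := mul_le_mul (by linarith : 1 / 2 ≤ 1 - ε)
      (by linarith : (Fintype.card V : ℝ) / 2 ≤ Fintype.card V - (U ∪ Z ∪ R).card)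
      (by positivity) (by linarith)
    linarith
  obtain ⟨s, s1, s2, s3⟩ := exists_le_modEq htc hatc ((n':ℤ) - (m + (es.length + 1) * tc))
  have s4 : (s:ℝ) * P ≤ (1 - ε) * (Fintype.card V - (U ∪ Z ∪ R).card) := by
    rw [← le_div_iff₀ hP0]
    exact (Nat.cast_le.2 s1).trans (Nat.floor_le hx0)
  have s5 : (1 - ε) * (Fintype.card V - (U ∪ Z ∪ R).card) < (s + tc : ℝ) * P := by
    rw [← div_lt_iff₀ hP0]
    exact_mod_cast (Nat.floor_lt hx0).1 s2
  have s6 : (s:ℝ) < hR * Fintype.card V := by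
    have h1 : (s:ℝ) * t ≤ s * P := by gcongr
    have h2 := mul_le_mul (by linarith : 1 - ε ≤ 1)
      (sub_le_self (Fintype.card V : ℝ) (Nat.cast_nonneg (U ∪ Z ∪ R).card)) (by linarith)
      zero_le_one
    have h3 := lt_mul_of_one_lt_left hn0 htR
    refine lt_of_mul_lt_mul_right (a := (t : ℝ)) ?_ (Nat.cast_nonneg t)
    linarith
  obtain ⟨es', U', t1, t2, t3, t4⟩ := hNT V E hE (by omega)
    (hdeg.mono (by linarith [min_le_left ηT (c / 2)])) hrob (U ∪ Z ∪ R)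
    (hWle.trans (by have := mul_pos hηT hn0; linarith)) s s4
  refine exists_closed_chain_of_absorber hl hqcl ht f1 f2 f3 (by simpa [hkl] using hm) f5
    f6 r2 r3 r4 t1 t2 (by rw [t3, hP]) t4 s6 (by rw [hn', hkl]) s3 ?_
  rw [← hP]
  rw [hW] at s5
  push_cast at s5
  have h1 : ε * Fintype.card V ≤ hA / 4 * Fintype.card V := by gcongr
  have h2 : β * Fintype.card V ≤ hA / 4 * Fintype.card V := by gcongr
  have h3 : 0 ≤ ε * (U.card + Z.card + R.card) := by positivity
  linarith

end Assembly

/-- Non-extremal case. For any `0 < ξ < 1` and all integers `k ≥ 4` and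
`1 ≤ ℓ < k/2` there exists `γ > 0` such that for sufficiently large `n` divisible by `k-ℓ`:
if `H` is a `k`-uniform hypergraph on `n` vertices which is not `(ℓ,ξ)`-extremal and
`δ_{k-2}(H) ≥ ((4(k-ℓ)-1)/(4(k-ℓ)²) - γ)·C(n,2)`, then `H` contains a Hamiltonian
ℓ-cycle. -/
theorem statement3 (ξ : ℝ) (hξ0 : 0 < ξ) (hξ1 : ξ < 1)
    (k ℓ : ℕ) (hk : 4 ≤ k) (hl : 1 ≤ ℓ) (hlk : 2 * ℓ < k) :
    ∃ γ : ℝ, 0 < γ ∧ ∃ n₀ : ℕ, ∀ n : ℕ, n₀ ≤ n → (k - ℓ) ∣ n →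
      ∀ E : Finset (Finset (Fin n)), Uniform n k E →
        ¬ IsExtremal n k ℓ E ξ →
        ((4 * ((k - ℓ : ℕ) : ℝ) - 1) / (4 * ((k - ℓ : ℕ) : ℝ) ^ 2) - γ) * (n.choose 2 : ℝ) ≤
          (minDeg n E (k - 2) : ℝ) →
        HasHamCycle n k ℓ E := by
  obtain ⟨q, hq⟩ : ∃ q, k = ℓ + q + ℓ := ⟨k - 2 * ℓ, by omega⟩
  obtain ⟨δ, hδ⟩ : ∃ δ, δ = ξ / (2 ^ k * k.factorial) := ⟨_, rfl⟩
  obtain ⟨c, hc⟩ : ∃ c : ℝ, c = 1 / (2 * ((ℓ + q : ℕ) : ℝ)) := ⟨_, rfl⟩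
  have hkl : k - ℓ = ℓ + q := by omega
  have hk4 : (4:ℝ) ≤ k := by exact_mod_cast hk
  have hδ0 : 0 < δ := by rw [hδ]; positivity
  have hδ1 : δ ≤ 1 := by
    rw [hδ]
    refine div_le_one_of_le₀ (hξ1.le.trans ?_) (by positivity)
    exact_mod_cast Nat.one_le_iff_ne_zero.2 (by positivity)
  have hδk : δ / (4 * k) ≤ 3 / 20 := by
    rw [div_le_iff₀ (by positivity)]
    linarith
  obtain ⟨η, hη, N, hN⟩ := exists_closed_chain (k := k) hl hq hk (by omega) (by omega) hc
    (ξ := δ / (4 * k)) (ξ' := δ / 2) (by positivity) hδk (by positivity)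
  have hp : (3:ℝ) ≤ ((ℓ + q : ℕ) : ℝ) := by exact_mod_cast (by omega : 3 ≤ ℓ + q)
  have hcc : (4 * ((k - ℓ : ℕ) : ℝ) - 1) / (4 * ((k - ℓ : ℕ) : ℝ) ^ 2) = 2 * c - c ^ 2 := by
    rw [hkl, hc]
    field_simp
    ring
  refine ⟨η / 2, by positivity, N + 2 * k + ⌈(2 : ℝ) / η⌉₊ + ⌈(4 * k : ℝ) / δ⌉₊,
    fun n hn hdvd E hE hX hdeg => ?_⟩
  have hn1 : 2 ≤ η * n := le_mul_of_ceil_le hη (by omega)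
  have hn2 : 4 * k ≤ δ * n := le_mul_of_ceil_le hδ0 (by omega)
  have hn0 : (0:ℝ) < n := by exact_mod_cast (by omega : 0 < n)
  rw [hcc] at hdeg
  have h1 : 2 * c - c ^ 2 - η / 2 ≤ 1 := by nlinarith [sq_nonneg (c - 1)]
  have h2 := (degCond_of_minDeg hE (by omega) (by omega) h1 hdeg).mono
    (d' := 2 * c - c ^ 2 - η) (by
      have : 1 / (n:ℝ) ≤ η / 2 := by
        rw [div_le_iff₀ hn0]
        linarith
      linarith)
  obtain ⟨X, Y, W, W', h3, h4, h5, h6⟩ := hN (Fin n) E hE (by rw [Fintype.card_fin]; omega)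
    (by rwa [Fintype.card_fin]) h2 fun B hB => by
      refine robust_of_not_isExtremal (by simp [hq]; omega) (by omega) hE hX hξ0 hδ (by omega)
        hn2 B ?_
      rwa [Fintype.card_fin, hc, ← hkl] at hB
  exact hasHamCycle_of_lk hE hlk (by omega) h3 h4 h5 h6
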